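/- There exist families {A_n}_{n≥1} and {B_{n,k}}_{n≥1,k≥1} of CNFs and constants d₁, d₂ > 0 such that A_n has size at most n^{d₁}, B_{n,k} has size at most n^{d₂·k} (for all n ≥ 2 and k ≥ 1), A_n and B_{n,k} share no propositional variables, and all of the following hold: (i) there exist α > 0 and an integer n₁ such that for every k ≥ 1 and every n ≥ n₁, every Res(k) refutation of A_n has size greater than 2^{n^α}; (ii) for every k ≥ 1 there exist β > 0 and an integer n₂ such that for every n ≥ n₂, every Res(k) refutation of B_{n,k} has size greater than 2^{β·n}; (iii) there is a constant c such that for all integers n ≥ 1 and k ≥ 1, the CNF A_n ∧ B_{n,k} has a Res(2) refutation of size at most c·k²·n^{7k+7}. -/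

import Mathlib

open Classical Finset

structure Lit (V : Type) where
  var : V
  pos : Bool
deriving DecidableEq

abbrev Clause (V : Type) := Finset (Lit V)
abbrev PTerm (V : Type) := Finset (Lit V)
abbrev Cnf (V : Type) := Finset (Clause V)
abbrev Dnf (V : Type) := Finset (PTerm V)

variable {V : Type} [DecidableEq V]

def Lit.neg (l : Lit V) : Lit V := ⟨l.var, !l.pos⟩

/-- A clause viewed as a 1-DNF. -/
def clauseToDnf (C : Clause V) : Dnf V := C.image (fun l => {l})

/-- A `k`-DNF: every term has at most `k` literals. -/
def IsKDnf (k : ℕ) (G : Dnf V) : Prop := ∀ q ∈ G, q.card ≤ k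

/-- The inference rules of Res(k): axiom, weakening, ∧-introduction and cut. -/
inductive ResKInf (k : ℕ) : List (Dnf V) → Dnf V → Prop
  | ax (x : V) :
      ResKInf k [] {{(⟨x, true⟩ : Lit V)}, {(⟨x, false⟩ : Lit V)}}
  | weaken (A B : Dnf V) : ResKInf k [A] (A ∪ B)
  | andIntro (A B : Dnf V) (l : Lit V) (q : PTerm V) (hq : q.card + 1 ≤ k) :
      ResKInf k [A ∪ {({l} : PTerm V)}, B ∪ {q}] (A ∪ B ∪ {insert l q})
  | cut (A B : Dnf V) (q : PTerm V) :
      ResKInf k [A ∪ {q}, B ∪ q.image (fun l => ({l.neg} : PTerm V))] (A ∪ B)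

/-- A Res(k) refutation of the CNF `F`: a sequence of k-DNFs, each a clause of `F`
or inferred from earlier lines, ending with the empty clause. -/
def IsResKRefutation (k : ℕ) (F : Set (Clause V)) (P : List (Dnf V)) : Prop :=
  P ≠ [] ∧ P.getLast? = some (∅ : Dnf V) ∧ (∀ G ∈ P, IsKDnf k G) ∧
  ∀ i : Fin P.length,
    (∃ C ∈ F, P.get i = clauseToDnf C) ∨
    ∃ prems : List (Dnf V), ResKInf k prems (P.get i) ∧
      ∀ Q ∈ prems, ∃ j : Fin P.length, (j : ℕ) < (i : ℕ) ∧ P.get j = Q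

/-- The number of symbols in a DNF. -/
def dnfSize (G : Dnf V) : ℕ := ∑ q ∈ G, (q.card + 1)

/-- The size (number of symbols) of a Res(k) refutation. -/
def proofSize (P : List (Dnf V)) : ℕ := (P.map dnfSize).sum

/-- The size (number of symbols) of a CNF. -/
def cnfSize (F : Cnf V) : ℕ := ∑ C ∈ F, (C.card + 1)

/-- The set of propositional variables occurring in a CNF. -/
def cnfVars (F : Cnf V) : Finset V := F.sup (fun C => C.image Lit.var)

def SatClauseA (a : V → Bool) (C : Clause V) : Prop := ∃ l ∈ C, a l.var = l.pos

/-- Unsatisfiability of a CNF. -/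
def Unsat (F : Set (Clause V)) : Prop := ¬ ∃ a : V → Bool, ∀ C ∈ F, SatClauseA a C

def litSatP (π : V → Option Bool) (l : Lit V) : Prop := π l.var = some l.pos
def litFalsP (π : V → Option Bool) (l : Lit V) : Prop := π l.var = some (!l.pos)

/-- A partial assignment satisfies a term if it satisfies all its literals. -/
def satPTerm (π : V → Option Bool) (q : PTerm V) : Prop := ∀ l ∈ q, litSatP π l
/-- A partial assignment falsifies a term if it falsifies some literal of it. -/
def falsPTerm (π : V → Option Bool) (q : PTerm V) : Prop := ∃ l ∈ q, litFalsP π l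

/-- The restriction of a DNF by a partial assignment: falsified terms are removed,
and satisfied literals are removed from the remaining terms. -/
noncomputable def restrictDnf (G : Dnf V) (π : V → Option Bool) : Dnf V :=
  (G.filter (fun q => ¬ falsPTerm π q)).image (fun q => q.filter (fun l => ¬ litSatP π l))

def clauseSatP (π : V → Option Bool) (C : Clause V) : Prop := ∃ l ∈ C, litSatP π l

/-- The restriction of a clause: falsified literals are removed. -/
noncomputable def restrictClause (C : Clause V) (π : V → Option Bool) : Clause V :=
  C.filter (fun l => ¬ litFalsP π l)

/-- The restriction of a CNF by a partial assignment: satisfied clauses are removed,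
falsified literals are removed from the remaining clauses. -/
def restrictCnfSet (F : Set (Clause V)) (π : V → Option Bool) : Set (Clause V) :=
  {E | ∃ C ∈ F, ¬ clauseSatP π C ∧ E = restrictClause C π}

/-- A resolution refutation of the CNF `F` (weakening is built into the rules). -/
def IsResRefutation (F : Set (Clause V)) (P : List (Clause V)) : Prop :=
  P ≠ [] ∧ P.getLast? = some (∅ : Clause V) ∧
  ∀ i : Fin P.length,
    (∃ C ∈ F, C ⊆ P.get i) ∨
    ∃ jv jw : Fin P.length, (jv : ℕ) < (i : ℕ) ∧ (jw : ℕ) < (i : ℕ) ∧ ∃ x : V,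
      (⟨x, true⟩ : Lit V) ∈ P.get jv ∧ (⟨x, false⟩ : Lit V) ∈ P.get jw ∧
      ((P.get jv).erase ⟨x, true⟩ ∪ (P.get jw).erase ⟨x, false⟩) ⊆ P.get i

set_option linter.unusedSectionVars false

section Matchings

variable {P H : Type} [Fintype P] [Fintype H] [DecidableEq P] [DecidableEq H]

/-- A set of pigeon-hole pairs is a matching if distinct pairs share no endpoint. -/
def IsMat (s : Finset (P × H)) : Prop :=
  ∀ e ∈ s, ∀ f ∈ s, (e.1 = f.1 ∨ e.2 = f.2) → e = f

/-- A term over matchings: each pigeon in `dom` must be sent to a hole allowed by `ok`. -/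
structure MTerm (P H : Type) where
  dom : Finset P
  ok : P → H → Prop

def MTerm.Sat (s : Finset (P × H)) (t : MTerm P H) : Prop :=
  ∀ i ∈ t.dom, ∃ y, (i, y) ∈ s ∧ t.ok i y

/-- A term is alive at `s` if some matching extending `s` satisfies it. -/
def MTerm.Alive (s : Finset (P × H)) (t : MTerm P H) : Prop :=
  ∃ m, IsMat m ∧ s ⊆ m ∧ t.Sat m

lemma IsMat.mono {s m : Finset (P × H)} (hm : IsMat m) (h : s ⊆ m) : IsMat s :=
  fun e he f hf hef => hm e (h he) f (h hf) hef

lemma MTerm.Sat.mono {s m : Finset (P × H)} {t : MTerm P H} (hs : t.Sat s) (h : s ⊆ m) :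
    t.Sat m := fun i hi => by
  obtain ⟨y, hy, hok⟩ := hs i hi
  exact ⟨y, h hy, hok⟩

lemma MTerm.Alive.anti {s m : Finset (P × H)} {t : MTerm P H} (ha : t.Alive m) (h : s ⊆ m) :
    t.Alive s := by
  obtain ⟨m', h1, h2, h3⟩ := ha
  exact ⟨m', h1, h.trans h2, h3⟩

lemma IsMat.insert_of_ne {s : Finset (P × H)} (hs : IsMat s) {e : P × H}
    (h1 : ∀ f ∈ s, f.1 ≠ e.1) (h2 : ∀ f ∈ s, f.2 ≠ e.2) : IsMat (insert e s) := by
  intro a ha b hb hab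
  rw [Finset.mem_insert] at ha hb
  rcases ha with rfl | ha <;> rcases hb with rfl | hb
  · rfl
  · rcases hab with h | h
    · exact absurd h.symm (h1 b hb)
    · exact absurd h.symm (h2 b hb)
  · rcases hab with h | h
    · exact absurd h (h1 a ha)
    · exact absurd h (h2 a ha)
  · exact hs a ha b hb hab

lemma IsMat.card_image_fst {s : Finset (P × H)} (hs : IsMat s) : (s.image Prod.fst).card = s.card :=
  Finset.card_image_of_injOn fun a ha b hb h => hs a ha b hb (Or.inl h)

lemma IsMat.card_image_snd {s : Finset (P × H)} (hs : IsMat s) : (s.image Prod.snd).card = s.card :=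
  Finset.card_image_of_injOn fun a ha b hb h => hs a ha b hb (Or.inr h)

lemma IsMat.exists_insert_fst {s : Finset (P × H)} (hs : IsMat s) (hc : s.card < Fintype.card H)
    (i : P) : ∃ m, IsMat m ∧ s ⊆ m ∧ m.card ≤ s.card + 1 ∧ ∃ e ∈ m, e.1 = i := by
  by_cases h : ∃ e ∈ s, e.1 = i
  · exact ⟨s, hs, subset_rfl, by omega, h⟩
  · push Not at h
    obtain ⟨y, -, hy⟩ : ∃ y ∈ (univ : Finset H), y ∉ s.image Prod.snd := by
      apply Finset.exists_mem_notMem_of_card_lt_card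
      rw [hs.card_image_snd]; simpa using hc
    refine ⟨insert (i, y) s, hs.insert_of_ne h ?_, Finset.subset_insert _ _, Finset.card_insert_le _ _,
      (i, y), by simp, rfl⟩
    intro f hf hfy
    exact hy (Finset.mem_image.2 ⟨f, hf, hfy⟩)

lemma IsMat.exists_insert_snd {s : Finset (P × H)} (hs : IsMat s) (hc : s.card < Fintype.card P)
    (y : H) : ∃ m, IsMat m ∧ s ⊆ m ∧ m.card ≤ s.card + 1 ∧ ∃ e ∈ m, e.2 = y := by
  by_cases h : ∃ e ∈ s, e.2 = y
  · exact ⟨s, hs, subset_rfl, by omega, h⟩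
  · push Not at h
    obtain ⟨i, -, hi⟩ : ∃ i ∈ (univ : Finset P), i ∉ s.image Prod.fst := by
      apply Finset.exists_mem_notMem_of_card_lt_card
      rw [hs.card_image_fst]; simpa using hc
    refine ⟨insert (i, y) s, hs.insert_of_ne ?_ h, Finset.subset_insert _ _, Finset.card_insert_le _ _,
      (i, y), by simp, rfl⟩
    intro f hf hfi
    exact hi (Finset.mem_image.2 ⟨f, hf, hfi⟩)

/-- Any small matching extends to one touching both endpoints of every pair in `g`. -/
lemma IsMat.exists_cover (hPH : Fintype.card H ≤ Fintype.card P) (g : Finset (P × H)) :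
    ∀ s : Finset (P × H), IsMat s → s.card + 2 * g.card ≤ Fintype.card H →
      ∃ m, IsMat m ∧ s ⊆ m ∧ m.card ≤ s.card + 2 * g.card ∧
        ∀ e ∈ g, (∃ f ∈ m, f.1 = e.1) ∧ ∃ f ∈ m, f.2 = e.2 := by
  induction g using Finset.induction_on with
  | empty => intro s hs _; exact ⟨s, hs, subset_rfl, by omega, by simp⟩
  | insert e g he ih =>
    intro s hs hc
    rw [Finset.card_insert_of_notMem he] at hc ⊢
    obtain ⟨m1, hm1, hs1, hc1, hcov⟩ := ih s hs (by omega)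
    obtain ⟨m2, hm2, hs2, hc2, f2, hf2, hfe2⟩ := hm1.exists_insert_fst (by omega) e.1
    obtain ⟨m3, hm3, hs3, hc3, f3, hf3, hfe3⟩ := hm2.exists_insert_snd (by omega) e.2
    refine ⟨m3, hm3, hs1.trans (hs2.trans hs3), by omega, ?_⟩
    intro e' he'
    rcases Finset.mem_insert.1 he' with rfl | he'
    · exact ⟨⟨f2, hs3 hf2, hfe2⟩, f3, hf3, hfe3⟩
    · obtain ⟨⟨a, ha, ha'⟩, b, hb, hb'⟩ := hcov e' he'
      exact ⟨⟨a, hs3 (hs2 ha), ha'⟩, b, hs3 (hs2 hb), hb'⟩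

noncomputable def firstAlive (G : List (MTerm P H)) (s : Finset (P × H)) : Option (MTerm P H) :=
  G.find? (fun t => decide (t.Alive s))

lemma firstAlive_mono {G : List (MTerm P H)} {s m : Finset (P × H)} {t : MTerm P H}
    (h : firstAlive G s = some t) (hsm : s ⊆ m) (hm : IsMat m) (hsat : t.Sat m) :
    firstAlive G m = some t := by
  unfold firstAlive at *
  rw [List.find?_eq_some_iff_append] at h ⊢
  obtain ⟨_, as, bs, rfl, has⟩ := h
  refine ⟨by simpa using ⟨m, hm, subset_rfl, hsat⟩, as, bs, rfl, ?_⟩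
  intro a ha
  have := has a ha
  simp only [Bool.not_eq_eq_eq_not, Bool.not_true, decide_eq_false_iff_not] at this ⊢
  exact fun hal => this (hal.anti hsm)

/-- The canonical decision process for `G` started at `s` can run for `h` rounds. -/
def Long (G : List (MTerm P H)) : ℕ → Finset (P × H) → Prop
  | 0, _ => True
  | h + 1, s => ∃ t g a, firstAlive G s = some t ∧ g.Nonempty ∧ IsMat (s ∪ g) ∧ Disjoint s g ∧
      t.Sat (s ∪ g) ∧ (∀ e ∈ g, e.1 ∈ t.dom) ∧ IsMat (s ∪ a) ∧ Disjoint s a ∧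
      (∀ e ∈ g, (∃ f ∈ a, f.1 = e.1) ∧ ∃ f ∈ a, f.2 = e.2) ∧ a.card ≤ 2 * g.card ∧
      Long G h (s ∪ a)

/-- `s` decides `G`: some term is satisfied, or all terms are dead. -/
def MDecides (G : List (MTerm P H)) (s : Finset (P × H)) : Prop :=
  (∃ t ∈ G, t.Sat s) ∨ ∀ t ∈ G, ¬ t.Alive s

/-- If the canonical process from `s` is short then it can be followed
alongside any small matching `m ⊇ s`. -/
lemma exists_decides_of_not_long (hPH : Fintype.card H ≤ Fintype.card P)
    {G : List (MTerm P H)} {base : Finset (P × H)} {w : ℕ}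
    (hw : ∀ t ∈ G, t.Alive base → (t.dom \ base.image Prod.fst).card ≤ w) :
    ∀ (h : ℕ) (s m : Finset (P × H)), base ⊆ s → s ⊆ m → IsMat m → ¬ Long G h s →
      m.card + 2 * w * h ≤ Fintype.card H →
      ∃ s' m', s ⊆ s' ∧ s' ⊆ m' ∧ m ⊆ m' ∧ IsMat m' ∧ s'.card ≤ s.card + 2 * w * h ∧
        m'.card ≤ m.card + 2 * w * h ∧ MDecides G s' := by
  intro h
  induction h with
  | zero => intro s m _ _ _ hl; exact absurd trivial hl
  | succ h ih =>
    intro s m hbs hsm hm hl hc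
    by_cases hd : MDecides G s
    · exact ⟨s, m, subset_rfl, hsm, subset_rfl, hm, by omega, by omega, hd⟩
    have hd' := hd
    unfold MDecides at hd
    push Not at hd
    obtain ⟨hns, t0, ht0, hal0⟩ := hd
    obtain ⟨t, ht⟩ : ∃ t, firstAlive G s = some t := by
      rw [← Option.isSome_iff_exists]
      unfold firstAlive
      rw [List.find?_isSome]
      exact ⟨t0, ht0, by simpa using hal0⟩
    have htG : t ∈ G := List.mem_of_find?_eq_some ht
    have hal : t.Alive s := by
      have := List.find?_some ht
      simpa using this
    obtain ⟨μ, hμ, hsμ, hsat⟩ := hal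
    set g := (μ \ s).filter (fun e => e.1 ∈ t.dom) with hg
    have hgμ : g ⊆ μ := fun e he => (Finset.mem_sdiff.1 (Finset.mem_filter.1 he).1).1
    have hsg : s ∪ g ⊆ μ := Finset.union_subset hsμ hgμ
    have hdisj : Disjoint s g := by
      rw [Finset.disjoint_left]
      intro e he he'
      exact (Finset.mem_sdiff.1 (Finset.mem_filter.1 he').1).2 he
    have hsatg : t.Sat (s ∪ g) := by
      intro i hi
      obtain ⟨y, hy, hok⟩ := hsat i hi
      refine ⟨y, ?_, hok⟩
      by_cases his : (i, y) ∈ s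
      · exact Finset.mem_union_left _ his
      · exact Finset.mem_union_right _ (by simp [hg, hy, his, hi])
    have hgne : g.Nonempty := by
      rw [Finset.nonempty_iff_ne_empty]
      intro h0
      rw [h0, Finset.union_empty] at hsatg
      exact hns t htG hsatg
    have hgs : ∀ e ∈ g, ∀ f ∈ s, e.1 ≠ f.1 ∧ e.2 ≠ f.2 := by
      intro e he f hf
      have hne : e ≠ f := fun h => (Finset.disjoint_left.1 hdisj hf) (h ▸ he)
      exact ⟨fun h => hne (hμ e (hgμ he) f (hsμ hf) (Or.inl h)),
        fun h => hne (hμ e (hgμ he) f (hsμ hf) (Or.inr h))⟩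
    have hgw : g.card ≤ w := by
      rw [← (hμ.mono hgμ).card_image_fst]
      refine le_trans (Finset.card_le_card ?_) (hw t htG (MTerm.Alive.anti (m := s) ⟨μ, hμ, hsμ, hsat⟩ hbs))
      intro i hi
      obtain ⟨e, he, rfl⟩ := Finset.mem_image.1 hi
      rw [Finset.mem_sdiff]
      refine ⟨(Finset.mem_filter.1 he).2, fun hb => ?_⟩
      obtain ⟨f, hf, hfe⟩ := Finset.mem_image.1 hb
      exact (hgs e he f (hbs hf)).1 hfe.symm
    have hmul : 2 * w * (h + 1) = 2 * w * h + 2 * w := by ring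
    obtain ⟨m1, hm1, hmm1, hc1, hcov⟩ := IsMat.exists_cover hPH g m hm (by omega)
    have hcov1 : ∀ e ∈ g, ∃ f ∈ m1, f.1 = e.1 := fun e he => (hcov e he).1
    have hcov2 : ∀ e ∈ g, ∃ f ∈ m1, f.2 = e.2 := fun e he => (hcov e he).2
    choose! f1 hf1 hf1' using hcov1
    choose! f2 hf2 hf2' using hcov2
    set a := g.image f1 ∪ g.image f2 with ha
    have ham1 : a ⊆ m1 := by
      intro e he
      rcases Finset.mem_union.1 he with he | he
      · obtain ⟨e', he', rfl⟩ := Finset.mem_image.1 he; exact hf1 e' he'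
      · obtain ⟨e', he', rfl⟩ := Finset.mem_image.1 he; exact hf2 e' he'
    have hac : a.card ≤ 2 * g.card := by
      refine (Finset.card_union_le _ _).trans ?_
      have h1 := Finset.card_image_le (s := g) (f := f1)
      have h2 := Finset.card_image_le (s := g) (f := f2)
      omega
    have hsa : Disjoint s a := by
      rw [Finset.disjoint_left]
      intro e he he'
      rcases Finset.mem_union.1 he' with he' | he'
      · obtain ⟨e', he'', rfl⟩ := Finset.mem_image.1 he'
        exact (hgs e' he'' _ he).1 (hf1' e' he'').symm
      · obtain ⟨e', he'', rfl⟩ := Finset.mem_image.1 he'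
        exact (hgs e' he'' _ he).2 (hf2' e' he'').symm
    have hsm1 : s ∪ a ⊆ m1 := Finset.union_subset (hsm.trans hmm1) ham1
    have hl' : ¬ Long G h (s ∪ a) := by
      intro hl'
      refine hl ⟨t, g, a, ht, hgne, hμ.mono hsg, hdisj, hsatg,
        fun e he => (Finset.mem_filter.1 he).2, hm1.mono hsm1, hsa, ?_, hac, hl'⟩
      intro e he
      exact ⟨⟨f1 e, Finset.mem_union_left _ (Finset.mem_image_of_mem _ he), hf1' e he⟩,
        f2 e, Finset.mem_union_right _ (Finset.mem_image_of_mem _ he), hf2' e he⟩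
    obtain ⟨s', m', h1, h2, h3, h4, h5, h6, h7⟩ := ih (s ∪ a) m1
      (hbs.trans Finset.subset_union_left) hsm1 hm1 hl' (by omega)
    have hcu := Finset.card_union_le s a
    exact ⟨s', m', Finset.subset_union_left.trans h1, h2, hmm1.trans h3, h4, by omega, by omega, h7⟩

end Matchings

section Pick

variable {α : Type}

/-- The elements of `X` whose positions in the enumeration of `X` are listed by `f`. -/
noncomputable def pick {n c : ℕ} (X : Finset α) (f : Fin n → Fin c) : Finset α :=
  X.filter (fun x => ∃ k, X.toList[(f k : ℕ)]? = some x)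

lemma exists_pick_eq {n c : ℕ} {X Y : Finset α} (hYX : Y ⊆ X) (hY : Y.Nonempty) (hX : X.card ≤ c)
    (hn : Y.card ≤ n) : ∃ f : Fin n → Fin c, pick X f = Y := by
  have hidx : ∀ y ∈ Y, ∃ i : Fin c, X.toList[(i : ℕ)]? = some y := by
    intro y hy
    obtain ⟨i, hi, h⟩ := List.getElem_of_mem (Finset.mem_toList.2 (hYX hy))
    rw [Finset.length_toList] at hi
    exact ⟨⟨i, by omega⟩, by rw [List.getElem?_eq_some_iff]; exact ⟨by simpa using hi, h⟩⟩
  obtain ⟨y0, hy0⟩ := hY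
  have : Nonempty (Fin c) := (hidx y0 hy0).nonempty
  choose! idx hidx using hidx
  refine ⟨fun k => idx ((Y.toList[(k : ℕ)]?).getD y0), ?_⟩
  have hmem : ∀ k : Fin n, (Y.toList[(k : ℕ)]?).getD y0 ∈ Y := by
    intro k
    cases h : Y.toList[(k : ℕ)]? with
    | none => simpa using hy0
    | some y => simpa using Finset.mem_toList.1 (List.mem_of_getElem? h)
  ext x
  simp only [pick, Finset.mem_filter]
  constructor
  · rintro ⟨-, k, hk⟩
    rw [hidx _ (hmem k)] at hk
    rw [← Option.some_injective _ hk]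
    exact hmem k
  · intro hx
    refine ⟨hYX hx, ?_⟩
    obtain ⟨i, hi, h⟩ := List.getElem_of_mem (Finset.mem_toList.2 hx)
    rw [Finset.length_toList] at hi
    refine ⟨⟨i, by omega⟩, ?_⟩
    have : Y.toList[i]? = some x := by
      rw [List.getElem?_eq_some_iff]; exact ⟨by simpa using hi, h⟩
    simp only [this, Option.getD_some]
    exact hidx x hx

end Pick

section Coding

variable {P H : Type} [Fintype P] [Fintype H] [DecidableEq P] [DecidableEq H]

/-- The pairs both of whose endpoints are free. -/
def freeEdges (s : Finset (P × H)) : Finset (P × H) :=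
  (univ \ s.image Prod.fst) ×ˢ (univ \ s.image Prod.snd)

lemma mem_freeEdges {s : Finset (P × H)} {e : P × H} :
    e ∈ freeEdges s ↔ (∀ f ∈ s, f.1 ≠ e.1) ∧ ∀ f ∈ s, f.2 ≠ e.2 := by
  simp only [freeEdges, Finset.mem_product, Finset.mem_sdiff, Finset.mem_univ, true_and,
    Finset.mem_image, not_exists, not_and]

lemma IsMat.card_freeEdges {s : Finset (P × H)} (hs : IsMat s) :
    (freeEdges s).card = (Fintype.card P - s.card) * (Fintype.card H - s.card) := by
  rw [freeEdges, Finset.card_product, Finset.card_univ_sdiff, Finset.card_univ_sdiff,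
    hs.card_image_fst, hs.card_image_snd]

/-- Matchings with `j` pairs that extend `base`. -/
noncomputable def mats (base : Finset (P × H)) (j : ℕ) : Finset (Finset (P × H)) :=
  univ.filter (fun m => IsMat m ∧ base ⊆ m ∧ m.card = j)

lemma mem_mats {base m : Finset (P × H)} {j : ℕ} :
    m ∈ mats base j ↔ IsMat m ∧ base ⊆ m ∧ m.card = j := by simp [mats]

lemma card_mats_succ_mul_le (base : Finset (P × H)) (j : ℕ) :
    (mats base (j + 1)).card * (j + 1 - base.card) ≤
      (mats base j).card * ((Fintype.card P - j) * (Fintype.card H - j)) := by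
  refine Finset.card_mul_le_card_mul (fun m n => n ⊆ m) ?_ ?_
  · intro m hm
    obtain ⟨hmm, hbm, hc⟩ := mem_mats.1 hm
    have : (m \ base).card = j + 1 - base.card := by rw [Finset.card_sdiff_of_subset hbm, hc]
    rw [← this, ← Finset.card_image_of_injOn (s := m \ base) (f := fun e => m.erase e)]
    · refine Finset.card_le_card ?_
      intro n hn
      obtain ⟨e, he, rfl⟩ := Finset.mem_image.1 hn
      rw [Finset.mem_sdiff] at he
      rw [Finset.mem_bipartiteAbove]
      refine ⟨mem_mats.2 ⟨hmm.mono (Finset.erase_subset _ _), ?_, ?_⟩, Finset.erase_subset _ _⟩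
      · intro f hf
        exact Finset.mem_erase.2 ⟨fun h => he.2 (h ▸ hf), hbm hf⟩
      · rw [Finset.card_erase_of_mem he.1, hc]; rfl
    · intro e he f hf h
      exact Finset.erase_injOn m (Finset.mem_sdiff.1 he).1 (Finset.mem_sdiff.1 hf).1 h
  · intro n hn
    obtain ⟨hn1, hn2, hn3⟩ := mem_mats.1 hn
    rw [← hn3, ← hn1.card_freeEdges]
    refine (Finset.card_le_card (t := (freeEdges n).image (fun e => insert e n)) ?_).trans
      Finset.card_image_le
    intro m hm
    rw [Finset.mem_bipartiteBelow] at hm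
    obtain ⟨hm, hnm⟩ := hm
    obtain ⟨hm1, hm2, hm3⟩ := mem_mats.1 hm
    have hc : (m \ n).card = 1 := by rw [Finset.card_sdiff_of_subset hnm]; omega
    obtain ⟨e, he⟩ := Finset.card_eq_one.1 hc
    have hem : e ∈ m \ n := by rw [he]; simp
    rw [Finset.mem_sdiff] at hem
    refine Finset.mem_image.2 ⟨e, mem_freeEdges.2 ⟨?_, ?_⟩, ?_⟩
    · intro f hf h
      exact hem.2 (hm1 f (hnm hf) e hem.1 (Or.inl h) ▸ hf)
    · intro f hf h
      exact hem.2 (hm1 f (hnm hf) e hem.1 (Or.inr h) ▸ hf)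
    · rw [Finset.insert_eq, ← he, Finset.sdiff_union_of_subset hnm]

abbrev Code (w Λ : ℕ) : Type :=
  Σ r : Fin w, (Fin (r + 1) → Fin w) × (Fin (2 * (r + 1)) → Fin Λ)

def Code.weight {w Λ : ℕ} (c : Code w Λ) : ℕ := c.1 + 1

/-- Undo one round of the canonical decision process from its code, continuing with `rec`. -/
noncomputable def decodeStep (G : List (MTerm P H)) (base : Finset (P × H)) {w Λ : ℕ}
    (c : Code w Λ) (μ : Finset (P × H)) (rec : Finset (P × H) → Finset (P × H)) :
    Finset (P × H) :=
  match firstAlive G μ with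
  | none => ∅
  | some t =>
    let I := pick (t.dom \ base.image Prod.fst) c.2.1
    let rest := μ \ μ.filter (fun e => e.1 ∈ I)
    let a := pick (freeEdges rest) c.2.2
    rec (rest ∪ a) \ a

noncomputable def decode (G : List (MTerm P H)) (base : Finset (P × H)) {w Λ : ℕ} :
    List (Code w Λ) → Finset (P × H) → Finset (P × H)
  | [], μ => μ
  | c :: cs, μ => decodeStep G base c μ (decode G base cs)

lemma exists_code_of_long {G : List (MTerm P H)} {base : Finset (P × H)} {w Λ j : ℕ}
    (hw : ∀ t ∈ G, t.Alive base → (t.dom \ base.image Prod.fst).card ≤ w)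
    (hΛ : (Fintype.card P - j) * (Fintype.card H - j) ≤ Λ) :
    ∀ (h : ℕ) (s : Finset (P × H)), IsMat s → base ⊆ s → j ≤ s.card → Long G h s →
      ∃ (cs : List (Code w Λ)) (μ : Finset (P × H)), cs.length = h ∧ IsMat μ ∧ s ⊆ μ ∧
        μ.card = s.card + (cs.map Code.weight).sum ∧ decode G base cs μ = s := by
  intro h
  induction h with
  | zero => intro s hs _ _ _; exact ⟨[], s, rfl, hs, subset_rfl, by simp, rfl⟩
  | succ h ih =>
    rintro s hs hbs hj ⟨t, g, a, ht, hgne, hsg, hdg, hsat, hgdom, hsa, hda, hcov, hac, hl⟩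
    obtain ⟨cs, μ1, hlen, hμ1, hsub, hcard, hdec⟩ := ih (s ∪ a) hsa
      (hbs.trans Finset.subset_union_left)
      (hj.trans (Finset.card_le_card Finset.subset_union_left)) hl
    have hsμ1 : s ⊆ μ1 := Finset.subset_union_left.trans hsub
    have haμ1 : a ⊆ μ1 := Finset.subset_union_right.trans hsub
    have hsr : s ⊆ μ1 \ a := fun e he =>
      Finset.mem_sdiff.2 ⟨hsμ1 he, Finset.disjoint_left.1 hda he⟩
    have hfree : ∀ e ∈ g, ∀ f ∈ μ1 \ a, f.1 ≠ e.1 ∧ f.2 ≠ e.2 := by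
      intro e he f hf
      rw [Finset.mem_sdiff] at hf
      obtain ⟨⟨f1, hf1, h1⟩, f2, hf2, h2⟩ := hcov e he
      refine ⟨fun h => hf.2 ?_, fun h => hf.2 ?_⟩
      · rw [hμ1 f hf.1 f1 (haμ1 hf1) (Or.inl (h.trans h1.symm))]; exact hf1
      · rw [hμ1 f hf.1 f2 (haμ1 hf2) (Or.inr (h.trans h2.symm))]; exact hf2
    have hdrg : Disjoint (μ1 \ a) g := by
      rw [Finset.disjoint_left]
      intro e he he'
      exact (hfree e he' e he).1 rfl
    have hgm : IsMat g := hsg.mono Finset.subset_union_right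
    set μ := (μ1 \ a) ∪ g with hμdef
    have hμ : IsMat μ := by
      intro e he f hf hef
      rcases Finset.mem_union.1 he with he | he <;> rcases Finset.mem_union.1 hf with hf | hf
      · exact hμ1 e (Finset.mem_sdiff.1 he).1 f (Finset.mem_sdiff.1 hf).1 hef
      · exact absurd hef (not_or.2 (hfree f hf e he))
      · exact absurd (hef.imp Eq.symm Eq.symm) (not_or.2 (hfree e he f hf))
      · exact hgm e he f hf hef
    have hsgμ : s ∪ g ⊆ μ := Finset.union_subset_union_left hsr
    have hsμ : s ⊆ μ := Finset.subset_union_left.trans hsgμ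
    have htμ : firstAlive G μ = some t :=
      firstAlive_mono ht hsμ hμ (hsat.mono hsgμ)
    have htG : t ∈ G := List.mem_of_find?_eq_some ht
    have htb : t.Alive base := ⟨_, hsg, hbs.trans Finset.subset_union_left, hsat⟩
    set D := t.dom \ base.image Prod.fst with hD
    have hI : g.image Prod.fst ⊆ D := by
      intro i hi
      obtain ⟨e, he, rfl⟩ := Finset.mem_image.1 hi
      refine Finset.mem_sdiff.2 ⟨hgdom e he, fun hb => ?_⟩
      obtain ⟨f, hf, hfe⟩ := Finset.mem_image.1 hb
      exact (hfree e he f (hsr (hbs hf))).1 hfe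
    have hgc : (g.image Prod.fst).card = g.card := hgm.card_image_fst
    have hDw : D.card ≤ w := hw t htG htb
    have hgw : g.card ≤ w := by rw [← hgc]; exact (Finset.card_le_card hI).trans hDw
    have hgpos : 0 < g.card := hgne.card_pos
    have hane : a.Nonempty := by
      obtain ⟨e, he⟩ := hgne
      obtain ⟨f, hf, -⟩ := (hcov e he).1
      exact ⟨f, hf⟩
    have hrm : IsMat (μ1 \ a) := hμ1.mono Finset.sdiff_subset
    have hafree : a ⊆ freeEdges (μ1 \ a) := by
      intro e he
      refine mem_freeEdges.2 ⟨fun f hf h => ?_, fun f hf h => ?_⟩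
      · rw [Finset.mem_sdiff] at hf
        exact hf.2 (hμ1 f hf.1 e (haμ1 he) (Or.inl h) ▸ he)
      · rw [Finset.mem_sdiff] at hf
        exact hf.2 (hμ1 f hf.1 e (haμ1 he) (Or.inr h) ▸ he)
    have hXc : (freeEdges (μ1 \ a)).card ≤ Λ := by
      rw [hrm.card_freeEdges]
      have : j ≤ (μ1 \ a).card := hj.trans (Finset.card_le_card hsr)
      exact (Nat.mul_le_mul (by omega) (by omega)).trans hΛ
    have hrw : g.card - 1 + 1 = g.card := by omega
    obtain ⟨f1, hf1⟩ := exists_pick_eq (n := g.card - 1 + 1) hI (hgne.image _) hDw (by omega)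
    obtain ⟨f2, hf2⟩ := exists_pick_eq (n := 2 * (g.card - 1 + 1)) hafree hane hXc (by omega)
    refine ⟨⟨⟨g.card - 1, by omega⟩, f1, f2⟩ :: cs, μ, by simp [hlen], hμ, hsμ, ?_, ?_⟩
    · rw [hμdef, Finset.card_union_of_disjoint hdrg, Finset.card_sdiff_of_subset haμ1, hcard,
        Finset.card_union_of_disjoint hda]
      simp only [List.map_cons, List.sum_cons, Code.weight]
      omega
    · have hflt : μ.filter (fun e => e.1 ∈ g.image Prod.fst) = g := by
        ext e
        rw [Finset.mem_filter, hμdef, Finset.mem_union]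
        constructor
        · rintro ⟨he | he, hi⟩
          · obtain ⟨f, hf, hfe⟩ := Finset.mem_image.1 hi
            exact absurd hfe.symm (hfree f hf e he).1
          · exact he
        · exact fun he => ⟨Or.inr he, Finset.mem_image_of_mem _ he⟩
      have hrest : μ \ g = μ1 \ a := by
        rw [hμdef, Finset.union_sdiff_right, Finset.sdiff_eq_self_of_disjoint hdrg]
      simp only [decode, decodeStep, htμ]
      rw [← hD, hf1, hflt, hrest, hf2, Finset.sdiff_union_of_subset haμ1, hdec,
        Finset.union_sdiff_right, Finset.sdiff_eq_self_of_disjoint hda]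

/-- The switching lemma for matchings: few matchings have a long decision process. -/
lemma card_long_le {G : List (MTerm P H)} {base : Finset (P × H)} {w Λ j : ℕ} {θ : ℝ}
    (hw : ∀ t ∈ G, t.Alive base → (t.dom \ base.image Prod.fst).card ≤ w)
    (hΛ : (Fintype.card P - j) * (Fintype.card H - j) ≤ Λ) (hθ : 0 ≤ θ)
    (hθ1 : (Λ : ℝ) ≤ θ * ((j + 1 - base.card : ℕ) : ℝ)) (hb : base.card ≤ j)
    (hs : (w : ℝ) * Λ ^ 2 * θ ≤ 1) (h : ℕ) :
    (((mats base j).filter (Long G h)).card : ℝ) ≤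
      (w * (w * Λ ^ 2 * θ)) ^ h * (mats base j).card := by
  have hstep : ∀ d, ((mats base (j + d)).card : ℝ) ≤ θ ^ d * (mats base j).card := by
    intro d
    induction d with
    | zero => simp
    | succ d ih =>
      have h1 := card_mats_succ_mul_le base (j + d)
      have h2 : (Fintype.card P - (j + d)) * (Fintype.card H - (j + d)) ≤ Λ :=
        (Nat.mul_le_mul (by omega) (by omega)).trans hΛ
      have h3 : ((mats base (j + (d + 1))).card : ℝ) * ((j + 1 - base.card : ℕ) : ℝ) ≤
          (mats base (j + d)).card * (Λ : ℝ) := by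
        have h4 : (mats base (j + (d + 1))).card * (j + 1 - base.card) ≤
            (mats base (j + d)).card * Λ :=
          (Nat.mul_le_mul_left _ (by omega)).trans (h1.trans (Nat.mul_le_mul_left _ h2))
        exact_mod_cast h4
      have hpos : (0 : ℝ) < ((j + 1 - base.card : ℕ) : ℝ) := by
        exact_mod_cast (by omega : 0 < j + 1 - base.card)
      have h5 : ((mats base (j + d)).card : ℝ) * (Λ : ℝ) ≤
          ((mats base (j + d)).card * θ) * ((j + 1 - base.card : ℕ) : ℝ) := by
        rw [mul_assoc]
        exact mul_le_mul_of_nonneg_left hθ1 (by positivity)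
      have h6 := le_of_mul_le_mul_right (h3.trans h5) hpos
      calc ((mats base (j + (d + 1))).card : ℝ) ≤ (mats base (j + d)).card * θ := h6
        _ ≤ (θ ^ d * (mats base j).card) * θ := by gcongr
        _ = θ ^ (d + 1) * (mats base j).card := by ring
  have hsub : (mats base j).filter (Long G h) ⊆
      (univ : Finset (Fin h → Code w Λ)).biUnion (fun c =>
        (mats base (j + ∑ i, (c i).weight)).image (decode G base (List.ofFn c))) := by
    intro s hs
    obtain ⟨hs, hl⟩ := Finset.mem_filter.1 hs
    obtain ⟨hs1, hs2, hs3⟩ := mem_mats.1 hs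
    obtain ⟨cs, μ, hlen, hμ, hsμ, hc, hd⟩ :=
      exists_code_of_long (w := w) (Λ := Λ) (j := j) hw hΛ h s hs1 hs2 hs3.ge hl
    subst hlen
    refine Finset.mem_biUnion.2 ⟨fun i => cs.get i, Finset.mem_univ _,
      Finset.mem_image.2 ⟨μ, mem_mats.2 ⟨hμ, hs2.trans hsμ, ?_⟩, ?_⟩⟩
    · rw [hc, hs3]
      congr 1
      conv_lhs => rw [← List.ofFn_get cs]
      rw [List.map_ofFn, List.sum_ofFn]
      rfl
    · rw [List.ofFn_get]; exact hd
  have hsum : ∑ c : Code w Λ, θ ^ c.weight ≤ w * (w * Λ ^ 2 * θ) := by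
    rw [Fintype.sum_sigma]
    have : ∀ r : Fin w, ∑ x : (Fin (r + 1) → Fin w) × (Fin (2 * (r + 1)) → Fin Λ),
        θ ^ (Code.weight (⟨r, x⟩ : Code w Λ)) ≤ w * Λ ^ 2 * θ := by
      intro r
      simp only [Code.weight, Finset.sum_const, Finset.card_univ, nsmul_eq_mul,
        Fintype.card_prod, Fintype.card_fun, Fintype.card_fin, Nat.cast_mul, Nat.cast_pow]
      have : (w : ℝ) ^ ((r : ℕ) + 1) * (Λ : ℝ) ^ (2 * ((r : ℕ) + 1)) * θ ^ ((r : ℕ) + 1) =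
          (w * Λ ^ 2 * θ) ^ ((r : ℕ) + 1) := by
        rw [mul_pow, mul_pow, ← pow_mul]
      rw [this]
      exact (pow_le_pow_of_le_one (by positivity) hs (by omega : 1 ≤ (r : ℕ) + 1)).trans
        (by rw [pow_one])
    refine (Finset.sum_le_sum fun r _ => this r).trans ?_
    simp
  have hnat : ((mats base j).filter (Long G h)).card ≤
      ∑ c : Fin h → Code w Λ, (mats base (j + ∑ i, (c i).weight)).card :=
    (Finset.card_le_card hsub).trans (Finset.card_biUnion_le.trans
      (Finset.sum_le_sum fun c _ => Finset.card_image_le))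
  calc (((mats base j).filter (Long G h)).card : ℝ)
      ≤ ∑ c : Fin h → Code w Λ, ((mats base (j + ∑ i, (c i).weight)).card : ℝ) := by
        exact_mod_cast hnat
    _ ≤ ∑ c : Fin h → Code w Λ, (∏ i, θ ^ (c i).weight) * (mats base j).card := by
        refine Finset.sum_le_sum fun c _ => ?_
        rw [Finset.prod_pow_eq_pow_sum]
        exact hstep _
    _ = (∑ c : Code w Λ, θ ^ c.weight) ^ h * (mats base j).card := by
        rw [← Finset.sum_mul, Fintype.sum_pow]
    _ ≤ _ := by
        gcongr

end Coding

section Restriction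

variable {P H : Type} [Fintype P] [Fintype H] [DecidableEq P] [DecidableEq H]

lemma IsMat.insert_freeEdge {s : Finset (P × H)} (hs : IsMat s) {e : P × H}
    (he : e ∈ freeEdges s) : IsMat (insert e s) :=
  hs.insert_of_ne (mem_freeEdges.1 he).1 (mem_freeEdges.1 he).2

lemma mats_nonempty (hPH : Fintype.card H ≤ Fintype.card P) {s : Finset (P × H)} (hs : IsMat s)
    {j : ℕ} (hsj : s.card ≤ j) (hj : j ≤ Fintype.card H) : (mats s j).Nonempty := by
  induction j, hsj using Nat.le_induction with
  | base => exact ⟨s, mem_mats.2 ⟨hs, subset_rfl, rfl⟩⟩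
  | succ j hsj ih =>
    obtain ⟨m, hm⟩ := ih (by omega)
    obtain ⟨h1, h2, h3⟩ := mem_mats.1 hm
    have : 0 < (freeEdges m).card := by
      rw [h1.card_freeEdges]
      exact Nat.mul_pos (by omega) (by omega)
    obtain ⟨e, he⟩ := Finset.card_pos.1 this
    have hem : e ∉ m := fun h => (mem_freeEdges.1 he).1 e h rfl
    exact ⟨insert e m, mem_mats.2 ⟨h1.insert_freeEdge he, h2.trans (Finset.subset_insert _ _),
      by rw [Finset.card_insert_of_notMem hem, h3]⟩⟩

/-- A small matching makes all terms of a small family dead or narrow. -/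
lemma exists_narrowing {m w : ℕ} (hH : Fintype.card H = m) (hP : Fintype.card P = m + 1)
    (T : Finset (MTerm P H))
    (hT : ∀ t ∈ T, ∀ i ∈ t.dom, m ≤ 2 * (univ.filter (fun y => ¬ t.ok i y)).card)
    (hw : w ≤ 4 * (m + 1)) (c : ℕ) (hc : 4 * c ≤ m) :
    ∃ s : Finset (P × H), IsMat s ∧ s.card ≤ c ∧
      ((T.filter (fun t => t.Alive s ∧ w < (t.dom \ s.image Prod.fst).card)).card : ℝ) ≤
        T.card * (1 - (w : ℝ) / (4 * (m + 1))) ^ c := by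
  induction c with
  | zero =>
    refine ⟨∅, fun e he => by simp at he, by simp, ?_⟩
    simp only [pow_zero, mul_one]
    exact_mod_cast Finset.card_filter_le _ _
  | succ c ih =>
    obtain ⟨s, hs, hsc, hb⟩ := ih (by omega)
    set δ : ℝ := (w : ℝ) / (4 * (m + 1)) with hδ
    have hm0 : (0 : ℝ) < 4 * (m + 1) := by positivity
    have hδ1 : δ ≤ 1 := by
      rw [hδ, div_le_one hm0]
      exact_mod_cast hw
    set bad : Finset (P × H) → Finset (MTerm P H) := fun s =>
      T.filter (fun t => t.Alive s ∧ w < (t.dom \ s.image Prod.fst).card) with hbad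
    change ((bad s).card : ℝ) ≤ _ at hb
    let kills : P × H → MTerm P H → Prop := fun e t => e.1 ∈ t.dom ∧ ¬ t.ok e.1 e.2
    have hfc : (freeEdges s).card ≤ (m + 1) * m := by
      rw [hs.card_freeEdges, hP, hH]
      exact Nat.mul_le_mul (Nat.sub_le _ _) (Nat.sub_le _ _)
    have hfree : (freeEdges s).Nonempty := by
      rw [← Finset.card_pos, hs.card_freeEdges]
      exact Nat.mul_pos (by omega) (by omega)
    have hkill : ∀ t ∈ bad s,
        (w : ℝ) * m / 4 ≤ ((freeEdges s).filter (fun e => kills e t)).card := by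
      intro t ht
      obtain ⟨htT, -, htw⟩ := Finset.mem_filter.1 ht
      have hsub : (t.dom \ s.image Prod.fst).sigma
          (fun i => univ.filter (fun y => ¬ t.ok i y) \ s.image Prod.snd) ⊆
          ((freeEdges s).filter (fun e => kills e t)).image (fun e => (⟨e.1, e.2⟩ : Σ _ : P, H)) := by
        rintro ⟨i, y⟩ hiy
        simp only [Finset.mem_sigma, Finset.mem_sdiff, Finset.mem_filter, Finset.mem_univ,
          true_and] at hiy
        refine Finset.mem_image.2 ⟨(i, y), Finset.mem_filter.2 ⟨?_, hiy.1.1, hiy.2.1⟩, rfl⟩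
        simp only [freeEdges, Finset.mem_product, Finset.mem_sdiff, Finset.mem_univ, true_and]
        exact ⟨hiy.1.2, hiy.2.2⟩
      have h1 := (Finset.card_le_card hsub).trans Finset.card_image_le
      rw [Finset.card_sigma] at h1
      have h2 : ∀ i ∈ t.dom \ s.image Prod.fst,
          (m : ℝ) / 4 ≤ ((univ.filter (fun y => ¬ t.ok i y) \ s.image Prod.snd).card : ℝ) := by
        intro i hi
        have h3 := hT t htT i (Finset.mem_sdiff.1 hi).1
        have h4 := Finset.le_card_sdiff (s.image Prod.snd) (univ.filter (fun y => ¬ t.ok i y))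
        rw [hs.card_image_snd] at h4
        have h5 : m ≤ 4 * (univ.filter (fun y => ¬ t.ok i y) \ s.image Prod.snd).card := by omega
        have h6 : (m : ℝ) ≤
            4 * ((univ.filter (fun y => ¬ t.ok i y) \ s.image Prod.snd).card : ℝ) := by
          exact_mod_cast h5
        linarith
      calc (w : ℝ) * m / 4 ≤ (t.dom \ s.image Prod.fst).card * ((m : ℝ) / 4) := by
            have : (w : ℝ) ≤ (t.dom \ s.image Prod.fst).card := by exact_mod_cast htw.le
            rw [mul_div_assoc]
            exact mul_le_mul_of_nonneg_right this (by positivity)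
        _ ≤ ∑ i ∈ t.dom \ s.image Prod.fst,
              ((univ.filter (fun y => ¬ t.ok i y) \ s.image Prod.snd).card : ℝ) := by
            rw [← nsmul_eq_mul]
            exact Finset.card_nsmul_le_sum _ _ _ h2
        _ ≤ _ := by exact_mod_cast h1
    obtain ⟨e, he, hek⟩ : ∃ e ∈ freeEdges s,
        ((bad s).card : ℝ) * δ ≤ (((bad s).filter (fun t => kills e t)).card : ℝ) := by
      refine Finset.exists_le_of_sum_le hfree ?_
      have hswap : ∑ e ∈ freeEdges s, (((bad s).filter (fun t => kills e t)).card : ℝ) =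
          ∑ t ∈ bad s, (((freeEdges s).filter (fun e => kills e t)).card : ℝ) := by
        exact_mod_cast Finset.sum_card_bipartiteAbove_eq_sum_card_bipartiteBelow
          (s := freeEdges s) (t := bad s) kills
      rw [hswap]
      calc ∑ e ∈ freeEdges s, ((bad s).card : ℝ) * δ = (freeEdges s).card * ((bad s).card * δ) := by
            simp
        _ ≤ ((m + 1) * m) * ((bad s).card * δ) := by
            have : ((freeEdges s).card : ℝ) ≤ (m + 1) * m := by exact_mod_cast hfc
            exact mul_le_mul_of_nonneg_right this (by positivity)
        _ = (bad s).card * ((w : ℝ) * m / 4) := by rw [hδ]; field_simp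
        _ ≤ _ := by
            rw [← nsmul_eq_mul]
            exact Finset.card_nsmul_le_sum _ _ _ hkill
    have hins : IsMat (insert e s) := hs.insert_freeEdge he
    refine ⟨insert e s, hins, (Finset.card_insert_le _ _).trans (by omega), ?_⟩
    have hsub : bad (insert e s) ⊆ bad s \ (bad s).filter (fun t => kills e t) := by
      intro t ht
      obtain ⟨htT, hal, htw⟩ := Finset.mem_filter.1 ht
      refine Finset.mem_sdiff.2 ⟨Finset.mem_filter.2 ⟨htT, hal.anti (Finset.subset_insert _ _),
        htw.trans_le (Finset.card_le_card (Finset.sdiff_subset_sdiff subset_rfl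
          (Finset.image_subset_image (Finset.subset_insert _ _))))⟩, fun hk => ?_⟩
      replace hk := (Finset.mem_filter.1 hk).2
      obtain ⟨μ, hμ, hsμ, hsat⟩ := hal
      obtain ⟨y, hy, hok⟩ := hsat e.1 hk.1
      have := hμ e (hsμ (Finset.mem_insert_self _ _)) (e.1, y) hy (Or.inl rfl)
      rw [this] at hk
      exact hk.2 hok
    have h7 : (bad (insert e s)).card + ((bad s).filter (fun t => kills e t)).card ≤
        (bad s).card := by
      have h8 := Finset.card_le_card hsub
      rw [Finset.card_sdiff_of_subset (Finset.filter_subset _ _)] at h8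
      have := Finset.card_filter_le (bad s) (fun t => kills e t)
      omega
    have h9 : ((bad (insert e s)).card : ℝ) + ((bad s).filter (fun t => kills e t)).card ≤
        (bad s).card := by exact_mod_cast h7
    change ((bad (insert e s)).card : ℝ) ≤ _
    calc ((bad (insert e s)).card : ℝ) ≤ (bad s).card * (1 - δ) := by linarith
      _ ≤ (T.card * (1 - δ) ^ c) * (1 - δ) := by
          exact mul_le_mul_of_nonneg_right hb (by linarith)
      _ = _ := by ring

/-- If all terms are narrow, some matching makes the decision processes of few lines short. -/
lemma exists_short {m ℓ w h c Λ : ℕ} {θ : ℝ} (hH : Fintype.card H = m)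
    (hP : Fintype.card P = m + 1) (lines : Finset (List (MTerm P H))) {base : Finset (P × H)}
    (hb : IsMat base) (hbc : base.card ≤ c) (hc : c + ℓ ≤ m)
    (hnarrow : ∀ G ∈ lines, ∀ t ∈ G, t.Alive base → (t.dom \ base.image Prod.fst).card ≤ w)
    (hΛ : (ℓ + 1) * ℓ ≤ Λ) (hθ : 0 ≤ θ) (hΛθ : (Λ : ℝ) ≤ θ * ((m - ℓ - c : ℕ) : ℝ))
    (hw : 1 ≤ w) (hs : (w : ℝ) * (w * Λ ^ 2 * θ) ≤ 1 / 2) (hlines : lines.card < 2 ^ h) :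
    ∃ ρ : Finset (P × H), IsMat ρ ∧ base ⊆ ρ ∧ ρ.card + ℓ = m ∧ ∀ G ∈ lines, ¬ Long G h ρ := by
  have hne := mats_nonempty (by omega) hb (j := m - ℓ) (by omega) (by omega)
  have hlong : ∀ G ∈ lines, (((mats base (m - ℓ)).filter (Long G h)).card : ℝ) ≤
      (1 / 2) ^ h * (mats base (m - ℓ)).card := by
    intro G hG
    refine (card_long_le (w := w) (Λ := Λ) (θ := θ) (hnarrow G hG) ?_ hθ ?_ (by omega) ?_
      h).trans ?_
    · rw [hP, hH]
      refine (Nat.mul_le_mul ?_ ?_).trans hΛ <;> omega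
    · refine hΛθ.trans (mul_le_mul_of_nonneg_left ?_ hθ)
      exact_mod_cast (by omega : m - ℓ - c ≤ m - ℓ + 1 - base.card)
    · refine le_trans ?_ (hs.trans (by norm_num))
      exact le_mul_of_one_le_left (by positivity) (by exact_mod_cast hw)
    · gcongr
  have hcount : (lines.biUnion (fun G => (mats base (m - ℓ)).filter (Long G h))).card <
      (mats base (m - ℓ)).card := by
    have hMpos : (0 : ℝ) < (mats base (m - ℓ)).card := by exact_mod_cast hne.card_pos
    have h1 : ((lines.biUnion (fun G => (mats base (m - ℓ)).filter (Long G h))).card : ℝ) ≤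
        ∑ G ∈ lines, (((mats base (m - ℓ)).filter (Long G h)).card : ℝ) := by
      exact_mod_cast Finset.card_biUnion_le
    have h2 := h1.trans (Finset.sum_le_sum hlong)
    rw [Finset.sum_const, nsmul_eq_mul] at h2
    have h3 : (lines.card : ℝ) < 2 ^ h := by exact_mod_cast hlines
    have h4 : (2 : ℝ) ^ h * (1 / 2) ^ h = 1 := by rw [← mul_pow]; norm_num
    have : (lines.card : ℝ) * ((1 / 2) ^ h * (mats base (m - ℓ)).card) <
        (mats base (m - ℓ)).card := by
      rw [← mul_assoc]
      refine mul_lt_of_lt_one_left hMpos ?_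
      calc _ < (2 : ℝ) ^ h * (1 / 2) ^ h := by gcongr
        _ = 1 := h4
    exact_mod_cast h2.trans_lt this
  obtain ⟨ρ, hρ, hρn⟩ := Finset.exists_mem_notMem_of_card_lt_card hcount
  obtain ⟨h1, h2, h3⟩ := mem_mats.1 hρ
  refine ⟨ρ, h1, h2, by omega, fun G hG hl => hρn ?_⟩
  exact Finset.mem_biUnion.2 ⟨G, hG, Finset.mem_filter.2 ⟨hρ, hl⟩⟩

/-- For any small family of lines there is a matching of size `2 ^ r - 2 ^ (2 * v + 8)` after
which all the decision processes are short and narrow. -/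
lemma exists_restriction {r v : ℕ} (hH : Fintype.card H = 2 ^ r) (hP : Fintype.card P = 2 ^ r + 1)
    (hr : 14 * v + 66 ≤ r) (lines : Finset (List (MTerm P H)))
    (hT : ∀ G ∈ lines, ∀ t ∈ G, ∀ i ∈ t.dom,
      2 ^ r ≤ 2 * (univ.filter (fun y => ¬ t.ok i y)).card)
    (hlines : lines.card < 2 ^ 2 ^ v)
    (hterms : (lines.biUnion List.toFinset).card < 2 ^ 2 ^ v) :
    ∃ base ρ : Finset (P × H), IsMat ρ ∧ base ⊆ ρ ∧ ρ.card + 2 ^ (2 * v + 8) = 2 ^ r ∧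
      ∀ G ∈ lines, (∀ t ∈ G, t.Alive base → (t.dom \ base.image Prod.fst).card ≤ 2 ^ (v + 5)) ∧
        ¬ Long G (2 ^ v) ρ := by
  have hm4 : 2 ^ r = 4 * 2 ^ (r - 2) := by
    rw [show r = (r - 2) + 2 by omega, pow_add]; simp; ring
  have hwr : 2 ^ (v + 5) ≤ 2 ^ r := Nat.pow_le_pow_right (by norm_num) (by omega)
  obtain ⟨base, hb, hbc, hbad⟩ := exists_narrowing (w := 2 ^ (v + 5)) hH hP
    (lines.biUnion List.toFinset) (by
      intro t ht
      obtain ⟨G, hG, htG⟩ := Finset.mem_biUnion.1 ht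
      exact hT G hG t (List.mem_toFinset.1 htG)) (by omega) (2 ^ (r - 2)) (by omega)
  have hnarrow : ∀ G ∈ lines, ∀ t ∈ G, t.Alive base →
      (t.dom \ base.image Prod.fst).card ≤ 2 ^ (v + 5) := by
    have hlt : ((lines.biUnion List.toFinset).card : ℝ) *
        (1 - ((2 ^ (v + 5) : ℕ) : ℝ) / (4 * ((2 ^ r : ℕ) + 1))) ^ (2 ^ (r - 2)) < 1 := by
      set δ : ℝ := ((2 ^ (v + 5) : ℕ) : ℝ) / (4 * ((2 ^ r : ℕ) + 1)) with hδ
      have hδ0 : 0 ≤ δ := by positivity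
      have hδ1 : δ ≤ 1 := by
        rw [hδ, div_le_one (by positivity)]
        have : ((2 ^ (v + 5) : ℕ) : ℝ) ≤ ((2 ^ r : ℕ) : ℝ) := by exact_mod_cast hwr
        have h0 : (0 : ℝ) ≤ ((2 ^ r : ℕ) : ℝ) := by positivity
        linarith
      have h1 : (1 - δ) ^ (2 ^ (r - 2)) ≤ Real.exp (-(2 ^ v : ℝ)) := by
        calc (1 - δ) ^ (2 ^ (r - 2)) ≤ (Real.exp (-δ)) ^ (2 ^ (r - 2)) := by
              refine pow_le_pow_left₀ (by linarith) ?_ _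
              have := Real.add_one_le_exp (-δ)
              linarith
          _ = Real.exp (-(δ * 2 ^ (r - 2))) := by
              rw [← Real.exp_nat_mul]; congr 1; push_cast; ring
          _ ≤ _ := by
              apply Real.exp_le_exp.2
              have : (2 : ℝ) ^ v ≤ δ * 2 ^ (r - 2) := by
                have hm4' : (2 : ℝ) ^ r = 4 * 2 ^ (r - 2) := by exact_mod_cast hm4
                have h1r : (1 : ℝ) ≤ 2 ^ r := one_le_pow₀ (by norm_num)
                rw [hδ, div_mul_eq_mul_div, le_div_iff₀ (by positivity)]
                push_cast
                rw [pow_add]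
                have h2v : (0 : ℝ) < 2 ^ v := by positivity
                nlinarith
              linarith
      have h2 : Real.exp (-(2 ^ v : ℝ)) ≤ ((2 : ℝ) ^ 2 ^ v)⁻¹ := by
        rw [Real.exp_neg]
        apply inv_anti₀ (by positivity)
        calc (2 : ℝ) ^ 2 ^ v ≤ (Real.exp 1) ^ 2 ^ v := by
              refine pow_le_pow_left₀ (by norm_num) ?_ _
              have := Real.add_one_le_exp 1
              linarith
          _ = Real.exp (2 ^ v) := by rw [← Real.exp_nat_mul]; simp
      have h3 : ((lines.biUnion List.toFinset).card : ℝ) < 2 ^ 2 ^ v := by exact_mod_cast hterms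
      have hpos : (0 : ℝ) < 2 ^ 2 ^ v := by positivity
      calc _ ≤ ((lines.biUnion List.toFinset).card : ℝ) * ((2 : ℝ) ^ 2 ^ v)⁻¹ := by
            exact mul_le_mul_of_nonneg_left (h1.trans h2) (by positivity)
        _ < 2 ^ 2 ^ v * ((2 : ℝ) ^ 2 ^ v)⁻¹ := by gcongr
        _ = 1 := mul_inv_cancel₀ hpos.ne'
    have h0 := hbad.trans_lt hlt
    have h0' := Nat.cast_lt_one.1 h0
    rw [Finset.card_eq_zero, Finset.filter_eq_empty_iff] at h0'
    intro G hG t ht hal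
    have := h0' (Finset.mem_biUnion.2 ⟨G, hG, List.mem_toFinset.2 ht⟩)
    by_contra hcon
    exact this ⟨hal, by omega⟩
  have hℓ : 2 ^ (2 * v + 8) ≤ 2 ^ (r - 2) := Nat.pow_le_pow_right (by norm_num) (by omega)
  have hΛ : (2 ^ (2 * v + 8) + 1) * 2 ^ (2 * v + 8) ≤ 2 ^ (4 * v + 17) := by
    have h3 : 1 ≤ 2 ^ (2 * v + 8) := Nat.one_le_two_pow
    have h4 : 2 ^ (4 * v + 17) = 2 ^ (2 * v + 8) * 2 ^ (2 * v + 8) * 2 := by ring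
    rw [h4]
    generalize 2 ^ (2 * v + 8) = L at h3
    nlinarith
  have hpowr : (2 : ℝ) ^ r = 2 ^ (14 * v + 66) * 2 ^ (r - (14 * v + 66)) := by
    rw [← pow_add]; congr 1; omega
  have hq : (1 : ℝ) ≤ 2 ^ (r - (14 * v + 66)) := one_le_pow₀ (by norm_num)
  have hcalc : ((2 ^ (v + 5) : ℕ) : ℝ) * (((2 ^ (v + 5) : ℕ) : ℝ) * ((2 ^ (4 * v + 17) : ℕ) : ℝ) ^ 2
      * (2 ^ (4 * v + 18) / 2 ^ r)) ≤ 1 / 2 := by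
    push_cast
    rw [hpowr]
    generalize (2 : ℝ) ^ (r - (14 * v + 66)) = q at hq
    have hq0 : 0 < q := by linarith
    have : (2 : ℝ) ^ (v + 5) * (2 ^ (v + 5) * (2 ^ (4 * v + 17)) ^ 2 *
        (2 ^ (4 * v + 18) / (2 ^ (14 * v + 66) * q))) = 1 / (16 * q) := by
      have h1 : (2 : ℝ) ^ (14 * v + 66) =
          2 ^ (v + 5) * (2 ^ (v + 5) * (2 ^ (4 * v + 17)) ^ 2 * 2 ^ (4 * v + 18)) * 16 := by ring
      rw [h1]
      field_simp
    rw [this]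
    rw [div_le_div_iff₀ (by positivity) (by norm_num)]
    linarith
  have hΛθ : ((2 ^ (4 * v + 17) : ℕ) : ℝ) ≤
      2 ^ (4 * v + 18) / 2 ^ r * ((2 ^ r - 2 ^ (2 * v + 8) - 2 ^ (r - 2) : ℕ) : ℝ) := by
    have h1 : 2 ^ r ≤ 2 * (2 ^ r - 2 ^ (2 * v + 8) - 2 ^ (r - 2)) := by
      generalize 2 ^ (2 * v + 8) = L at hℓ
      omega
    have h2 : (2 : ℝ) ^ r ≤ 2 * ((2 ^ r - 2 ^ (2 * v + 8) - 2 ^ (r - 2) : ℕ) : ℝ) := by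
      exact_mod_cast h1
    have h3 : (2 : ℝ) ^ (4 * v + 18) = 2 ^ (4 * v + 17) * 2 := by ring
    rw [div_mul_eq_mul_div, le_div_iff₀ (by positivity), h3, Nat.cast_pow, Nat.cast_ofNat, mul_assoc]
    exact mul_le_mul_of_nonneg_left h2 (by positivity)
  obtain ⟨ρ, h1, h2, h3, h4⟩ := exists_short hH hP lines hb hbc
    (by generalize 2 ^ (2 * v + 8) = L at *; omega) hnarrow hΛ
    (by positivity) hΛθ Nat.one_le_two_pow hcalc hlines
  exact ⟨base, ρ, h1, h2, h3, fun G hG => ⟨hnarrow G hG, h4 G hG⟩⟩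

end Restriction

section Refutations

/-- A property of lines that is inherited by some premise and fails on axioms
fails on the empty line. -/
lemma IsResKRefutation.not_bad_empty {k : ℕ} {F : Set (Clause V)} {P : List (Dnf V)}
    (h : IsResKRefutation k F P) {Bad : Dnf V → Prop}
    (hF : ∀ C ∈ F, clauseToDnf C ∈ P → ¬ Bad (clauseToDnf C))
    (hstep : ∀ prems G, ResKInf k prems G → G ∈ P → (∀ Q ∈ prems, Q ∈ P) → Bad G →
      ∃ Q ∈ prems, Bad Q) : ¬ Bad ∅ := by
  obtain ⟨hne, hlast, -, hinf⟩ := h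
  have key : ∀ n (hn : n < P.length), ¬ Bad P[n] := by
    intro n
    induction n using Nat.strong_induction_on with
    | _ n ih =>
      intro hn hb
      rcases hinf ⟨n, hn⟩ with ⟨C, hC, hCP⟩ | ⟨prems, hres, hprem⟩
      · simp only [List.get_eq_getElem] at hCP
        rw [hCP] at hb
        exact hF C hC (hCP ▸ List.getElem_mem hn) hb
      · obtain ⟨Q, hQ, hQb⟩ := hstep prems _ hres (List.get_mem _ _)
          (fun Q hQ => by obtain ⟨j, -, rfl⟩ := hprem Q hQ; exact List.get_mem _ _) hb
        obtain ⟨j, hj, rfl⟩ := hprem Q hQ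
        exact ih j hj j.2 hQb
  intro hb
  have hmem := List.mem_of_getLast? hlast
  obtain ⟨n, hn, hn'⟩ := List.getElem_of_mem hmem
  exact key n hn (hn' ▸ hb)

lemma sum_toFinset_dnfSize_le (P : List (Dnf V)) : ∑ G ∈ P.toFinset, dnfSize G ≤ proofSize P := by
  induction P with
  | nil => simp [proofSize]
  | cons G P ih =>
    simp only [List.toFinset_cons, proofSize, List.map_cons, List.sum_cons] at ih ⊢
    by_cases h : G ∈ P.toFinset
    · rw [Finset.insert_eq_of_mem h]; omega
    · rw [Finset.sum_insert h]; omega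

lemma card_le_dnfSize (G : Dnf V) : G.card ≤ dnfSize G := by
  rw [Finset.card_eq_sum_ones]
  exact Finset.sum_le_sum fun q _ => by omega

lemma card_terms_le_proofSize (P : List (Dnf V)) :
    (P.toFinset.biUnion id).card ≤ proofSize P :=
  Finset.card_biUnion_le.trans
    ((Finset.sum_le_sum fun G _ => card_le_dnfSize G).trans (sum_toFinset_dnfSize_le P))

lemma card_lines_le_proofSize (P : List (Dnf V)) : P.toFinset.card ≤ proofSize P + 1 := by
  have h1 : (P.toFinset.erase ∅).card ≤ ∑ G ∈ P.toFinset.erase ∅, dnfSize G := by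
    rw [Finset.card_eq_sum_ones]
    refine Finset.sum_le_sum fun G hG => ?_
    obtain ⟨q, hq⟩ := Finset.nonempty_iff_ne_empty.2 (Finset.ne_of_mem_erase hG)
    exact (Finset.card_pos.2 ⟨q, hq⟩).trans_le (card_le_dnfSize G)
  have h2 : ∑ G ∈ P.toFinset.erase ∅, dnfSize G ≤ ∑ G ∈ P.toFinset, dnfSize G :=
    Finset.sum_le_sum_of_subset (Finset.erase_subset _ _)
  have h3 := sum_toFinset_dnfSize_le P
  have h4 := Finset.pred_card_le_card_erase (s := P.toFinset) (a := (∅ : Dnf V))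
  omega

end Refutations

section BitPigeonhole

variable {P : Type} [Fintype P] [DecidableEq P] {r : ℕ}

/-- The literal `l` is true under the matching `m`; variables outside the range of `var` are
read as false. -/
def LitTrue (var : P × Fin r → V) (m : Finset (P × (Fin r → Bool))) (l : Lit V) : Prop :=
  (∃ i y b, (i, y) ∈ m ∧ l.var = var (i, b) ∧ y b = l.pos) ∨ (l.var ∉ Set.range var ∧ l.pos = false)

lemma LitTrue.mono {var : P × Fin r → V} {s m : Finset (P × (Fin r → Bool))} {l : Lit V}
    (h : LitTrue var s l) (hsm : s ⊆ m) : LitTrue var m l := by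
  rcases h with ⟨i, y, b, hm, h⟩ | h
  · exact Or.inl ⟨i, y, b, hsm hm, h⟩
  · exact Or.inr h

lemma LitTrue.not_neg {var : P × Fin r → V} (hvar : Function.Injective var)
    {m : Finset (P × (Fin r → Bool))} (hm : IsMat m) {l : Lit V}
    (h : LitTrue var m l) : ¬ LitTrue var m l.neg := by
  rintro (⟨i, y, b, hi, hl, hy⟩ | ⟨hl, hp⟩)
  · rcases h with ⟨i', y', b', hi', hl', hy'⟩ | ⟨hl', hp'⟩
    · have h1 := hvar (hl.symm.trans hl')
      obtain ⟨rfl, rfl⟩ := Prod.mk.inj h1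
      have h2 := hm _ hi _ hi' (Or.inl rfl)
      obtain ⟨-, rfl⟩ := Prod.mk.inj h2
      rw [hy'] at hy
      simp [Lit.neg] at hy
    · exact hl' ⟨_, hl.symm⟩
  · rcases h with ⟨i', y', b', hi', hl', hy'⟩ | ⟨hl', hp'⟩
    · exact hl ⟨_, hl'.symm⟩
    · simp [Lit.neg, hp'] at hp

/-- A term of literals as a term over matchings. -/
noncomputable def toMTerm (var : P × Fin r → V) (q : PTerm V) : MTerm P (Fin r → Bool) where
  dom := univ.filter (fun i => ∃ b, ∃ l ∈ q, l.var = var (i, b))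
  ok i y := ∀ l ∈ q, ∀ b, l.var = var (i, b) → l.pos = y b

lemma toMTerm_sat_iff {var : P × Fin r → V} (hvar : Function.Injective var)
    {m : Finset (P × (Fin r → Bool))} (hm : IsMat m) {q : PTerm V} :
    (∀ l ∈ q, LitTrue var m l) ↔
      (∀ l ∈ q, l.var ∉ Set.range var → l.pos = false) ∧ (toMTerm var q).Sat m := by
  constructor
  · intro h
    refine ⟨fun l hl hr => ?_, fun i hi => ?_⟩
    · rcases h l hl with ⟨i, y, b, -, h1, -⟩ | h1
      · exact absurd ⟨_, h1.symm⟩ hr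
      · exact h1.2
    · obtain ⟨b, l, hl, hlv⟩ := (Finset.mem_filter.1 hi).2
      rcases h l hl with ⟨i', y, b', hiy, h1, h2⟩ | h1
      · obtain ⟨rfl, rfl⟩ := Prod.mk.inj (hvar (hlv.symm.trans h1))
        refine ⟨y, hiy, fun l' hl' b' hlv' => ?_⟩
        rcases h l' hl' with ⟨i'', y', b'', hiy', h1', h2'⟩ | h1'
        · obtain ⟨rfl, rfl⟩ := Prod.mk.inj (hvar (hlv'.symm.trans h1'))
          obtain ⟨-, rfl⟩ := Prod.mk.inj (hm _ hiy _ hiy' (Or.inl rfl))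
          exact h2'.symm
        · exact absurd ⟨_, hlv'.symm⟩ h1'.1
      · exact absurd ⟨_, hlv.symm⟩ h1.1
  · rintro ⟨h1, h2⟩ l hl
    by_cases hr : l.var ∈ Set.range var
    · obtain ⟨⟨i, b⟩, hib⟩ := hr
      obtain ⟨y, hy, hok⟩ := h2 i (Finset.mem_filter.2 ⟨Finset.mem_univ _, b, l, hl, hib.symm⟩)
      exact Or.inl ⟨i, y, b, hy, hib.symm, (hok l hl b hib.symm).symm⟩
    · exact Or.inr ⟨hr, h1 l hl hr⟩

lemma le_card_not_ok {var : P × Fin r → V} {q : PTerm V} {i : P} (hi : i ∈ (toMTerm var q).dom) :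
    2 ^ r ≤ 2 * (univ.filter (fun y => ¬ (toMTerm var q).ok i y)).card := by
  obtain ⟨b, l, hl, hlv⟩ := (Finset.mem_filter.1 hi).2
  have h1 : (univ.filter (fun y => (toMTerm var q).ok i y)).card ≤
      (univ.filter (fun y => ¬ (toMTerm var q).ok i y)).card := by
    refine Finset.card_le_card_of_injOn (fun y => Function.update y b (!(y b))) ?_ ?_
    · intro y hy
      have hy' : (toMTerm var q).ok i y := (Finset.mem_filter.1 hy).2
      refine Finset.mem_filter.2 ⟨Finset.mem_univ _, fun hok => ?_⟩
      have h2 := hy' l hl b hlv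
      have h3 := hok l hl b hlv
      rw [h2] at h3
      simp at h3
    · intro y _ y' _ h
      have h : Function.update y b (!(y b)) = Function.update y' b (!(y' b)) := h
      funext c
      have hc := congrFun h c
      by_cases hcb : c = b
      · subst hcb; simpa using hc
      · simpa [Function.update_of_ne hcb] using hc
  have h2 := Finset.card_filter_add_card_filter_not (s := (univ : Finset (Fin r → Bool)))
    (fun y => (toMTerm var q).ok i y)
  have h3 : (univ : Finset (Fin r → Bool)).card = 2 ^ r := by simp
  omega

/-- A line as a list of terms over matchings, dropping terms with a true junk literal. -/
noncomputable def toMTerms (var : P × Fin r → V) (G : Dnf V) : List (MTerm P (Fin r → Bool)) :=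
  (G.filter (fun q => ∀ l ∈ q, l.var ∉ Set.range var → l.pos = false)).toList.map (toMTerm var)

lemma mem_toMTerms {var : P × Fin r → V} {G : Dnf V} {t : MTerm P (Fin r → Bool)} :
    t ∈ toMTerms var G ↔
      ∃ q ∈ G, (∀ l ∈ q, l.var ∉ Set.range var → l.pos = false) ∧ toMTerm var q = t := by
  simp [toMTerms, and_assoc]

lemma MDecides.cases {var : P × Fin r → V} (hvar : Function.Injective var)
    {s : Finset (P × (Fin r → Bool))} (hs : IsMat s) {G : Dnf V}
    (h : MDecides (toMTerms var G) s) :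
    (∃ q ∈ G, ∀ l ∈ q, LitTrue var s l) ∨
      ∀ q ∈ G, ∀ m, IsMat m → s ⊆ m → ∃ l ∈ q, ¬ LitTrue var m l := by
  rcases h with ⟨t, ht, hsat⟩ | h
  · obtain ⟨q, hq, hj, rfl⟩ := mem_toMTerms.1 ht
    exact Or.inl ⟨q, hq, (toMTerm_sat_iff hvar hs).2 ⟨hj, hsat⟩⟩
  · refine Or.inr fun q hq m hm hsm => ?_
    by_contra hcon
    push Not at hcon
    obtain ⟨h1, h2⟩ := (toMTerm_sat_iff hvar hm).1 hcon
    exact h _ (mem_toMTerms.2 ⟨q, hq, h1, rfl⟩) ⟨m, hm, hsm, h2⟩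

/-- Refutations of the bit pigeonhole principle are long, independently of the width of terms. -/
theorem bitPigeonhole_lower_bound {v k : ℕ} (hr : 14 * v + 66 ≤ r) (hP : Fintype.card P = 2 ^ r + 1)
    {var : P × Fin r → V} (hvar : Function.Injective var) {F : Set (Clause V)}
    (hF : ∀ C ∈ F, ∃ i i' : P, ∃ y : Fin r → Bool, i ≠ i' ∧
      ∀ b, (⟨var (i, b), !(y b)⟩ : Lit V) ∈ C ∧ (⟨var (i', b), !(y b)⟩ : Lit V) ∈ C)
    {R : List (Dnf V)} (hR : IsResKRefutation k F R) : 2 ^ 2 ^ v ≤ proofSize R + 1 := by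
  by_contra hcon
  push Not at hcon
  have hH : Fintype.card (Fin r → Bool) = 2 ^ r := by simp
  have hPH : Fintype.card (Fin r → Bool) ≤ Fintype.card P := by omega
  obtain ⟨base, ρ, hρ, hbρ, hρc, hlines⟩ := exists_restriction hH hP hr
    (R.toFinset.image (toMTerms var)) (by
      intro G hG t ht i hi
      obtain ⟨G, -, rfl⟩ := Finset.mem_image.1 hG
      obtain ⟨q, -, -, rfl⟩ := mem_toMTerms.1 ht
      exact le_card_not_ok hi)
    ((Finset.card_image_le.trans (card_lines_le_proofSize R)).trans_lt hcon) (by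
      refine lt_of_le_of_lt ?_ ((Nat.le_succ _).trans_lt hcon)
      refine le_trans ?_ (card_terms_le_proofSize R)
      refine le_trans (Finset.card_le_card ?_)
        (Finset.card_image_le (s := R.toFinset.biUnion id) (f := toMTerm var))
      intro t ht
      obtain ⟨L, hL, ht⟩ := Finset.mem_biUnion.1 ht
      obtain ⟨G, hG, rfl⟩ := Finset.mem_image.1 hL
      obtain ⟨q, hq, -, rfl⟩ := mem_toMTerms.1 (List.mem_toFinset.1 ht)
      exact Finset.mem_image_of_mem _ (Finset.mem_biUnion.2 ⟨G, hG, hq⟩))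
  set B := 2 * 2 ^ (v + 5) * 2 ^ v with hB
  have hBℓ : 3 * B + 2 ≤ 2 ^ (2 * v + 8) := by
    have h1 : B = 64 * 2 ^ (2 * v) := by rw [hB]; ring
    have h2 : 2 ^ (2 * v + 8) = 256 * 2 ^ (2 * v) := by ring
    have h3 : 1 ≤ 2 ^ (2 * v) := Nat.one_le_two_pow
    omega
  clear_value B
  generalize 2 ^ (2 * v + 8) = L at hBℓ hρc
  have hdec : ∀ G ∈ R, ∀ m, IsMat m → ρ ⊆ m → m.card + B ≤ 2 ^ r →
      ∃ s' m', ρ ⊆ s' ∧ s' ⊆ m' ∧ m ⊆ m' ∧ IsMat m' ∧ s'.card ≤ ρ.card + B ∧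
        m'.card ≤ m.card + B ∧ ((∃ q ∈ G, ∀ l ∈ q, LitTrue var m' l) ∨
          ∀ q ∈ G, ∀ μ, IsMat μ → s' ⊆ μ → ∃ l ∈ q, ¬ LitTrue var μ l) := by
    intro G hG m hm hρm hc
    obtain ⟨hnar, hlong⟩ := hlines _ (Finset.mem_image_of_mem _ (List.mem_toFinset.2 hG))
    obtain ⟨s', m', h1, h2, h3, h4, h5, h6, h7⟩ := exists_decides_of_not_long hPH hnar _ ρ m hbρ hρm
      hm hlong (by rw [hH, ← hB]; exact hc)
    rw [← hB] at h5 h6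
    refine ⟨s', m', h1, h2, h3, h4, h5, h6, ?_⟩
    refine (MDecides.cases hvar (h4.mono h2) h7).imp_left ?_
    rintro ⟨q, hq, hql⟩
    exact ⟨q, hq, fun l hl => (hql l hl).mono h2⟩
  let Bad : Dnf V → Prop := fun G => ∃ s, IsMat s ∧ ρ ⊆ s ∧ s.card ≤ ρ.card + B ∧
    ∀ q ∈ G, ∀ m, IsMat m → s ⊆ m → ∃ l ∈ q, ¬ LitTrue var m l
  refine hR.not_bad_empty (Bad := Bad) ?_ ?_ ⟨ρ, hρ, subset_rfl, by omega, by simp⟩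
  · rintro C hC - ⟨s, hs, hρs, hsc, hdead⟩
    obtain ⟨i, i', y, hne, hlit⟩ := hF C hC
    obtain ⟨m1, hm1, hsm1, hc1, ⟨i0, y1⟩, he1, rfl⟩ := hs.exists_insert_fst (by omega) i
    obtain ⟨m2, hm2, hsm2, hc2, ⟨i0', y2⟩, he2, rfl⟩ := hm1.exists_insert_fst (by omega) i'
    have hdead' : ∀ l ∈ C, ¬ LitTrue var m2 l := by
      intro l hl
      obtain ⟨l', hl', h⟩ := hdead {l} (Finset.mem_image_of_mem _ hl) m2 hm2 (hsm1.trans hsm2)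
      rwa [Finset.mem_singleton.1 hl'] at h
    have hyy : ∀ i z, (i, z) ∈ m2 → (∀ b, (⟨var (i, b), !(y b)⟩ : Lit V) ∈ C) → z = y := by
      intro i z hz hb
      funext b
      by_contra hzy
      refine hdead' _ (hb b) (Or.inl ⟨i, z, b, hz, rfl, ?_⟩)
      revert hzy
      cases z b <;> cases y b <;> simp
    have e1 := hyy _ y1 (hsm2 he1) (fun b => (hlit b).1)
    have e2 := hyy _ y2 he2 (fun b => (hlit b).2)
    exact hne (Prod.mk.inj (hm2 _ (hsm2 he1) _ he2 (Or.inr (e1.trans e2.symm)))).1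
  · rintro prems G hinf hG hprems ⟨s, hs, hρs, hsc, hdead⟩
    have hdead1 : ∀ q ∈ G, ∀ m, IsMat m → s ⊆ m → ¬ ∀ l ∈ q, LitTrue var m l := by
      intro q hq m hm hsm h
      obtain ⟨l, hl, hnl⟩ := hdead q hq m hm hsm
      exact hnl (h l hl)
    cases hinf with
    | ax x =>
      exfalso
      by_cases hx : x ∈ Set.range var
      · obtain ⟨⟨i, b⟩, rfl⟩ := hx
        obtain ⟨m, hm, hsm, hc, ⟨i0, y⟩, he, rfl⟩ := hs.exists_insert_fst (by omega) i
        refine hdead1 {⟨var (i0, b), y b⟩} ?_ m hm hsm ?_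
        · cases y b <;> simp
        · intro l hl
          rw [Finset.mem_singleton] at hl
          subst hl
          exact Or.inl ⟨i0, y, b, he, rfl, rfl⟩
      · refine hdead1 {⟨x, false⟩} (by simp) s hs subset_rfl ?_
        intro l hl
        rw [Finset.mem_singleton] at hl
        subst hl
        exact Or.inr ⟨hx, rfl⟩
    | weaken A B' =>
      refine ⟨A, by simp, ?_⟩
      exact ⟨s, hs, hρs, hsc, fun q hq => hdead q (Finset.mem_union_left _ hq)⟩
    | andIntro A B' l q hq =>
      by_contra hnb
      push Not at hnb
      obtain ⟨s1, m1, h11, h12, h13, h14, h15, h16, h17⟩ := hdec (A ∪ {({l} : PTerm V)}) (hprems _ (by simp)) s hs hρs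
        (by omega)
      obtain ⟨s2, m2, h21, h22, h23, h24, h25, h26, h27⟩ := hdec (B' ∪ {q}) (hprems _ (by simp)) m1 h14
        (hρs.trans h13) (by omega)
      have hsm := h13.trans h23
      rcases h17 with ⟨p1, hp1, hl1⟩ | h17
      swap
      · exact hnb _ (by simp) ⟨s1, h14.mono h12, h11, h15, h17⟩
      rcases h27 with ⟨p2, hp2, hl2⟩ | h27
      swap
      · exact hnb _ (by simp) ⟨s2, h24.mono h22, h21, h25, h27⟩
      replace hl1 := fun l hl => (hl1 l hl).mono h23
      rw [Finset.mem_union, Finset.mem_singleton] at hp1 hp2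
      rcases hp1 with hp1 | rfl
      · exact hdead1 p1 (by simp [hp1]) m2 h24 hsm hl1
      rcases hp2 with hp2 | rfl
      · exact hdead1 p2 (by simp [hp2]) m2 h24 hsm hl2
      refine hdead1 (insert l p2) (by simp) m2 h24 hsm ?_
      intro l' hl'
      rcases Finset.mem_insert.1 hl' with rfl | hl'
      · exact hl1 _ (by simp)
      · exact hl2 _ hl'
    | cut A B' q =>
      by_contra hnb
      push Not at hnb
      obtain ⟨s1, m1, h11, h12, h13, h14, h15, h16, h17⟩ := hdec (A ∪ {q}) (hprems _ (by simp)) s hs hρs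
        (by omega)
      obtain ⟨s2, m2, h21, h22, h23, h24, h25, h26, h27⟩ := hdec (B' ∪ q.image (fun l => ({l.neg} : PTerm V))) (hprems _ (by simp)) m1 h14
        (hρs.trans h13) (by omega)
      have hsm := h13.trans h23
      rcases h17 with ⟨p1, hp1, hl1⟩ | h17
      swap
      · exact hnb _ (by simp) ⟨s1, h14.mono h12, h11, h15, h17⟩
      rcases h27 with ⟨p2, hp2, hl2⟩ | h27
      swap
      · exact hnb _ (by simp) ⟨s2, h24.mono h22, h21, h25, h27⟩
      replace hl1 := fun l hl => (hl1 l hl).mono h23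
      rw [Finset.mem_union] at hp1 hp2
      rcases hp1 with hp1 | hp1
      · exact hdead1 p1 (by simp [hp1]) m2 h24 hsm hl1
      rcases hp2 with hp2 | hp2
      · exact hdead1 p2 (by simp [hp2]) m2 h24 hsm hl2
      rw [Finset.mem_singleton] at hp1
      subst hp1
      obtain ⟨l, hl, rfl⟩ := Finset.mem_image.1 hp2
      exact (hl1 l hl).not_neg hvar h24 (hl2 _ (by simp))

end BitPigeonhole

/-- If subcubes of codimension at most `u` fix pairwise disjoint sets of coordinates, then few
points avoid all of them. -/
theorem card_avoid_subcubes_le {X ι : Type} [Fintype X] [DecidableEq X] (u : ℕ)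
    (I : Finset ι) (U : ι → Finset X) (p : ι → X → Bool)
    (hU : (I : Set ι).PairwiseDisjoint U) (hu : ∀ i ∈ I, (U i).card ≤ u) :
    ((univ.filter fun a : X → Bool => ∀ i ∈ I, ∃ x ∈ U i, a x ≠ p i x).card : ℝ) ≤
      (1 - 1 / 2 ^ u) ^ I.card * Fintype.card (X → Bool) := by
  induction I using Finset.induction_on with
  | empty => simp
  | insert i I hi ih =>
    have ih := ih (hU.subset (by simp)) (fun j hj => hu j (by simp [hj]))
    set S := univ.filter fun a : X → Bool => ∀ i ∈ I, ∃ x ∈ U i, a x ≠ p i x with hS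
    have hdis : ∀ j ∈ I, Disjoint (U i) (U j) := fun j hj =>
      hU (by simp) (by simp [hj]) (by rintro rfl; exact hi hj)
    have key : S.card ≤ (S.filter fun a => ∀ x ∈ U i, a x = p i x).card * 2 ^ u := by
      have h1 : S.card ≤ ((S.filter fun a => ∀ x ∈ U i, a x = p i x) ×ˢ
          (univ : Finset (U i → Bool))).card := by
        refine Finset.card_le_card_of_injOn
          (fun a => (fun x => if x ∈ U i then p i x else a x, fun x => a x)) ?_ ?_
        · intro a ha
          simp only [Finset.coe_product, Set.mem_prod, Finset.mem_coe, Finset.mem_filter, hS,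
            Finset.mem_univ, true_and, and_true] at ha ⊢
          refine ⟨fun j hj => ?_, fun x hx => by simp [hx]⟩
          obtain ⟨x, hx, hax⟩ := ha j hj
          refine ⟨x, hx, ?_⟩
          rwa [if_neg (Finset.disjoint_right.1 (hdis j hj) hx)]
        · intro a _ b _ hab
          simp only [Prod.mk.injEq] at hab
          funext x
          by_cases hx : x ∈ U i
          · exact congrFun hab.2 ⟨x, hx⟩
          · have := congrFun hab.1 x
            simpa [hx] using this
      refine h1.trans ?_
      rw [Finset.card_product]
      refine Nat.mul_le_mul_left _ ?_
      simpa using Nat.pow_le_pow_right (n := 2) (by norm_num) (hu i (by simp))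
    have hsplit : (univ.filter fun a : X → Bool => ∀ j ∈ insert i I, ∃ x ∈ U j, a x ≠ p j x) =
        S.filter fun a => ¬ ∀ x ∈ U i, a x = p i x := by
      ext a
      simp only [hS, Finset.mem_filter, Finset.mem_univ, true_and, Finset.forall_mem_insert]
      push Not
      tauto
    have hcard := Finset.card_filter_add_card_filter_not (s := S)
      (fun a : X → Bool => ∀ x ∈ U i, a x = p i x)
    rw [hsplit, Finset.card_insert_of_notMem hi, pow_succ]
    have h2 : (0 : ℝ) < 2 ^ u := by positivity
    have hcard' : ((S.filter fun a => ∀ x ∈ U i, a x = p i x).card : ℝ) +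
        (S.filter fun a => ¬ ∀ x ∈ U i, a x = p i x).card = S.card := by exact_mod_cast hcard
    have key' : (S.card : ℝ) ≤ (S.filter fun a => ∀ x ∈ U i, a x = p i x).card * 2 ^ u := by
      exact_mod_cast key
    have key2 : (S.card : ℝ) * (1 / 2 ^ u) ≤
        (S.filter fun a => ∀ x ∈ U i, a x = p i x).card := by
      rw [mul_one_div, div_le_iff₀ h2]; exact key'
    have h3 : (0 : ℝ) ≤ 1 - 1 / 2 ^ u := by
      rw [sub_nonneg, div_le_one h2]; exact one_le_pow₀ (by norm_num)
    calc ((S.filter fun a => ¬ ∀ x ∈ U i, a x = p i x).card : ℝ)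
        ≤ S.card * (1 - 1 / 2 ^ u) := by linarith
      _ ≤ ((1 - 1 / 2 ^ u) ^ I.card * Fintype.card (X → Bool)) * (1 - 1 / 2 ^ u) :=
          mul_le_mul_of_nonneg_right ih h3
      _ = _ := by ring

/-- A family of nonempty sets of size at most `k` contains `T` pairwise disjoint members or has
a hitting set of size at most `k * T`. -/
theorem exists_disjoint_or_hitting {ι L : Type} [DecidableEq ι] [DecidableEq L] (G : Finset ι)
    (S : ι → Finset L) (k : ℕ) (hk : ∀ q ∈ G, (S q).card ≤ k) (hne : ∀ q ∈ G, (S q).Nonempty)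
    (T : ℕ) :
    (∃ I ⊆ G, I.card = T ∧ (I : Set ι).PairwiseDisjoint S) ∨
      ∃ Q : Finset L, Q.card ≤ k * T ∧ ∀ q ∈ G, ∃ x ∈ S q, x ∈ Q := by
  induction T with
  | zero => exact Or.inl ⟨∅, by simp, rfl, by simp⟩
  | succ T ih =>
    rcases ih with ⟨I, hI, hc, hd⟩ | ⟨Q, hQ, h⟩
    swap
    · exact Or.inr ⟨Q, hQ.trans (Nat.mul_le_mul_left _ (by omega)), h⟩
    by_cases hcov : ∀ q ∈ G, ∃ x ∈ S q, x ∈ I.biUnion S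
    · refine Or.inr ⟨I.biUnion S, ?_, hcov⟩
      calc (I.biUnion S).card ≤ I.card * k :=
            Finset.card_biUnion_le_card_mul _ _ _ fun q hq => hk q (hI hq)
        _ ≤ k * (T + 1) := by rw [hc, mul_comm]; exact Nat.mul_le_mul_left _ (by omega)
    · push Not at hcov
      obtain ⟨q, hq, hqd⟩ := hcov
      have hqI : q ∉ I := by
        intro h
        obtain ⟨x, hx⟩ := hne q hq
        exact hqd x hx (Finset.mem_biUnion.2 ⟨q, h, hx⟩)
      refine Or.inl ⟨insert q I, Finset.insert_subset hq hI, by simp [hqI, hc], ?_⟩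
      rw [Finset.coe_insert, Set.pairwiseDisjoint_insert_of_notMem (by simpa using hqI)]
      refine ⟨hd, fun j hj => Finset.disjoint_left.2 fun x hx hxj => ?_⟩
      exact hqd x hx (Finset.mem_biUnion.2 ⟨j, hj, hxj⟩)

/-- A term holds under a total assignment. -/
def TermTrue (a : V → Bool) (q : PTerm V) : Prop := ∀ l ∈ q, a l.var = l.pos

/-- A DNF holds under a total assignment. -/
def DnfTrue (a : V → Bool) (G : Dnf V) : Prop := ∃ q ∈ G, TermTrue a q

/-- Every inference rule is sound. -/
theorem ResKInf.sound {k : ℕ} {prems : List (Dnf V)} {G : Dnf V} (h : ResKInf k prems G)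
    (a : V → Bool) (hp : ∀ Q ∈ prems, DnfTrue a Q) : DnfTrue a G := by
  cases h with
  | ax x =>
    refine ⟨{⟨x, a x⟩}, ?_, by simp [TermTrue]⟩
    cases a x <;> simp
  | weaken A B =>
    obtain ⟨q, hq, h⟩ := hp A (by simp)
    exact ⟨q, by simp [hq], h⟩
  | andIntro A B l q _ =>
    obtain ⟨q1, hq1, h1⟩ := hp (A ∪ {({l} : PTerm V)}) (by simp)
    obtain ⟨q2, hq2, h2⟩ := hp (B ∪ {q}) (by simp)
    rw [Finset.mem_union, Finset.mem_singleton] at hq1 hq2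
    rcases hq1 with hq1 | rfl
    · exact ⟨q1, by simp [hq1], h1⟩
    rcases hq2 with hq2 | rfl
    · exact ⟨q2, by simp [hq2], h2⟩
    refine ⟨insert l q2, by simp, fun l' hl' => ?_⟩
    rcases Finset.mem_insert.1 hl' with rfl | hl'
    · exact h1 _ (by simp)
    · exact h2 _ hl'
  | cut A B q =>
    obtain ⟨q1, hq1, h1⟩ := hp (A ∪ {q}) (by simp)
    obtain ⟨q2, hq2, h2⟩ := hp (B ∪ q.image (fun l => ({l.neg} : PTerm V))) (by simp)
    rw [Finset.mem_union] at hq1 hq2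
    rcases hq1 with hq1 | hq1
    · exact ⟨q1, by simp [hq1], h1⟩
    rcases hq2 with hq2 | hq2
    · exact ⟨q2, by simp [hq2], h2⟩
    rw [Finset.mem_singleton] at hq1
    subst hq1
    obtain ⟨l, hl, rfl⟩ := Finset.mem_image.1 hq2
    have e1 := h1 l hl
    have e2 := h2 l.neg (by simp)
    simp only [Lit.neg] at e2
    rw [e1] at e2
    cases l.pos <;> simp at e2

theorem dnfTrue_restrictDnf {G : Dnf V} {π : V → Option Bool} {a : V → Bool}
    (h : ∀ x v, π x = some v → a x = v) : DnfTrue a (restrictDnf G π) ↔ DnfTrue a G := by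
  constructor
  · rintro ⟨q', hq', ht⟩
    obtain ⟨q, hq, rfl⟩ := Finset.mem_image.1 hq'
    refine ⟨q, (Finset.mem_filter.1 hq).1, fun l hl => ?_⟩
    by_cases hs : litSatP π l
    · exact h _ _ hs
    · exact ht l (Finset.mem_filter.2 ⟨hl, hs⟩)
  · rintro ⟨q, hq, ht⟩
    refine ⟨_, Finset.mem_image_of_mem _ (Finset.mem_filter.2 ⟨hq, ?_⟩),
      fun l hl => ht l (Finset.mem_filter.1 hl).1⟩
    rintro ⟨l, hl, hf⟩
    have h1 := h _ _ hf
    rw [ht l hl] at h1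
    cases l.pos <;> simp at h1

namespace Switching

variable {R L W : Type} [Fintype R] [Fintype L] [Fintype W] [DecidableEq R] [DecidableEq L]
  [DecidableEq W] {K : ℕ}

/-- Variables grouped in blocks: one root block, and for each line `K` copies of its activity bit
together with data bits. -/
abbrev BlockVar (R L W : Type) (K : ℕ) := R ⊕ L × (Fin K ⊕ W)

/-- The block of a variable; `none` is the root block. -/
def block : BlockVar R L W K → Option L := Sum.elim (fun _ => none) (fun p => some p.1)

/-- A line is active when all copies of its activity bit are true. -/
def LineActive (a : BlockVar R L W K → Bool) (q : L) : Prop := ∀ c, a (.inr (q, .inl c)) = true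

/-- `a` agrees with `a₀` on all activity bits and on all variables of inactive lines. -/
def Follows (a₀ a : BlockVar R L W K → Bool) : Prop :=
  ∀ q w, (w.isLeft = true ∨ ¬ LineActive a₀ q) → a (.inr (q, w)) = a₀ (.inr (q, w))

/-- Agreement on the blocks in `Q`. -/
def AgreeOn (Q : Finset (Option L)) (a a' : BlockVar R L W K → Bool) : Prop :=
  ∀ x, block x ∈ Q → a' x = a x

theorem AgreeOn.mono {Q Q' : Finset (Option L)} {a a' : BlockVar R L W K → Bool}
    (h : AgreeOn Q a a') (hQ : Q' ⊆ Q) : AgreeOn Q' a a' := fun x hx => h x (hQ hx)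

theorem AgreeOn.trans {Q : Finset (Option L)} {a a' a'' : BlockVar R L W K → Bool}
    (h : AgreeOn Q a a') (h' : AgreeOn Q a' a'') : AgreeOn Q a a'' :=
  fun x hx => (h' x hx).trans (h x hx)

/-- The values of the blocks in `Q` determine the truth value of `G`. -/
def Decided (a₀ : BlockVar R L W K → Bool) (G : Dnf (BlockVar R L W K)) (Q : Finset (Option L))
    (a : BlockVar R L W K → Bool) : Prop :=
  (∀ a', Follows a₀ a' → AgreeOn Q a a' → DnfTrue a' G) ∨
    (∀ a', Follows a₀ a' → AgreeOn Q a a' → ¬ DnfTrue a' G)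

/-- Any state with fewer than `cap` blocks can be extended by any further block. -/
def Extendable (Valid : Finset (Option L) → (BlockVar R L W K → Bool) → Prop) (cap : ℕ) : Prop :=
  ∀ Q a b, Valid Q a → Q.card < cap → ∃ a', AgreeOn Q a a' ∧ Valid (insert b Q) a'

/-- Any state can be extended by at most `H` blocks which decide `G`. -/
def Good (Valid : Finset (Option L) → (BlockVar R L W K → Bool) → Prop) (cap : ℕ)
    (a₀ : BlockVar R L W K → Bool) (G : Dnf (BlockVar R L W K)) (H : ℕ) : Prop :=
  ∀ Q a, Valid Q a → Q.card + H ≤ cap → ∃ Q' a', Q'.card ≤ H ∧ AgreeOn Q a a' ∧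
    Valid (Q ∪ Q') a' ∧ Decided a₀ G Q' a'

theorem Extendable.union {Valid : Finset (Option L) → (BlockVar R L W K → Bool) → Prop} {cap : ℕ}
    (h : Extendable Valid cap) (Q' : Finset (Option L)) : ∀ Q a, Valid Q a →
    Q.card + Q'.card ≤ cap → ∃ a', AgreeOn Q a a' ∧ Valid (Q ∪ Q') a' := by
  induction Q' using Finset.induction_on with
  | empty => exact fun Q a hv _ => ⟨a, fun _ _ => rfl, by simpa using hv⟩
  | insert b Q' hb ih =>
    intro Q a hv hc
    rw [Finset.card_insert_of_notMem hb] at hc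
    obtain ⟨a1, h1, h2⟩ := ih Q a hv (by omega)
    obtain ⟨a2, h3, h4⟩ := h _ _ b h2 (by
      have := Finset.card_union_le Q Q'
      omega)
    refine ⟨a2, h1.trans (h3.mono Finset.subset_union_left), ?_⟩
    rwa [Finset.union_insert]

/-- The partial assignment given by values for the blocks in `Q`. -/
noncomputable def blockAssign (Q : Finset (Option L))
    (π : {x : BlockVar R L W K // block x ∈ Q} → Bool) (x : BlockVar R L W K) : Option Bool :=
  if h : block x ∈ Q then some (π ⟨x, h⟩) else none

theorem good_of_restrict {Valid : Finset (Option L) → (BlockVar R L W K → Bool) → Prop} {cap : ℕ}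
    (hext : Extendable Valid cap) {a₀ : BlockVar R L W K → Bool} {G : Dnf (BlockVar R L W K)}
    {H H₁ : ℕ} (Q₁ : Finset (Option L)) (hQ₁ : Q₁.card ≤ H₁)
    (h : ∀ π, Good Valid cap a₀ (restrictDnf G (blockAssign Q₁ π)) H) :
    Good Valid cap a₀ G (H₁ + H) := by
  intro Q a hv hc
  obtain ⟨a1, h1, h2⟩ := hext.union Q₁ Q a hv (by omega)
  obtain ⟨Q', a', h3, h4, h5, h6⟩ := h (fun x => a1 x.1) (Q ∪ Q₁) a1 h2 (by
    have := Finset.card_union_le Q Q₁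
    omega)
  refine ⟨Q₁ ∪ Q', a', (Finset.card_union_le _ _).trans (by omega),
    h1.trans (h4.mono Finset.subset_union_left), by rwa [← Finset.union_assoc], ?_⟩
  have key : ∀ a'', AgreeOn (Q₁ ∪ Q') a' a'' → (DnfTrue a''
      (restrictDnf G (blockAssign Q₁ fun x => a1 x.1)) ↔ DnfTrue a'' G) := by
    intro a'' ha''
    refine dnfTrue_restrictDnf fun x v hx => ?_
    unfold blockAssign at hx
    split_ifs at hx with hb
    rw [← Option.some.inj hx, ha'' x (Finset.mem_union_left _ hb),
      h4 x (Finset.mem_union_right _ hb)]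
  rcases h6 with h6 | h6
  · exact Or.inl fun a'' hf ha => (key a'' ha).1 (h6 a'' hf (ha.mono Finset.subset_union_right))
  · exact Or.inr fun a'' hf ha h' =>
      h6 a'' hf (ha.mono Finset.subset_union_right) ((key a'' ha).2 h')

theorem exists_of_mem_restrict {Q : Finset (Option L)}
    {π : {x : BlockVar R L W K // block x ∈ Q} → Bool} {G : Dnf (BlockVar R L W K)}
    {q' : PTerm (BlockVar R L W K)} (h : q' ∈ restrictDnf G (blockAssign Q π)) :
    ∃ q ∈ G, q' ⊆ q ∧ (∀ l ∈ q, l ∈ q' ↔ block l.var ∉ Q) ∧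
      ((∃ a, TermTrue a q') → ∃ a, TermTrue a q) := by
  obtain ⟨q, hq, rfl⟩ := Finset.mem_image.1 h
  rw [Finset.mem_filter] at hq
  have hsat : ∀ l ∈ q, ∀ hb : block l.var ∈ Q, π ⟨l.var, hb⟩ = l.pos := by
    intro l hl hb
    by_contra hne
    refine hq.2 ⟨l, hl, ?_⟩
    simp only [litFalsP, blockAssign, hb, dif_pos, Option.some.injEq]
    revert hne
    cases π ⟨l.var, hb⟩ <;> cases l.pos <;> simp
  refine ⟨q, hq.1, Finset.filter_subset _ _, ?_, ?_⟩
  · intro l hl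
    rw [Finset.mem_filter]
    by_cases hb : block l.var ∈ Q
    · simp [litSatP, blockAssign, hb, hsat l hl hb]
    · simp [litSatP, blockAssign, hb, hl]
  · rintro ⟨a, ha⟩
    refine ⟨fun x => if hb : block x ∈ Q then π ⟨x, hb⟩ else a x, fun l hl => ?_⟩
    by_cases hb : block l.var ∈ Q
    · simp [hb, hsat l hl hb]
    · simp only [hb, dif_neg, not_false_eq_true]
      refine ha l (Finset.mem_filter.2 ⟨hl, ?_⟩)
      simp [litSatP, blockAssign, hb]

theorem card_block_mem_le {v : ℕ}
    (hv : ∀ b, (univ.filter fun x : BlockVar R L W K => block x = b).card ≤ v)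
    (Q : Finset (Option L)) :
    Fintype.card ({x : BlockVar R L W K // block x ∈ Q} → Bool) ≤ 2 ^ (Q.card * v) := by
  rw [Fintype.card_fun, Fintype.card_bool]
  refine Nat.pow_le_pow_right (by norm_num) ?_
  rw [Fintype.card_subtype]
  calc (univ.filter fun x : BlockVar R L W K => block x ∈ Q).card
      ≤ (Q.biUnion fun b => univ.filter fun x : BlockVar R L W K => block x = b).card := by
        refine Finset.card_le_card fun x hx => ?_
        simpa using hx
    _ ≤ Q.card * v := Finset.card_biUnion_le_card_mul _ _ _ fun b _ => hv b

/-- The event that a term is satisfied by the values of inactive lines contains a subcube of small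
codimension. -/
theorem exists_subcube {k : ℕ} (hK : k < K) {q : PTerm (BlockVar R L W K)} (hq : q.card ≤ k)
    (hroot : ∀ l ∈ q, block l.var ≠ none) (hcons : ∃ a, TermTrue a q) :
    ∃ (U : Finset (BlockVar R L W K)) (p : BlockVar R L W K → Bool), U.card ≤ 2 * k ∧
      (∀ x ∈ U, block x ∈ q.image fun l => block l.var) ∧
      ∀ a₀, (∀ x ∈ U, a₀ x = p x) → ∀ a, Follows a₀ a → TermTrue a q := by
  obtain ⟨a1, ha1⟩ := hcons
  have hvars : (q.image Lit.var).card ≤ k := Finset.card_image_le.trans hq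
  have hfree : ∀ t : L, ∃ c : Fin K, (.inr (t, .inl c) : BlockVar R L W K) ∉ q.image Lit.var := by
    intro t
    by_contra hcon
    push Not at hcon
    have : (univ.image fun c : Fin K => (.inr (t, .inl c) : BlockVar R L W K)).card ≤ k :=
      (Finset.card_le_card (by intro x hx; simp only [Finset.mem_image] at hx
                               obtain ⟨c, -, rfl⟩ := hx; exact hcon c)).trans hvars
    rw [Finset.card_image_of_injective _ (by intro c c' h; simpa using h), Finset.card_univ,
      Fintype.card_fin] at this
    omega
  choose c hc using hfree
  let w : Lit (BlockVar R L W K) → BlockVar R L W K := fun l =>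
    match l.var with
    | .inl r => .inl r
    | .inr (t, _) => .inr (t, .inl (c t))
  refine ⟨q.image Lit.var ∪ q.image w, fun x => if x ∈ q.image Lit.var then a1 x else false,
    ?_, ?_, ?_⟩
  · refine (Finset.card_union_le _ _).trans ?_
    have : (q.image w).card ≤ q.card := Finset.card_image_le
    omega
  · intro x hx
    rcases Finset.mem_union.1 hx with hx | hx
    · obtain ⟨l, hl, rfl⟩ := Finset.mem_image.1 hx
      exact Finset.mem_image_of_mem (fun l : Lit (BlockVar R L W K) => block l.var) hl
    · obtain ⟨l, hl, rfl⟩ := Finset.mem_image.1 hx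
      refine Finset.mem_image.2 ⟨l, hl, ?_⟩
      simp only [w]
      rcases l.var with r | ⟨t, _⟩ <;> rfl
  · intro a₀ ha₀ a hfol l hl
    have h1 := hroot l hl
    have h2 : a₀ l.var = a1 l.var := by
      have hm := Finset.mem_image_of_mem Lit.var hl
      exact (ha₀ _ (Finset.mem_union_left _ hm)).trans (if_pos hm)
    have h3 := ha₀ (w l) (Finset.mem_union_right _ (Finset.mem_image_of_mem w hl))
    rw [← ha1 l hl, ← h2]
    simp only [w] at h3
    rcases hlv : l.var with r | ⟨t, x⟩
    · rw [hlv] at h1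
      exact absurd rfl h1
    · rw [hlv] at h3
      refine hfol t x (Or.inr fun hact => ?_)
      have h4 := hact (c t)
      simp only [hc t, if_false] at h3
      rw [h3] at h4
      exact Bool.noConfusion h4

/-- The depth of the decision procedure for terms with at most `j` literals. -/
def depth (k X : ℕ) : ℕ → ℕ → ℕ
  | 0, _ => 0
  | j + 1, T => k * T + depth k X j (T * X)

variable (Valid : (BlockVar R L W K → Bool) → Finset (Option L) → (BlockVar R L W K → Bool) → Prop)

theorem good_of_const {a₀ : BlockVar R L W K → Bool}
    {cap H : ℕ} {G : Dnf (BlockVar R L W K)}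
    (h : (∀ a, Follows a₀ a → DnfTrue a G) ∨ ∀ a, Follows a₀ a → ¬ DnfTrue a G) :
    Good (Valid a₀) cap a₀ G H := by
  intro Q a hv _
  exact ⟨∅, a, by simp, fun _ _ => rfl, by simpa using hv, h.imp (fun h a' hf _ => h a' hf)
    (fun h a' hf _ => h a' hf)⟩

/-- Union bound over the values of the blocks in a set `Q`. -/
theorem card_not_good_le_of_restrict {v cap H H₁ : ℕ}
    (hv : ∀ b, (univ.filter fun x : BlockVar R L W K => block x = b).card ≤ v)
    {G : Dnf (BlockVar R L W K)} (Q : Finset (Option L)) (hQ : Q.card ≤ H₁) {ε : ℝ} (hε : 0 ≤ ε)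
    (h : ∀ π, ((univ.filter fun a₀ => Extendable (Valid a₀) cap ∧
      ¬ Good (Valid a₀) cap a₀ (restrictDnf G (blockAssign Q π)) H).card : ℝ) ≤ ε) :
    ((univ.filter fun a₀ => Extendable (Valid a₀) cap ∧
      ¬ Good (Valid a₀) cap a₀ G (H₁ + H)).card : ℝ) ≤ 2 ^ (H₁ * v) * ε := by
  have hsub : (univ.filter fun a₀ => Extendable (Valid a₀) cap ∧
      ¬ Good (Valid a₀) cap a₀ G (H₁ + H)) ⊆
      (univ : Finset ({x : BlockVar R L W K // block x ∈ Q} → Bool)).biUnion fun π =>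
        univ.filter fun a₀ => Extendable (Valid a₀) cap ∧
          ¬ Good (Valid a₀) cap a₀ (restrictDnf G (blockAssign Q π)) H := by
    intro a₀ ha
    simp only [Finset.mem_filter, Finset.mem_univ, true_and, Finset.mem_biUnion] at ha ⊢
    by_contra hcon
    push Not at hcon
    exact ha.2 (good_of_restrict ha.1 Q hQ fun π => hcon π ha.1)
  calc ((univ.filter fun a₀ => Extendable (Valid a₀) cap ∧
      ¬ Good (Valid a₀) cap a₀ G (H₁ + H)).card : ℝ)
      ≤ ∑ π : {x : BlockVar R L W K // block x ∈ Q} → Bool,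
          ((univ.filter fun a₀ => Extendable (Valid a₀) cap ∧
          ¬ Good (Valid a₀) cap a₀ (restrictDnf G (blockAssign Q π)) H).card : ℝ) := by
        exact_mod_cast (Finset.card_le_card hsub).trans Finset.card_biUnion_le
    _ ≤ ∑ π : {x : BlockVar R L W K // block x ∈ Q} → Bool, ε := Finset.sum_le_sum fun π _ => h π
    _ = Fintype.card ({x : BlockVar R L W K // block x ∈ Q} → Bool) * ε := by simp
    _ ≤ 2 ^ (H₁ * v) * ε := by
        refine mul_le_mul_of_nonneg_right ?_ hε
        have h1 := (card_block_mem_le hv Q).trans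
          (Nat.pow_le_pow_right (n := 2) (by norm_num) (Nat.mul_le_mul_right v hQ))
        exact_mod_cast h1

/-- Switching lemma for DNFs which do not mention the root block. -/
theorem card_not_good_le {k v X cap : ℕ} (hK : k < K)
    (hv : ∀ b, (univ.filter fun x : BlockVar R L W K => block x = b).card ≤ v)
    (hX : (2 : ℝ) ^ (k * v) * (1 - 1 / 2 ^ (2 * k)) ^ X ≤ 1 - 1 / 2 ^ (2 * k))
    (j : ℕ) (hj : j ≤ k) : ∀ (T : ℕ) (G : Dnf (BlockVar R L W K)),
    (∀ q ∈ G, (∃ a, TermTrue a q) → q.card ≤ j ∧ ∀ l ∈ q, block l.var ≠ none) →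
    ((univ.filter fun a₀ => Extendable (Valid a₀) cap ∧
      ¬ Good (Valid a₀) cap a₀ G (depth k X j T)).card : ℝ) ≤
        (1 - 1 / 2 ^ (2 * k)) ^ T * Fintype.card (BlockVar R L W K → Bool) := by
  have hθ : (0 : ℝ) ≤ 1 - 1 / 2 ^ (2 * k) := by
    rw [sub_nonneg, div_le_one (by positivity)]; exact one_le_pow₀ (by norm_num)
  have hconst : ∀ (G : Dnf (BlockVar R L W K)) (T H : ℕ), ((∀ a, DnfTrue a G) ∨
      ∀ a, ¬ DnfTrue a G) → ((univ.filter fun a₀ => Extendable (Valid a₀) cap ∧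
      ¬ Good (Valid a₀) cap a₀ G H).card : ℝ) ≤
        (1 - 1 / 2 ^ (2 * k)) ^ T * Fintype.card (BlockVar R L W K → Bool) := by
    intro G T H h
    rw [Finset.filter_false_of_mem]
    · simp only [Finset.card_empty, Nat.cast_zero]; positivity
    · rintro a₀ - ⟨-, hng⟩
      exact hng (good_of_const Valid (h.imp (fun h a _ => h a) (fun h a _ => h a)))
  induction j with
  | zero =>
    intro T G hG
    refine hconst G T _ ?_
    by_cases he : ∅ ∈ G
    · exact Or.inl fun a => ⟨∅, he, by simp [TermTrue]⟩
    · refine Or.inr fun a => ?_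
      rintro ⟨q, hq, ht⟩
      have := (hG q hq ⟨a, ht⟩).1
      rw [Nat.le_zero, Finset.card_eq_zero] at this
      exact he (this ▸ hq)
  | succ j ih =>
    intro T G hG
    by_cases he : ∅ ∈ G
    · exact hconst G T _ (Or.inl fun a => ⟨∅, he, by simp [TermTrue]⟩)
    have hcard : ∀ q ∈ G.filter fun q => ∃ a, TermTrue a q,
        (q.image fun l => block l.var).card ≤ k := by
      intro q hq
      have h1 := Finset.mem_filter.1 hq
      exact Finset.card_image_le.trans ((hG q h1.1 h1.2).1.trans hj)
    have hne : ∀ q ∈ G.filter fun q => ∃ a, TermTrue a q,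
        (q.image fun l => block l.var).Nonempty := by
      intro q hq
      have h1 := Finset.mem_filter.1 hq
      rw [Finset.image_nonempty, Finset.nonempty_iff_ne_empty]
      rintro rfl
      exact he h1.1
    rcases exists_disjoint_or_hitting _ _ k hcard hne T with ⟨I, hI, hc, hd⟩ | ⟨Q, hQ, hhit⟩
    · have hsub : ∀ q ∈ I, ∃ (U : Finset (BlockVar R L W K)) (p : BlockVar R L W K → Bool),
          U.card ≤ 2 * k ∧ (∀ x ∈ U, block x ∈ q.image fun l => block l.var) ∧
          ∀ a₀, (∀ x ∈ U, a₀ x = p x) → ∀ a, Follows a₀ a → TermTrue a q := by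
        intro q hq
        have h1 := Finset.mem_filter.1 (hI hq)
        have h2 := hG q h1.1 h1.2
        exact exists_subcube hK (h2.1.trans hj) h2.2 h1.2
      choose! U p hU1 hU2 hU3 using hsub
      have hdU : (I : Set _).PairwiseDisjoint U := by
        intro q hq q' hq' hne
        refine Finset.disjoint_left.2 fun x hx hx' => ?_
        exact Finset.disjoint_left.1 (hd hq hq' hne) (hU2 q hq x hx) (hU2 q' hq' x hx')
      have := card_avoid_subcubes_le (2 * k) I U p hdU hU1
      rw [hc] at this
      refine le_trans ?_ this
      norm_cast
      refine Finset.card_le_card fun a₀ ha => ?_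
      simp only [Finset.mem_filter, Finset.mem_univ, true_and] at ha ⊢
      by_contra hcon
      push Not at hcon
      obtain ⟨q, hq, hx⟩ := hcon
      refine ha.2 (good_of_const Valid (Or.inl fun a hf => ⟨q, ?_, ?_⟩))
      · exact (Finset.mem_filter.1 (hI hq)).1
      · exact hU3 q hq a₀ hx a hf
    · have hrec := card_not_good_le_of_restrict Valid hv (cap := cap)
        (H := depth k X j (T * X)) (G := G) Q hQ
        (ε := (1 - 1 / 2 ^ (2 * k)) ^ (T * X) * Fintype.card (BlockVar R L W K → Bool))
        (by positivity) ?_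
      · refine hrec.trans ?_
        rw [← mul_assoc]
        refine mul_le_mul_of_nonneg_right ?_ (by positivity)
        calc (2 : ℝ) ^ (k * T * v) * (1 - 1 / 2 ^ (2 * k)) ^ (T * X)
            = (2 ^ (k * v) * (1 - 1 / 2 ^ (2 * k)) ^ X) ^ T := by
              rw [mul_pow, ← pow_mul, ← pow_mul, mul_comm X T]; ring_nf
          _ ≤ _ := pow_le_pow_left₀ (by positivity) hX T
      · intro π
        refine ih (by omega) (T * X) _ ?_
        intro q' hq' hcons
        obtain ⟨q, hq, hsub, hmem, hc⟩ := exists_of_mem_restrict hq'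
        have h1 := hG q hq (hc hcons)
        refine ⟨?_, fun l hl => h1.2 l (hsub hl)⟩
        obtain ⟨b, hb, hbQ⟩ := hhit q (Finset.mem_filter.2 ⟨hq, hc hcons⟩)
        obtain ⟨l, hl, rfl⟩ := Finset.mem_image.1 hb
        have hlt : q' ⊂ q := by
          refine Finset.ssubset_iff_subset_ne.2 ⟨hsub, ?_⟩
          rintro rfl
          exact (hmem l hl).1 hl hbQ
        have := Finset.card_lt_card hlt
        omega

/-- Switching lemma. -/
theorem card_not_good_le' {k v X cap : ℕ} (hK : k < K)
    (hv : ∀ b, (univ.filter fun x : BlockVar R L W K => block x = b).card ≤ v)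
    (hX : (2 : ℝ) ^ (k * v) * (1 - 1 / 2 ^ (2 * k)) ^ X ≤ 1 - 1 / 2 ^ (2 * k))
    (T : ℕ) (G : Dnf (BlockVar R L W K)) (hG : ∀ q ∈ G, q.card ≤ k) :
    ((univ.filter fun a₀ => Extendable (Valid a₀) cap ∧
      ¬ Good (Valid a₀) cap a₀ G (1 + depth k X k T)).card : ℝ) ≤
        2 ^ v * ((1 - 1 / 2 ^ (2 * k)) ^ T * Fintype.card (BlockVar R L W K → Bool)) := by
  have hθ : (0 : ℝ) ≤ 1 - 1 / 2 ^ (2 * k) := by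
    rw [sub_nonneg, div_le_one (by positivity)]; exact one_le_pow₀ (by norm_num)
  have := card_not_good_le_of_restrict Valid hv (cap := cap) (H := depth k X k T) (G := G)
    {none} (H₁ := 1) (by simp)
    (ε := (1 - 1 / 2 ^ (2 * k)) ^ T * Fintype.card (BlockVar R L W K → Bool)) (by positivity) ?_
  · simpa using this
  · intro π
    refine card_not_good_le Valid hK hv hX k le_rfl T _ ?_
    intro q' hq' _
    obtain ⟨q, hq, hsub, hmem, -⟩ := exists_of_mem_restrict hq'
    refine ⟨(Finset.card_le_card hsub).trans (hG q hq), fun l hl => ?_⟩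
    simpa using (hmem l (hsub hl)).1 hl

end Switching

/-- Renaming the variable of a literal. -/
def Lit.map {X : Type} (x : X → V) (l : Lit X) : Lit V := ⟨x l.var, l.pos⟩

theorem Lit.map_injective {X : Type} {x : X → V} (hx : Function.Injective x) :
    Function.Injective (Lit.map x) := by
  rintro ⟨a, p⟩ ⟨b, p'⟩ h
  simp only [Lit.map, Lit.mk.injEq] at h
  rw [hx h.1, h.2]

/-- The pullback of a DNF along an injective renaming of variables; other variables are set to
false. -/
noncomputable def pullDnf {X : Type} [DecidableEq X] {x : X → V} (hx : Function.Injective x)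
    (G : Dnf V) : Dnf X :=
  (G.filter fun q => ∀ l ∈ q, l.var ∉ Set.range x → l.pos = false).image fun q =>
    q.preimage (Lit.map x) (Lit.map_injective hx).injOn

theorem dnfTrue_pullDnf {X : Type} [DecidableEq X] {x : X → V} (hx : Function.Injective x)
    (G : Dnf V) (a : X → Bool) :
    DnfTrue a (pullDnf hx G) ↔ DnfTrue (Function.extend x a fun _ => false) G := by
  constructor
  · rintro ⟨q', hq', ht⟩
    obtain ⟨q, hq, rfl⟩ := Finset.mem_image.1 hq'
    rw [Finset.mem_filter] at hq
    refine ⟨q, hq.1, fun l hl => ?_⟩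
    by_cases hr : l.var ∈ Set.range x
    · obtain ⟨z, hz⟩ := hr
      rw [← hz, hx.extend_apply]
      exact ht ⟨z, l.pos⟩ (by simpa [Lit.map, hz] using hl)
    · rw [Function.extend_apply' _ _ _ hr, hq.2 l hl hr]
  · rintro ⟨q, hq, ht⟩
    refine ⟨_, Finset.mem_image_of_mem _ (Finset.mem_filter.2 ⟨hq, fun l hl hr => ?_⟩),
      fun l hl => ?_⟩
    · rw [← ht l hl, Function.extend_apply' _ _ _ hr]
    · have := ht _ (Finset.mem_preimage.1 hl)
      simpa [Lit.map, hx.extend_apply] using this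

theorem card_le_of_mem_pullDnf {X : Type} [DecidableEq X] {x : X → V}
    (hx : Function.Injective x) {G : Dnf V} {k : ℕ} (hG : IsKDnf k G) :
    ∀ q ∈ pullDnf hx G, q.card ≤ k := by
  intro q' hq'
  obtain ⟨q, hq, rfl⟩ := Finset.mem_image.1 hq'
  refine le_trans ?_ (hG q (Finset.mem_filter.1 hq).1)
  rw [← Finset.card_image_of_injective _ (Lit.map_injective hx)]
  refine Finset.card_le_card fun l hl => ?_
  obtain ⟨l', hl', rfl⟩ := Finset.mem_image.1 hl
  exact Finset.mem_preimage.1 hl'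

namespace RefTree

open Switching

/-- Addresses of lines within a layer. -/
abbrev Addr (g : ℕ) := Fin g → Bool

/-- Lines, arranged in `N + 1` layers. -/
abbrev LineId (N g : ℕ) := Fin (N + 1) × Addr g

/-- Data bits of a line: an assignment of `N` bits and two pointers. -/
abbrev LineData (N g : ℕ) := Fin N ⊕ Bool × Fin g

/-- Variables describing a layered decision tree refutation. -/
abbrev RefVar (N g K : ℕ) := BlockVar (Fin g) (LineId N g) (LineData N g) K

section Formula

variable {N g K : ℕ} (x : RefVar N g K → V) (Cl : Addr g → Clause (Fin N))

/-- The variable of a bit of the pointer to the root line. -/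
def rootVar (b : Fin g) : V := x (.inl b)
/-- The variable of a copy of the activity bit of a line. -/
def copyVar (q : LineId N g) (c : Fin K) : V := x (.inr (q, .inl c))
/-- The variable of a bit of the assignment at a line. -/
def valVar (q : LineId N g) (i : Fin N) : V := x (.inr (q, .inr (.inl i)))
/-- The variable of a bit of the pointer `s` of a line. -/
def ptrVar (q : LineId N g) (s : Bool) (b : Fin g) : V := x (.inr (q, .inr (.inr (s, b))))

/-- The line is inactive. -/
def negActive (q : LineId N g) : Clause V := univ.image fun c => ⟨copyVar x q c, false⟩
/-- The pointer `s` of the line is not `j`. -/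
def negPtr (q : LineId N g) (s : Bool) (j : Addr g) : Clause V :=
  univ.image fun b => ⟨ptrVar x q s b, !(j b)⟩
/-- The root pointer is not `j`. -/
def negRoot (j : Addr g) : Clause V := univ.image fun b => ⟨rootVar x b, !(j b)⟩

/-- The clauses stating that the variables describe a decision tree, of a layered form, which
solves the search problem of the clauses `Cl`. -/
inductive IsRefClause : Clause V → Prop
  | keep (t : Fin N) (j : Addr g) (s : Bool) (j' : Addr g) (i : Fin N) (v : Bool) (hi : i < t) :
      IsRefClause (negActive x (t.castSucc, j) ∪ negPtr x (t.castSucc, j) s j' ∪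
        {⟨valVar x (t.castSucc, j) i, !v⟩, ⟨valVar x (t.succ, j') i, v⟩})
  | branch (t : Fin N) (j : Addr g) (s : Bool) (j' : Addr g) :
      IsRefClause (negActive x (t.castSucc, j) ∪ negPtr x (t.castSucc, j) s j' ∪
        {⟨valVar x (t.succ, j') t, s⟩})
  | active (t : Fin N) (j : Addr g) (s : Bool) (j' : Addr g) (c : Fin K) :
      IsRefClause (negActive x (t.castSucc, j) ∪ negPtr x (t.castSucc, j) s j' ∪
        {⟨copyVar x (t.succ, j') c, true⟩})
  | leaf (j e : Addr g) (i : Fin N) (v : Bool) (hl : ⟨i, v⟩ ∈ Cl e) :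
      IsRefClause (negActive x (Fin.last N, j) ∪ negPtr x (Fin.last N, j) false e ∪
        {⟨valVar x (Fin.last N, j) i, !v⟩})
  | root (j : Addr g) (c : Fin K) :
      IsRefClause (negRoot x j ∪ {⟨copyVar x (0, j) c, true⟩})

end Formula

section Hardness

variable {N g K : ℕ} {Cl : Addr g → Clause (Fin N)}

/-- The address stored in pointer `s` of a line. -/
def ptrOf (a : RefVar N g K → Bool) (q : LineId N g) (s : Bool) : Addr g :=
  fun b => a (.inr (q, .inr (.inr (s, b))))

/-- The assignment stored at a line. -/
def valOf (a : RefVar N g K → Bool) (q : LineId N g) (i : Fin N) : Bool :=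
  a (.inr (q, .inr (.inl i)))

/-- The constraints on the pointers of a block. -/
structure Consistent (Cl : Addr g → Clause (Fin N)) (a : RefVar N g K → Bool)
    (b : Option (LineId N g)) : Prop where
  root : b = none → LineActive a (0, fun b => a (.inl b))
  inner : ∀ (t : Fin N) (j : Addr g), b = some (t.castSucc, j) → LineActive a (t.castSucc, j) →
    ∀ s, LineActive a (t.succ, ptrOf a (t.castSucc, j) s) ∧
      (∀ i < t, valOf a (t.succ, ptrOf a (t.castSucc, j) s) i = valOf a (t.castSucc, j) i) ∧
      valOf a (t.succ, ptrOf a (t.castSucc, j) s) t = s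
  leaf : ∀ j, b = some (Fin.last N, j) → LineActive a (Fin.last N, j) →
    ∀ l ∈ Cl (ptrOf a (Fin.last N, j) false), valOf a (Fin.last N, j) l.var ≠ l.pos

/-- States of the adversary. -/
def Valid (Cl : Addr g → Clause (Fin N)) (a₀ : RefVar N g K → Bool)
    (Q : Finset (Option (LineId N g))) (a : RefVar N g K → Bool) : Prop :=
  Follows a₀ a ∧ ∀ b ∈ Q, Consistent Cl a b

theorem lineActive_congr {a a' : RefVar N g K → Bool}
    (h : ∀ q c, a' (.inr (q, .inl c)) = a (.inr (q, .inl c))) (q : LineId N g) :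
    LineActive a' q ↔ LineActive a q := by
  simp only [LineActive, h]

theorem Follows.lineActive_iff {a₀ a : RefVar N g K → Bool} (h : Follows a₀ a)
    (q : LineId N g) : LineActive a q ↔ LineActive a₀ q :=
  lineActive_congr (fun q c => h q (.inl c) (Or.inl rfl)) q

/-- Consistency of a block depends only on activity bits, on the block, and on the assignments at
the lines it points to. -/
theorem Consistent.congr {a a' : RefVar N g K → Bool} {b : Option (LineId N g)}
    (h : Consistent Cl a b)
    (hact : ∀ q c, a' (.inr (q, .inl c)) = a (.inr (q, .inl c)))
    (hb : ∀ x, block x = b → a' x = a x)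
    (hsucc : ∀ (t : Fin N) (j : Addr g) (s : Bool) (i : Fin N), b = some (t.castSucc, j) →
      valOf a' (t.succ, ptrOf a (t.castSucc, j) s) i =
        valOf a (t.succ, ptrOf a (t.castSucc, j) s) i) : Consistent Cl a' b := by
  have hp : ∀ q s, b = some q → ptrOf a' q s = ptrOf a q s :=
    fun q s hq => funext fun c => hb _ hq.symm
  have hv : ∀ q i, b = some q → valOf a' q i = valOf a q i := fun q i hq => hb _ hq.symm
  refine ⟨fun hn => ?_, fun t j hq ha s => ?_, fun j hq ha l hl => ?_⟩
  · have : (fun b => a' (.inl b)) = fun b => a (.inl b) := funext fun c => hb _ hn.symm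
    rw [lineActive_congr hact, this]
    exact h.root hn
  · rw [lineActive_congr hact] at ha
    obtain ⟨h1, h2, h3⟩ := h.inner t j hq ha s
    rw [hp _ _ hq, lineActive_congr hact]
    refine ⟨h1, fun i hi => ?_, ?_⟩
    · rw [hsucc t j s i hq, hv _ _ hq, h2 i hi]
    · rw [hsucc t j s t hq, h3]
  · rw [lineActive_congr hact] at ha
    rw [hp _ _ hq] at hl
    rw [hv _ _ hq]
    exact h.leaf j hq ha l hl

theorem exists_fresh {a₀ : RefVar N g K → Bool} {cap A : ℕ} (hA : 3 * cap + 2 ≤ A)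
    (hact : ∀ t, A ≤ (univ.filter fun j => LineActive a₀ (t, j)).card)
    (Q : Finset (Option (LineId N g))) (hQ : Q.card ≤ cap) (a : RefVar N g K → Bool)
    (t : Fin (N + 1)) :
    ∃ j0 j1 : Addr g, j0 ≠ j1 ∧ ∀ j, (j = j0 ∨ j = j1) → LineActive a₀ (t, j) ∧
      some (t, j) ∉ Q ∧ ∀ q s, some q ∈ Q → ptrOf a q s ≠ j := by
  set F₁ : Finset (Addr g) := Q.image fun o => o.elim default Prod.snd
  set F₂ : Finset (Addr g) := (Q ×ˢ (univ : Finset Bool)).image fun o =>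
    o.1.elim default fun q => ptrOf a q o.2
  have h1 : F₁.card ≤ cap := Finset.card_image_le.trans hQ
  have h2 : F₂.card ≤ 2 * cap := by
    refine Finset.card_image_le.trans ?_
    rw [Finset.card_product, Finset.card_univ, Fintype.card_bool]
    omega
  have h3 : 1 < ((univ.filter fun j => LineActive a₀ (t, j)) \ (F₁ ∪ F₂)).card := by
    have e1 := Finset.le_card_sdiff (F₁ ∪ F₂) (univ.filter fun j => LineActive a₀ (t, j))
    have e2 := Finset.card_union_le F₁ F₂
    have e3 := hact t
    omega
  obtain ⟨j0, hj0, j1, hj1, hne⟩ := Finset.one_lt_card.1 h3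
  refine ⟨j0, j1, hne, fun j hj => ?_⟩
  have hm : j ∈ (univ.filter fun j => LineActive a₀ (t, j)) \ (F₁ ∪ F₂) := by
    rcases hj with rfl | rfl <;> assumption
  rw [Finset.mem_sdiff, Finset.mem_filter, Finset.notMem_union] at hm
  refine ⟨hm.1.2, fun h => hm.2.1 ?_, fun q s h he => hm.2.2 ?_⟩
  · exact Finset.mem_image.2 ⟨_, h, rfl⟩
  · exact Finset.mem_image.2 ⟨(some q, s), by simp [h], he⟩

/-- With enough active lines in each layer, the adversary can answer any query. -/
theorem extendable_valid (hCl : ∀ D : Fin N → Bool, ∃ e, ∀ l ∈ Cl e, D l.var ≠ l.pos)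
    {a₀ : RefVar N g K → Bool} {cap A : ℕ} (hA : 3 * cap + 2 ≤ A)
    (hact : ∀ t, A ≤ (univ.filter fun j => LineActive a₀ (t, j)).card) :
    Extendable (Valid Cl a₀) cap := by
  rintro Q a b ⟨hfol, hcons⟩ hcard
  by_cases hbQ : b ∈ Q
  · exact ⟨a, fun _ _ => rfl, hfol, by rwa [Finset.insert_eq_of_mem hbQ]⟩
  rcases b with _ | ⟨t, j⟩
  · obtain ⟨j0, _, -, h⟩ := exists_fresh hA hact Q hcard.le a 0
    have h0 := h j0 (Or.inl rfl)
    let a' : RefVar N g K → Bool := fun x => match x with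
      | .inl b => j0 b
      | .inr y => a (.inr y)
    have ha' : ∀ x, block x ≠ none → a' x = a x := by
      rintro (b | y) hb
      · exact absurd rfl hb
      · rfl
    refine ⟨a', fun x hx => ha' x (by rintro h; rw [h] at hx; exact hbQ hx), hfol, ?_⟩
    rw [Finset.forall_mem_insert]
    refine ⟨⟨fun _ => ?_, by simp, by simp⟩, fun b hb => (hcons b hb).congr (fun _ _ => rfl)
      (fun x hx => ha' x ?_) (fun _ _ _ _ _ => rfl)⟩
    · exact (Follows.lineActive_iff (a := a') hfol _).2 h0.1
    · rintro h
      exact hbQ (by rwa [← h, hx])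
  by_cases hinact : LineActive a₀ (t, j)
  swap
  · refine ⟨a, fun _ _ => rfl, hfol, ?_⟩
    rw [Finset.forall_mem_insert]
    rw [← Follows.lineActive_iff hfol] at hinact
    refine ⟨⟨by simp, fun t' j' h ha => ?_, fun j' h ha => ?_⟩, hcons⟩
    · rw [← Option.some.inj h] at ha
      exact absurd ha hinact
    · rw [← Option.some.inj h] at ha
      exact absurd ha hinact
  have hactb := (Follows.lineActive_iff hfol _).2 hinact
  induction t using Fin.lastCases with
  | last =>
    obtain ⟨e, he⟩ := hCl (valOf a (Fin.last N, j))
    let a' : RefVar N g K → Bool := fun x => match x with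
      | .inl b => a (.inl b)
      | .inr (q, .inl c) => a (.inr (q, .inl c))
      | .inr (q, .inr (.inl i)) => a (.inr (q, .inr (.inl i)))
      | .inr (q, .inr (.inr (s, b))) =>
        if q = (Fin.last N, j) then e b else a (.inr (q, .inr (.inr (s, b))))
    have ha' : ∀ x, block x ≠ some (Fin.last N, j) → a' x = a x := by
      rintro (b | ⟨q, c | i | ⟨s, b⟩⟩) hb
      · rfl
      · rfl
      · rfl
      · exact if_neg fun h => hb (by rw [h]; rfl)
    have hptr : ptrOf a' (Fin.last N, j) false = e := funext fun b => if_pos rfl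
    refine ⟨a', fun x hx => ha' x (by rintro h; rw [h] at hx; exact hbQ hx), ?_, ?_⟩
    · intro q w hw
      refine Eq.trans ?_ (hfol q w hw)
      rcases w with c | w
      · rfl
      · refine ha' _ fun h => ?_
        rw [← Option.some.inj h] at hinact
        rcases hw with hw | hw
        · exact Bool.noConfusion hw
        · exact hw hinact
    · rw [Finset.forall_mem_insert]
      refine ⟨⟨by simp, fun t' j' h => ?_, fun j' h _ l hl => ?_⟩, fun b hb =>
        (hcons b hb).congr (fun _ _ => rfl) (fun x hx => ha' x ?_) (fun _ _ _ _ _ => rfl)⟩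
      · exact absurd (Prod.mk.inj (Option.some.inj h)).1.symm (Fin.castSucc_lt_last t').ne
      · obtain rfl : j = j' := (Prod.mk.inj (Option.some.inj h)).2
        rw [hptr] at hl
        exact he l hl
      · rintro h
        exact hbQ (by rwa [← h, hx])
  | cast t =>
    obtain ⟨j0, j1, hne, h⟩ := exists_fresh hA hact Q hcard.le a t.succ
    let D : Bool → Fin N → Bool := fun s i => if i = t then s else valOf a (t.castSucc, j) i
    let a' : RefVar N g K → Bool := fun x => match x with
      | .inl b => a (.inl b)
      | .inr (q, .inl c) => a (.inr (q, .inl c))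
      | .inr (q, .inr (.inl i)) => if q = (t.succ, j0) then D false i else
          if q = (t.succ, j1) then D true i else a (.inr (q, .inr (.inl i)))
      | .inr (q, .inr (.inr (s, b))) => if q = (t.castSucc, j) then (if s then j1 else j0) b else
          a (.inr (q, .inr (.inr (s, b))))
    have hnes : t.castSucc ≠ t.succ := (Fin.castSucc_lt_succ (i := t)).ne
    have hval : ∀ q i, q ≠ (t.succ, j0) → q ≠ (t.succ, j1) → valOf a' q i = valOf a q i := by
      intro q i h0 h1
      exact (if_neg h0).trans (if_neg h1)
    have ha' : ∀ x, block x ≠ some (t.castSucc, j) → block x ≠ some (t.succ, j0) →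
        block x ≠ some (t.succ, j1) → a' x = a x := by
      rintro (b | ⟨q, c | i | ⟨s, b⟩⟩) hb h0 h1
      · rfl
      · rfl
      · exact hval q i (fun h => h0 (by rw [h]; rfl)) (fun h => h1 (by rw [h]; rfl))
      · exact if_neg fun h => hb (by rw [h]; rfl)
    have hQ' : ∀ x, block x ∈ Q → a' x = a x := by
      intro x hx
      refine ha' x ?_ ?_ ?_
      · rintro h; rw [h] at hx; exact hbQ hx
      · rintro h'; rw [h'] at hx; exact (h j0 (Or.inl rfl)).2.1 hx
      · rintro h'; rw [h'] at hx; exact (h j1 (Or.inr rfl)).2.1 hx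
    have hfol' : Follows a₀ a' := by
      intro q w hw
      refine Eq.trans ?_ (hfol q w hw)
      rcases w with c | w
      · rfl
      · have hw' : ¬ LineActive a₀ q := hw.resolve_left (by simp)
        refine ha' _ ?_ ?_ ?_
        · intro h'; rw [← Option.some.inj h'] at hinact; exact hw' hinact
        · intro h'
          have := (h j0 (Or.inl rfl)).1
          rw [← Option.some.inj h'] at this; exact hw' this
        · intro h'
          have := (h j1 (Or.inr rfl)).1
          rw [← Option.some.inj h'] at this; exact hw' this
    have hptr : ∀ s, ptrOf a' (t.castSucc, j) s = if s then j1 else j0 :=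
      fun s => funext fun b => if_pos rfl
    refine ⟨a', hQ', hfol', ?_⟩
    rw [Finset.forall_mem_insert]
    refine ⟨⟨by simp, fun t' j' h' _ s => ?_, fun j' h' => ?_⟩, fun b hb =>
        (hcons b hb).congr (fun _ _ => rfl) (fun x hx => hQ' x (hx ▸ hb)) ?_⟩
    · obtain ⟨e1, rfl⟩ := Prod.mk.inj (Option.some.inj h')
      obtain rfl := Fin.castSucc_injective _ e1
      have hself : ∀ i, valOf a' (t.castSucc, j) i = valOf a (t.castSucc, j) i :=
        fun i => hval _ i (fun e => hnes (Prod.mk.inj e).1) (fun e => hnes (Prod.mk.inj e).1)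
      have hnew : ∀ i, valOf a' (t.succ, if s then j1 else j0) i = D s i := by
        intro i
        cases s with
        | false => exact if_pos rfl
        | true =>
          refine (if_neg ?_).trans (if_pos rfl)
          intro e
          exact hne (Prod.mk.inj e).2.symm
      rw [hptr]
      refine ⟨?_, fun i hi => ?_, ?_⟩
      · rw [Follows.lineActive_iff hfol']
        exact (h _ (by cases s <;> simp)).1
      · rw [hnew, hself]
        exact if_neg hi.ne
      · rw [hnew]
        exact if_pos rfl
    · exact absurd (Prod.mk.inj (Option.some.inj h')).1 (Fin.castSucc_lt_last t).ne
    · intro t' j' s i hb'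
      have hp : ∀ j'', (j'' = j0 ∨ j'' = j1) →
          (t'.succ, ptrOf a (t'.castSucc, j') s) ≠ (t.succ, j'') := fun j'' hj e =>
        (h j'' hj).2.2 _ s (hb' ▸ hb) (Prod.mk.inj e).2
      exact hval _ _ (hp j0 (Or.inl rfl)) (hp j1 (Or.inr rfl))

end Hardness

end RefTree

theorem dnfTrue_clauseToDnf {a : V → Bool} {C : Clause V} :
    DnfTrue a (clauseToDnf C) ↔ ∃ l ∈ C, a l.var = l.pos := by
  simp [DnfTrue, clauseToDnf, TermTrue]

namespace RefTree

open Switching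

variable {N g K : ℕ} {Cl : Addr g → Clause (Fin N)} {x : RefVar N g K → V}

theorem true_negActive {f : V → Bool} {a : RefVar N g K → Bool} (hf : ∀ z, f (x z) = a z)
    {q : LineId N g} (h : ¬ LineActive a q) : ∃ l ∈ negActive x q, f l.var = l.pos := by
  simp only [LineActive, not_forall, Bool.not_eq_true] at h
  obtain ⟨c, hc⟩ := h
  exact ⟨_, Finset.mem_image_of_mem _ (Finset.mem_univ c), (hf _).trans hc⟩

theorem true_negPtr {f : V → Bool} {a : RefVar N g K → Bool} (hf : ∀ z, f (x z) = a z)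
    {q : LineId N g} {s : Bool} {j : Addr g} (h : ptrOf a q s ≠ j) :
    ∃ l ∈ negPtr x q s j, f l.var = l.pos := by
  obtain ⟨b, hb⟩ := Function.ne_iff.1 h
  refine ⟨_, Finset.mem_image_of_mem _ (Finset.mem_univ b), (hf _).trans ?_⟩
  exact Bool.eq_not.2 hb

/-- Every clause is implied by the consistency of a single block. -/
theorem IsRefClause.exists_block {C : Clause V} (hC : IsRefClause x Cl C) :
    ∃ b : Option (LineId N g), ∀ (f : V → Bool) (a : RefVar N g K → Bool), (∀ z, f (x z) = a z) →
      Consistent Cl a b → ∃ l ∈ C, f l.var = l.pos := by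
  have guard : ∀ (q : LineId N g) (s : Bool) (j' : Addr g) (E : Clause V) (f : V → Bool)
      (a : RefVar N g K → Bool), (∀ z, f (x z) = a z) →
      (LineActive a q → ptrOf a q s = j' → ∃ l ∈ E, f l.var = l.pos) →
      ∃ l ∈ negActive x q ∪ negPtr x q s j' ∪ E, f l.var = l.pos := by
    intro q s j' E f a hf h
    by_cases h1 : LineActive a q
    swap
    · obtain ⟨l, hl, e⟩ := true_negActive hf h1
      exact ⟨l, by simp [hl], e⟩
    by_cases h2 : ptrOf a q s = j'
    swap
    · obtain ⟨l, hl, e⟩ := true_negPtr hf h2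
      exact ⟨l, by simp [hl], e⟩
    obtain ⟨l, hl, e⟩ := h h1 h2
    exact ⟨l, by simp [hl], e⟩
  cases hC with
  | keep t j s j' i v hi =>
    refine ⟨some (t.castSucc, j), fun f a hf hc => guard _ _ _ _ f a hf fun h1 h2 => ?_⟩
    have h3 := (hc.inner t j rfl h1 s).2.1 i hi
    rw [h2] at h3
    by_cases hv : valOf a (t.succ, j') i = v
    · exact ⟨⟨valVar x (t.succ, j') i, v⟩, by simp, (hf _).trans hv⟩
    · refine ⟨⟨valVar x (t.castSucc, j) i, !v⟩, by simp, (hf _).trans ?_⟩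
      rw [h3] at hv
      exact Bool.eq_not.2 hv
  | branch t j s j' =>
    refine ⟨some (t.castSucc, j), fun f a hf hc => guard _ _ _ _ f a hf fun h1 h2 => ?_⟩
    have h3 := (hc.inner t j rfl h1 s).2.2
    rw [h2] at h3
    exact ⟨_, Finset.mem_singleton_self _, (hf _).trans h3⟩
  | active t j s j' c =>
    refine ⟨some (t.castSucc, j), fun f a hf hc => guard _ _ _ _ f a hf fun h1 h2 => ?_⟩
    have h3 := (hc.inner t j rfl h1 s).1
    rw [h2] at h3
    exact ⟨_, Finset.mem_singleton_self _, (hf _).trans (h3 c)⟩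
  | leaf j e i v hl =>
    refine ⟨some (Fin.last N, j), fun f a hf hc => guard _ _ _ _ f a hf fun h1 h2 => ?_⟩
    have h3 := hc.leaf j rfl h1 ⟨i, v⟩ (h2 ▸ hl)
    exact ⟨_, Finset.mem_singleton_self _, (hf _).trans (Bool.eq_not.2 h3)⟩
  | root j c =>
    refine ⟨none, fun f a hf hc => ?_⟩
    by_cases h : (fun b => a (.inl b)) = j
    · have h3 := hc.root rfl
      rw [h] at h3
      exact ⟨⟨copyVar x (0, j) c, true⟩, by simp, (hf _).trans (h3 c)⟩
    · obtain ⟨b, hb⟩ := Function.ne_iff.1 h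
      refine ⟨⟨rootVar x b, !(j b)⟩, ?_, (hf _).trans (Bool.eq_not.2 hb)⟩
      exact Finset.mem_union_left _ (Finset.mem_image_of_mem _ (Finset.mem_univ b))

/-- Random activity bits make many lines of each layer active. -/
theorem card_few_active_le {A Y : ℕ} (ι : Fin A × Fin Y ↪ Addr g) :
    ((univ.filter fun a₀ : RefVar N g K → Bool =>
      ¬ ∀ t, A ≤ (univ.filter fun j => LineActive a₀ (t, j)).card).card : ℝ) ≤
      (N + 1) * A * ((1 - 1 / 2 ^ K) ^ Y * Fintype.card (RefVar N g K → Bool)) := by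
  let U : Fin (N + 1) → Fin A → Fin Y → Finset (RefVar N g K) := fun t α y =>
    univ.image fun c => .inr ((t, ι (α, y)), .inl c)
  have hsub : (univ.filter fun a₀ : RefVar N g K → Bool =>
      ¬ ∀ t, A ≤ (univ.filter fun j => LineActive a₀ (t, j)).card) ⊆
      (univ : Finset (Fin (N + 1) × Fin A)).biUnion fun p => univ.filter fun a₀ =>
        ∀ y ∈ (univ : Finset (Fin Y)), ∃ z ∈ U p.1 p.2 y, a₀ z ≠ true := by
    intro a₀ ha
    simp only [Finset.mem_filter, Finset.mem_univ, true_and, Finset.mem_biUnion,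
      true_implies] at ha ⊢
    by_contra hcon
    push Not at hcon
    refine ha fun t => ?_
    have hex : ∀ α : Fin A, ∃ y : Fin Y, LineActive a₀ (t, ι (α, y)) := by
      intro α
      obtain ⟨y, hy⟩ := hcon (t, α)
      refine ⟨y, fun c => hy _ (Finset.mem_image_of_mem _ (Finset.mem_univ c))⟩
    choose y hy using hex
    calc A = (univ.image fun α => ι (α, y α)).card := by
          rw [Finset.card_image_of_injective _ fun α α' h => (Prod.mk.inj (ι.injective h)).1]
          simp
      _ ≤ _ := Finset.card_le_card fun j hj => by
          obtain ⟨α, -, rfl⟩ := Finset.mem_image.1 hj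
          simpa using hy α
  have hone : ∀ p : Fin (N + 1) × Fin A, ((univ.filter fun a₀ : RefVar N g K → Bool =>
      ∀ y ∈ (univ : Finset (Fin Y)), ∃ z ∈ U p.1 p.2 y, a₀ z ≠ true).card : ℝ) ≤
      (1 - 1 / 2 ^ K) ^ Y * Fintype.card (RefVar N g K → Bool) := by
    intro p
    have := card_avoid_subcubes_le K (univ : Finset (Fin Y)) (U p.1 p.2) (fun _ _ => true) ?_ ?_
    · simpa using this
    · intro y _ y' _ hne
      refine Finset.disjoint_left.2 fun z hz hz' => hne ?_
      obtain ⟨c, -, rfl⟩ := Finset.mem_image.1 hz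
      obtain ⟨c', -, h⟩ := Finset.mem_image.1 hz'
      have h1 := (Prod.mk.inj (Sum.inr.inj h)).1
      exact (Prod.mk.inj (ι.injective (Prod.mk.inj h1).2)).2.symm
    · intro y _
      exact Finset.card_image_le.trans (by simp)
  calc ((univ.filter fun a₀ : RefVar N g K → Bool =>
      ¬ ∀ t, A ≤ (univ.filter fun j => LineActive a₀ (t, j)).card).card : ℝ)
      ≤ ∑ p : Fin (N + 1) × Fin A, ((univ.filter fun a₀ : RefVar N g K → Bool =>
      ∀ y ∈ (univ : Finset (Fin Y)), ∃ z ∈ U p.1 p.2 y, a₀ z ≠ true).card : ℝ) := by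
        exact_mod_cast (Finset.card_le_card hsub).trans Finset.card_biUnion_le
    _ ≤ ∑ p : Fin (N + 1) × Fin A, (1 - 1 / 2 ^ K) ^ Y * (Fintype.card (RefVar N g K → Bool) : ℝ) :=
        Finset.sum_le_sum fun p _ => hone p
    _ = _ := by simp

theorem card_block_le (b : Option (LineId N g)) :
    (univ.filter fun z : RefVar N g K => block z = b).card ≤ K + N + 2 * g := by
  rcases b with _ | q
  · calc (univ.filter fun z : RefVar N g K => block z = none).card
        ≤ (univ.image fun b : Fin g => (.inl b : RefVar N g K)).card := by
          refine Finset.card_le_card fun z hz => ?_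
          rcases z with b | y
          · simp
          · exact absurd (Finset.mem_filter.1 hz).2 (by simp [block])
      _ ≤ g := Finset.card_image_le.trans (by simp)
      _ ≤ _ := by omega
  · calc (univ.filter fun z : RefVar N g K => block z = some q).card
        ≤ (univ.image fun w : Fin K ⊕ LineData N g => (.inr (q, w) : RefVar N g K)).card := by
          refine Finset.card_le_card fun z hz => ?_
          rcases z with b | ⟨q', w⟩
          · exact absurd (Finset.mem_filter.1 hz).2 (by simp [block])
          · obtain rfl : q' = q := Option.some.inj (Finset.mem_filter.1 hz).2
            simp
      _ ≤ Fintype.card (Fin K ⊕ LineData N g) := Finset.card_image_le.trans (by simp)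
      _ = _ := by simp; ring

/-- Some restriction leaves many active lines and makes all DNFs of a small family decidable. -/
theorem exists_good {k X T n A Y H cap : ℕ} (hK : k < K)
    (hCl : ∀ D : Fin N → Bool, ∃ e, ∀ l ∈ Cl e, D l.var ≠ l.pos)
    (hX : (2 : ℝ) ^ (k * (K + N + 2 * g)) * (1 - 1 / 2 ^ (2 * k)) ^ X ≤ 1 - 1 / 2 ^ (2 * k))
    (hH : 1 + depth k X k T = H) (hA : 3 * cap + 2 ≤ A) (ι : Fin A × Fin Y ↪ Addr g)
    (hnum : (2 : ℝ) ^ n * (2 ^ (K + N + 2 * g) * (1 - 1 / 2 ^ (2 * k)) ^ T) +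
      (N + 1) * A * (1 - 1 / 2 ^ K) ^ Y < 1)
    (𝒢 : Finset (Dnf (RefVar N g K))) (h𝒢 : 𝒢.card ≤ 2 ^ n)
    (hk : ∀ G ∈ 𝒢, ∀ q ∈ G, q.card ≤ k) :
    ∃ a₀ : RefVar N g K → Bool,
      (∀ t, A ≤ (univ.filter fun j => LineActive a₀ (t, j)).card) ∧
      ∀ G ∈ 𝒢, Good (Valid Cl a₀) cap a₀ G H := by
  by_contra hcon
  push Not at hcon
  have hcov : (univ : Finset (RefVar N g K → Bool)) ⊆ (univ.filter fun a₀ =>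
      ¬ ∀ t, A ≤ (univ.filter fun j => LineActive a₀ (t, j)).card) ∪
      𝒢.biUnion fun G => univ.filter fun a₀ => Extendable (Valid Cl a₀) cap ∧
        ¬ Good (Valid Cl a₀) cap a₀ G H := by
    intro a₀ _
    by_cases h : ∀ t, A ≤ (univ.filter fun j => LineActive a₀ (t, j)).card
    · obtain ⟨G, hG, hng⟩ := hcon a₀ h
      refine Finset.mem_union_right _ (Finset.mem_biUnion.2 ⟨G, hG, ?_⟩)
      exact Finset.mem_filter.2 ⟨Finset.mem_univ _, extendable_valid hCl hA h, hng⟩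
    · exact Finset.mem_union_left _ (Finset.mem_filter.2 ⟨Finset.mem_univ _, h⟩)
  have h1 := (Finset.card_le_card hcov).trans (Finset.card_union_le _ _)
  rw [Finset.card_univ] at h1
  have hθ : (0 : ℝ) ≤ 1 - 1 / 2 ^ (2 * k) := by
    rw [sub_nonneg, div_le_one (by positivity)]; exact one_le_pow₀ (by norm_num)
  have h2 := card_few_active_le (N := N) (K := K) ι
  have h3 : ∀ G ∈ 𝒢, ((univ.filter fun a₀ => Extendable (Valid Cl a₀) cap ∧
        ¬ Good (Valid Cl a₀) cap a₀ G H).card : ℝ) ≤ 2 ^ (K + N + 2 * g) *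
        ((1 - 1 / 2 ^ (2 * k)) ^ T * Fintype.card (RefVar N g K → Bool)) := by
    intro G hG
    have := card_not_good_le' (Valid Cl) (cap := cap) hK card_block_le hX T G (hk G hG)
    rw [hH] at this
    convert this
  have htp : 0 < (Fintype.card (RefVar N g K → Bool) : ℝ) := by exact_mod_cast Fintype.card_pos
  generalize (Fintype.card (RefVar N g K → Bool)) = total at *
  have h4 : ((𝒢.biUnion fun G => univ.filter fun a₀ => Extendable (Valid Cl a₀) cap ∧
        ¬ Good (Valid Cl a₀) cap a₀ G H).card : ℝ) ≤
      2 ^ n * (2 ^ (K + N + 2 * g) * ((1 - 1 / 2 ^ (2 * k)) ^ T * total)) := by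
    refine le_trans (Nat.cast_le.2 Finset.card_biUnion_le) ?_
    rw [Nat.cast_sum]
    refine (Finset.sum_le_card_nsmul _ _ _ h3).trans ?_
    rw [nsmul_eq_mul]
    refine mul_le_mul_of_nonneg_right ?_ (by positivity)
    exact_mod_cast h𝒢
  have h6 := Nat.cast_le (α := ℝ) |>.2 h1
  rw [Nat.cast_add] at h6
  have h5 := mul_lt_mul_of_pos_right hnum htp
  rw [one_mul] at h5
  refine absurd (h6.trans (add_le_add h2 h4)) (not_le.2 (lt_of_eq_of_lt ?_ h5))
  ring

/-- Refutations of the formula are exponentially long. -/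
theorem refutation_lower_bound {k X T n A Y : ℕ} (hK : k < K) (hx : Function.Injective x)
    (hCl : ∀ D : Fin N → Bool, ∃ e, ∀ l ∈ Cl e, D l.var ≠ l.pos)
    (hX : (2 : ℝ) ^ (k * (K + N + 2 * g)) * (1 - 1 / 2 ^ (2 * k)) ^ X ≤ 1 - 1 / 2 ^ (2 * k))
    (hA : 3 * (3 * (1 + depth k X k T) + 1) + 2 ≤ A) (hAY : A * Y ≤ 2 ^ g)
    (hnum : (2 : ℝ) ^ n * (2 ^ (K + N + 2 * g) * (1 - 1 / 2 ^ (2 * k)) ^ T) +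
      (N + 1) * A * (1 - 1 / 2 ^ K) ^ Y < 1)
    {F : Set (Clause V)} (hF : ∀ C ∈ F, IsRefClause x Cl C) {P : List (Dnf V)}
    (hP : IsResKRefutation k F P) : 2 ^ n ≤ proofSize P + 1 := by
  by_contra hlt
  push Not at hlt
  have hlines : P.toFinset.card ≤ 2 ^ n := (card_lines_le_proofSize P).trans hlt.le
  set H := 1 + depth k X k T with hH
  set cap := 3 * H + 1 with hcap
  have hι : Nonempty (Fin A × Fin Y ↪ Addr g) := by
    rw [Function.Embedding.nonempty_iff_card_le]
    simpa using hAY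
  obtain ⟨ι⟩ := hι
  have hgood := exists_good (Cl := Cl) (cap := cap) hK hCl hX hH.symm hA ι hnum
    (P.toFinset.image (pullDnf hx)) (Finset.card_image_le.trans hlines) ?_
  swap
  · intro G hG
    obtain ⟨G', hG', rfl⟩ := Finset.mem_image.1 hG
    exact card_le_of_mem_pullDnf hx (hP.2.2.1 G' (List.mem_toFinset.1 hG'))
  obtain ⟨a₀, hact, hG⟩ := hgood
  have hext : Extendable (Valid Cl a₀) cap := extendable_valid hCl hA hact
  let lift : (RefVar N g K → Bool) → V → Bool := fun a => Function.extend x a fun _ => false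
  have hlift : ∀ a z, lift a (x z) = a z := fun a z => hx.extend_apply _ _ _
  let Bad : Dnf V → Prop := fun G => ∃ Q a, Valid Cl a₀ Q a ∧ Q.card ≤ H ∧
    ∀ a', Follows a₀ a' → AgreeOn Q a a' → ¬ DnfTrue (lift a') G
  have hdec : ∀ prems : List (Dnf V), (∀ Q ∈ prems, Q ∈ P ∧ ¬ Bad Q) → ∀ Q a, Valid Cl a₀ Q a →
      Q.card + prems.length * H ≤ cap → ∃ Q' a', AgreeOn Q a a' ∧ Valid Cl a₀ (Q ∪ Q') a' ∧
        ∀ G ∈ prems, ∀ a'', Follows a₀ a'' → AgreeOn Q' a' a'' → DnfTrue (lift a'') G := by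
    intro prems
    induction prems with
    | nil => exact fun _ Q a hv _ => ⟨∅, a, fun _ _ => rfl, by simpa using hv, by simp⟩
    | cons G prems ih =>
      intro hp Q a hv hc
      rw [List.length_cons, Nat.add_mul] at hc
      obtain ⟨Q1, a1, h1, h2, h3, h4⟩ := hG _ (Finset.mem_image_of_mem _
        (List.mem_toFinset.2 (hp G (by simp)).1)) Q a hv (by omega)
      have h5 : ∀ a'', Follows a₀ a'' → AgreeOn Q1 a1 a'' → DnfTrue (lift a'') G := by
        rcases h4 with h4 | h4
        · exact fun a'' hf ha => (dnfTrue_pullDnf hx G a'').1 (h4 a'' hf ha)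
        · refine absurd ⟨Q1, a1, ⟨h3.1, fun b hb => h3.2 b (Finset.mem_union_right _ hb)⟩, h1,
            fun a' hf ha ht => h4 a' hf ha ((dnfTrue_pullDnf hx G a').2 ht)⟩ (hp G (by simp)).2
      obtain ⟨Q2, a2, h6, h7, h8⟩ := ih (fun Q hQ => hp Q (by simp [hQ])) _ a1 h3 (by
        have := Finset.card_union_le Q Q1
        omega)
      refine ⟨Q1 ∪ Q2, a2, h2.trans (h6.mono Finset.subset_union_left),
        by rwa [← Finset.union_assoc], ?_⟩
      rintro G' hG' a'' hf ha
      rcases List.mem_cons.1 hG' with rfl | hG'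
      · exact h5 a'' hf ((h6.mono Finset.subset_union_right).trans
          (ha.mono Finset.subset_union_left))
      · exact h8 G' hG' a'' hf (ha.mono Finset.subset_union_right)
  refine hP.not_bad_empty (Bad := Bad) ?_ ?_ ⟨∅, a₀, ⟨fun _ _ _ => rfl, by simp⟩, by simp,
    fun a' _ _ => by simp [DnfTrue]⟩
  · rintro C hC - ⟨Q, a, hv, hc, hdead⟩
    obtain ⟨b, hb⟩ := (hF C hC).exists_block
    obtain ⟨a', h1, h2⟩ := hext Q a b hv (by omega)
    exact hdead a' h2.1 h1 (dnfTrue_clauseToDnf.2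
      (hb (lift a') a' (hlift a') (h2.2 b (Finset.mem_insert_self _ _))))
  · rintro prems G hinf hGP hprems ⟨Q, a, hv, hc, hdead⟩
    by_contra hnb
    push Not at hnb
    have hlen : prems.length ≤ 2 := by cases hinf <;> simp
    obtain ⟨Q', a', h1, h2, h3⟩ := hdec prems (fun Q hQ => ⟨hprems Q hQ, hnb Q hQ⟩) Q a hv (by
      have := Nat.mul_le_mul_right H hlen
      omega)
    exact hdead a' h2.1 h1 (hinf.sound _ fun G hG => h3 G hG a' h2.1 fun _ _ => rfl)

end RefTree

/-- A 2-DNF over the variables in `Ω`. -/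
def IsTwoDnfOn (Ω : Finset V) (G : Dnf V) : Prop :=
  ∀ q ∈ G, q.card ≤ 2 ∧ ∀ l ∈ q, l.var ∈ Ω

theorem IsTwoDnfOn.union {Ω : Finset V} {G G' : Dnf V} (h : IsTwoDnfOn Ω G)
    (h' : IsTwoDnfOn Ω G') : IsTwoDnfOn Ω (G ∪ G') := by
  intro q hq
  rcases Finset.mem_union.1 hq with hq | hq
  · exact h q hq
  · exact h' q hq

theorem IsTwoDnfOn.mono {Ω : Finset V} {G G' : Dnf V} (h : IsTwoDnfOn Ω G)
    (h' : G' ⊆ G) : IsTwoDnfOn Ω G' := fun q hq => h q (h' hq)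

theorem isTwoDnfOn_singleton {Ω : Finset V} {l : Lit V} (h : l.var ∈ Ω) :
    IsTwoDnfOn Ω {{l}} := by
  simp [IsTwoDnfOn, h]

theorem isTwoDnfOn_clauseToDnf {Ω : Finset V} {C : Clause V} (h : ∀ l ∈ C, l.var ∈ Ω) :
    IsTwoDnfOn Ω (clauseToDnf C) := by
  simpa [IsTwoDnfOn, clauseToDnf] using h

/-- Tree-like Res(2) derivations with `n` inferences from clauses of `F` and lines in `S`, over
the variables in `Ω`. -/
inductive TreeDeriv (F : Set (Clause V)) (Ω : Finset V) (S : Set (Dnf V)) : ℕ → Dnf V → Prop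
  | hyp {G : Dnf V} (hG : G ∈ S) (hΩ : IsTwoDnfOn Ω G) : TreeDeriv F Ω S 0 G
  | clause {C : Clause V} (hC : C ∈ F) (hΩ : ∀ l ∈ C, l.var ∈ Ω) :
      TreeDeriv F Ω S 1 (clauseToDnf C)
  | ax (x : V) (hx : x ∈ Ω) :
      TreeDeriv F Ω S 1 {{(⟨x, true⟩ : Lit V)}, {(⟨x, false⟩ : Lit V)}}
  | weaken {n : ℕ} {A B : Dnf V} (hA : TreeDeriv F Ω S n A) (hB : IsTwoDnfOn Ω B) :
      TreeDeriv F Ω S (n + 1) (A ∪ B)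
  | andIntro {n m : ℕ} {A B : Dnf V} {l l' : Lit V} (hA : TreeDeriv F Ω S n (A ∪ {{l}}))
      (hB : TreeDeriv F Ω S m (B ∪ {{l'}})) : TreeDeriv F Ω S (n + m + 1) (A ∪ B ∪ {{l, l'}})
  | cut {n m : ℕ} {A B : Dnf V} {q : PTerm V} (hA : TreeDeriv F Ω S n (A ∪ {q}))
      (hB : TreeDeriv F Ω S m (B ∪ q.image fun l => ({l.neg} : PTerm V))) :
      TreeDeriv F Ω S (n + m + 1) (A ∪ B)
  | mono {n m : ℕ} {A : Dnf V} (h : TreeDeriv F Ω S n A) (hnm : n ≤ m) : TreeDeriv F Ω S m A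

namespace TreeDeriv

variable {F : Set (Clause V)} {Ω : Finset V} {S : Set (Dnf V)}

theorem isTwoDnfOn {n : ℕ} {G : Dnf V} (h : TreeDeriv F Ω S n G) : IsTwoDnfOn Ω G := by
  induction h with
  | hyp _ h => exact h
  | clause _ h => exact isTwoDnfOn_clauseToDnf h
  | ax x hx => simp [IsTwoDnfOn, hx]
  | weaken _ hB ih => exact ih.union hB
  | @andIntro n m A B l l' _ _ ih1 ih2 =>
    refine ((ih1.mono Finset.subset_union_left).union
      (ih2.mono Finset.subset_union_left)).union ?_
    have h1 := (ih1 {l} (by simp)).2 l (by simp)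
    have h2 := (ih2 {l'} (by simp)).2 l' (by simp)
    intro q hq
    rw [Finset.mem_singleton] at hq
    subst hq
    exact ⟨Finset.card_le_two, by simp [h1, h2]⟩
  | cut _ _ ih1 ih2 =>
    exact (ih1.mono Finset.subset_union_left).union (ih2.mono Finset.subset_union_left)
  | mono _ _ ih => exact ih

theorem weaken_to {n : ℕ} {G D : Dnf V} (h : TreeDeriv F Ω S n G) (hD : IsTwoDnfOn Ω D)
    (hGD : G ⊆ D) : TreeDeriv F Ω S (n + 1) D := by
  have := h.weaken hD
  rwa [Finset.union_eq_right.2 hGD] at this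

/-- From `D ∨ q` and `D ∨ ¬q` derive `D`. -/
theorem cut_to {n m : ℕ} {G G' D : Dnf V} {q : PTerm V} (h : TreeDeriv F Ω S n G)
    (h' : TreeDeriv F Ω S m G') (hD : IsTwoDnfOn Ω D) (hG : G ⊆ D ∪ {q})
    (hG' : G' ⊆ D ∪ q.image fun l => ({l.neg} : PTerm V)) :
    TreeDeriv F Ω S (n + m + 3) D := by
  by_cases hq : q ∈ G
  · have hqΩ := h.isTwoDnfOn q hq
    have h1 := h.weaken_to (D := D ∪ {q}) (hD.union (by
      intro q' hq'
      rw [Finset.mem_singleton] at hq'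
      exact hq' ▸ hqΩ)) hG
    have h2 := h'.weaken_to (D := D ∪ q.image fun l => ({l.neg} : PTerm V)) (hD.union (by
      intro q' hq'
      obtain ⟨l, hl, rfl⟩ := Finset.mem_image.1 hq'
      refine ⟨by simp, fun l' hl' => ?_⟩
      rw [Finset.mem_singleton] at hl'
      subst hl'
      exact hqΩ.2 l hl)) hG'
    have h3 := h1.cut h2
    rw [Finset.union_self] at h3
    exact h3.mono (by omega)
  · refine (h.weaken_to hD fun q' hq' => ?_).mono (by omega)
    rcases Finset.mem_union.1 (hG hq') with h1 | h1
    · exact h1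
    · rw [Finset.mem_singleton] at h1
      exact absurd (h1 ▸ hq') hq

/-- From `D ∨ l` and `D ∨ ¬l` derive `D`. -/
theorem resolve {n m : ℕ} {G G' D : Dnf V} (l : Lit V) (h : TreeDeriv F Ω S n G)
    (h' : TreeDeriv F Ω S m G') (hD : IsTwoDnfOn Ω D) (hG : G ⊆ D ∪ {{l}})
    (hG' : G' ⊆ D ∪ {{l.neg}}) : TreeDeriv F Ω S (n + m + 3) D :=
  h.cut_to (q := {l}) h' hD hG (by simpa using hG')

/-- From `D ∨ l` and `D ∨ l'` derive `D ∨ l ∧ l'`. -/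
theorem and_to {n m : ℕ} {G G' D : Dnf V} {l l' : Lit V} (h : TreeDeriv F Ω S n G)
    (h' : TreeDeriv F Ω S m G') (hD : IsTwoDnfOn Ω D) (hG : G ⊆ D ∪ {{l}})
    (hG' : G' ⊆ D ∪ {{l'}}) (hl : {l, l'} ∈ D) : TreeDeriv F Ω S (n + m + 3) D := by
  have hΩ := (hD _ hl).2
  have h1 := h.weaken_to (hD.union (isTwoDnfOn_singleton (hΩ l (by simp)))) hG
  have h2 := h'.weaken_to (hD.union (isTwoDnfOn_singleton (hΩ l' (by simp)))) hG'
  have h3 := h1.andIntro h2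
  rw [Finset.union_self, Finset.union_eq_left.2 (by simpa using hl)] at h3
  exact h3.mono (by omega)

/-- Terms which can be removed one at a time can be removed together. -/
theorem eliminate {ι : Type} [DecidableEq ι] {m : ℕ} {D : Dnf V} (s : Finset ι)
    (q : ι → PTerm V) (hs : ∀ i ∈ s, ∀ (D' : Dnf V), D ⊆ D' → IsTwoDnfOn Ω D' → ∀ n,
      TreeDeriv F Ω S n (D' ∪ {q i}) → TreeDeriv F Ω S (n + m) D') :
    ∀ (D' : Dnf V), D ⊆ D' → IsTwoDnfOn Ω D' → ∀ n, TreeDeriv F Ω S n (D' ∪ s.image q) →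
      TreeDeriv F Ω S (n + s.card * m) D' := by
  induction s using Finset.induction_on with
  | empty =>
    intro D' _ _ n h
    simpa using h
  | insert i s hi ih =>
    intro D' hDD' hD' n h
    have hqi : IsTwoDnfOn Ω {q i} := h.isTwoDnfOn.mono (by simp)
    have h1 := ih (fun j hj => hs j (by simp [hj])) (D' ∪ {q i})
      (hDD'.trans Finset.subset_union_left) (hD'.union hqi) n (by
        rw [Finset.image_insert, Finset.insert_eq, ← Finset.union_assoc] at h
        exact h)
    have h2 := hs i (by simp) D' hDD' hD' _ h1
    rw [Finset.card_insert_of_notMem hi]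
    exact h2.mono (by rw [Nat.add_mul]; omega)

/-- If all lines `D ∨ (address ≠ j)` are derivable, then so is `D`. -/
theorem eliminate_address {g n : ℕ} {D : Dnf V} (p : Fin g → V) (hD : IsTwoDnfOn Ω D)
    (h : ∀ j : Fin g → Bool,
      TreeDeriv F Ω S n (D ∪ clauseToDnf (univ.image fun b => ⟨p b, !(j b)⟩))) :
    TreeDeriv F Ω S (2 ^ g * (n + 3)) D := by
  have hΩ : ∀ b, p b ∈ Ω := by
    intro b
    have := (h fun _ => true).isTwoDnfOn {⟨p b, false⟩} (by simp [clauseToDnf])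
    exact this.2 ⟨p b, false⟩ (by simp)
  have key : ∀ s : Finset (Fin g), ∃ m, m + 3 ≤ 2 ^ s.card * (n + 3) ∧ ∀ j : Fin g → Bool,
      TreeDeriv F Ω S m (D ∪ clauseToDnf ((univ \ s).image fun b => ⟨p b, !(j b)⟩)) := by
    intro s
    induction s using Finset.induction_on with
    | empty => exact ⟨n, by simp, by simpa using h⟩
    | insert b s hb ih =>
      obtain ⟨m, hm, hd⟩ := ih
      refine ⟨m + m + 3, ?_, fun j => ?_⟩
      · rw [Finset.card_insert_of_notMem hb, pow_succ, mul_right_comm]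
        omega
      · have hsub : ∀ v, D ∪ clauseToDnf ((univ \ s).image fun b' =>
            ⟨p b', !(Function.update j b v b')⟩) ⊆
            D ∪ clauseToDnf ((univ \ insert b s).image fun b => ⟨p b, !(j b)⟩) ∪
              {{⟨p b, !v⟩}} := by
          intro v q hq
          rcases Finset.mem_union.1 hq with hq | hq
          · simp [hq]
          · simp only [clauseToDnf, Finset.image_image, Finset.mem_image, Finset.mem_sdiff,
              Finset.mem_univ, true_and, Function.comp] at hq
            obtain ⟨b', hb', rfl⟩ := hq
            by_cases hbb : b' = b
            · subst hbb
              simp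
            · refine Finset.mem_union_left _ (Finset.mem_union_right _ ?_)
              simp only [clauseToDnf, Finset.image_image, Finset.mem_image, Finset.mem_sdiff,
                Finset.mem_univ, true_and, Function.comp]
              exact ⟨b', by simp [hbb, hb'], by rw [Function.update_of_ne hbb]⟩
        refine resolve ⟨p b, false⟩ (hd (Function.update j b true))
          (hd (Function.update j b false)) (hD.union (isTwoDnfOn_clauseToDnf ?_)) (hsub true)
          (hsub false)
        intro l hl
        obtain ⟨b', -, rfl⟩ := Finset.mem_image.1 hl
        exact hΩ b'
  obtain ⟨m, hm, hd⟩ := key univ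
  rw [Finset.card_univ, Fintype.card_fin] at hm
  have := hd fun _ => true
  simp only [sdiff_self, Finset.bot_eq_empty, Finset.image_empty, clauseToDnf,
    Finset.union_empty] at this
  exact this.mono (by omega)

end TreeDeriv

/-- Res(2) derivations as sequences of lines. -/
inductive Deriv (F : Set (Clause V)) : List (Dnf V) → Prop
  | nil : Deriv F []
  | clause {P : List (Dnf V)} (h : Deriv F P) {C : Clause V} (hC : C ∈ F) :
      Deriv F (P ++ [clauseToDnf C])
  | inf {P : List (Dnf V)} (h : Deriv F P) {prems : List (Dnf V)} {G : Dnf V}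
      (hG : ResKInf 2 prems G) (hp : ∀ Q ∈ prems, Q ∈ P) : Deriv F (P ++ [G])

/-- Some sequence of at most `L` lines, each with at most `m` variables, contains all of `S`. -/
def Reachable (F : Set (Clause V)) (m L : ℕ) (S : Set (Dnf V)) : Prop :=
  ∃ P : List (Dnf V), Deriv F P ∧ P.length ≤ L ∧ (∀ G ∈ S, G ∈ P) ∧
    ∀ G ∈ P, ∃ Ω : Finset V, Ω.card ≤ m ∧ IsTwoDnfOn Ω G

theorem TreeDeriv.append {F : Set (Clause V)} {Ω : Finset V} {S : Set (Dnf V)} {n : ℕ}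
    {G : Dnf V} (h : TreeDeriv F Ω S n G) {P : List (Dnf V)} (hP : Deriv F P)
    (hS : ∀ G ∈ S, G ∈ P) : ∃ P', Deriv F (P ++ P') ∧ P'.length ≤ n ∧ G ∈ P ++ P' ∧
      ∀ G ∈ P', IsTwoDnfOn Ω G := by
  induction h generalizing P with
  | hyp hG _ => exact ⟨[], by simpa using hP, by simp, by simpa using hS _ hG, by simp⟩
  | clause hC hΩ => exact ⟨_, hP.clause hC, by simp, by simp, by
      simpa using isTwoDnfOn_clauseToDnf hΩ⟩
  | ax x hx => exact ⟨_, hP.inf (.ax x) (by simp), by simp, by simp, by simp [IsTwoDnfOn, hx]⟩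
  | @weaken n A B hA hB ih =>
    obtain ⟨P', h1, h2, h3, h4⟩ := ih hP hS
    refine ⟨P' ++ [A ∪ B], ?_, by simp [h2], by simp, ?_⟩
    · rw [← List.append_assoc]
      exact h1.inf (.weaken A B) (by simpa using h3)
    · intro G hG
      rcases List.mem_append.1 hG with hG | hG
      · exact h4 G hG
      · rw [List.mem_singleton.1 hG]
        exact hA.isTwoDnfOn.union hB
  | @andIntro n m A B l l' hA hB ih1 ih2 =>
    obtain ⟨P', h1, h2, h3, h4⟩ := ih1 hP hS
    obtain ⟨P'', g1, g2, g3, g4⟩ := ih2 h1 fun G hG => List.mem_append_left _ (hS G hG)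
    refine ⟨P' ++ P'' ++ [A ∪ B ∪ {{l, l'}}], ?_, by simp; omega, by simp, ?_⟩
    · rw [← List.append_assoc, ← List.append_assoc]
      refine g1.inf (.andIntro A B l {l'} (by simp)) ?_
      intro Q hQ
      simp only [List.mem_cons, List.not_mem_nil, or_false] at hQ
      rcases hQ with rfl | rfl
      · exact List.mem_append_left _ h3
      · exact g3
    · intro G hG
      rcases List.mem_append.1 hG with hG | hG
      · rcases List.mem_append.1 hG with hG | hG
        · exact h4 G hG
        · exact g4 G hG
      · rw [List.mem_singleton.1 hG]
        exact (hA.andIntro hB).isTwoDnfOn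
  | @cut n m A B q hA hB ih1 ih2 =>
    obtain ⟨P', h1, h2, h3, h4⟩ := ih1 hP hS
    obtain ⟨P'', g1, g2, g3, g4⟩ := ih2 h1 fun G hG => List.mem_append_left _ (hS G hG)
    refine ⟨P' ++ P'' ++ [A ∪ B], ?_, by simp; omega, by simp, ?_⟩
    · rw [← List.append_assoc, ← List.append_assoc]
      refine g1.inf (.cut A B q) ?_
      intro Q hQ
      simp only [List.mem_cons, List.not_mem_nil, or_false] at hQ
      rcases hQ with rfl | rfl
      · exact List.mem_append_left _ h3
      · exact g3
    · intro G hG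
      rcases List.mem_append.1 hG with hG | hG
      · rcases List.mem_append.1 hG with hG | hG
        · exact h4 G hG
        · exact g4 G hG
      · rw [List.mem_singleton.1 hG]
        exact (hA.cut hB).isTwoDnfOn
  | mono _ hnm ih =>
    obtain ⟨P', h1, h2, h3, h4⟩ := ih hP hS
    exact ⟨P', h1, h2.trans hnm, h3, h4⟩

namespace Reachable

variable {F : Set (Clause V)} {m L : ℕ} {S : Set (Dnf V)}

theorem empty : Reachable F m 0 ∅ := ⟨[], .nil, by simp, by simp, by simp⟩

/-- Add a family of lines which have short tree-like derivations from available lines. -/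
theorem add (h : Reachable F m L S) {ι : Type} [DecidableEq ι] (n : ℕ) (s : Finset ι)
    (G : ι → Dnf V) (hs : ∀ i ∈ s, ∃ Ω : Finset V, Ω.card ≤ m ∧ TreeDeriv F Ω S n (G i)) :
    Reachable F m (L + s.card * n) (S ∪ G '' s) := by
  induction s using Finset.induction_on with
  | empty => simpa using h
  | insert i s hi ih =>
    obtain ⟨P, h1, h2, h3, h4⟩ := ih fun j hj => hs j (by simp [hj])
    obtain ⟨Ω, hΩ, ht⟩ := hs i (by simp)
    obtain ⟨P', g1, g2, g3, g4⟩ := ht.append h1 fun G hG => h3 G (Or.inl hG)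
    refine ⟨P ++ P', g1, ?_, ?_, ?_⟩
    · rw [List.length_append, Finset.card_insert_of_notMem hi, Nat.add_mul]
      omega
    · rintro H (hH | ⟨j, hj, rfl⟩)
      · exact List.mem_append_left _ (h3 H (Or.inl hH))
      · rcases Finset.mem_insert.1 (Finset.mem_coe.1 hj) with rfl | hj
        · exact g3
        · exact List.mem_append_left _ (h3 _ (Or.inr ⟨j, hj, rfl⟩))
    · intro H hH
      rcases List.mem_append.1 hH with hH | hH
      · exact h4 H hH
      · exact ⟨Ω, hΩ, g4 H hH⟩

theorem mono {L' : ℕ} {S' : Set (Dnf V)} (h : Reachable F m L S) (hL : L ≤ L') (hS : S' ⊆ S) :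
    Reachable F m L' S' := by
  obtain ⟨P, h1, h2, h3, h4⟩ := h
  exact ⟨P, h1, h2.trans hL, fun G hG => h3 G (hS hG), h4⟩

end Reachable

theorem Deriv.getElem {F : Set (Clause V)} {P : List (Dnf V)} (h : Deriv F P) :
    ∀ i : Fin P.length, (∃ C ∈ F, P.get i = clauseToDnf C) ∨
      ∃ prems : List (Dnf V), ResKInf 2 prems (P.get i) ∧
        ∀ Q ∈ prems, ∃ j : Fin P.length, (j : ℕ) < (i : ℕ) ∧ P.get j = Q := by
  have step : ∀ (P : List (Dnf V)) (G : Dnf V), (∀ i : Fin P.length,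
      (∃ C ∈ F, P.get i = clauseToDnf C) ∨ ∃ prems : List (Dnf V), ResKInf 2 prems (P.get i) ∧
        ∀ Q ∈ prems, ∃ j : Fin P.length, (j : ℕ) < (i : ℕ) ∧ P.get j = Q) →
      ((∃ C ∈ F, G = clauseToDnf C) ∨ ∃ prems : List (Dnf V), ResKInf 2 prems G ∧
        ∀ Q ∈ prems, Q ∈ P) → ∀ i : Fin (P ++ [G]).length,
      (∃ C ∈ F, (P ++ [G]).get i = clauseToDnf C) ∨ ∃ prems : List (Dnf V),
        ResKInf 2 prems ((P ++ [G]).get i) ∧ ∀ Q ∈ prems, ∃ j : Fin (P ++ [G]).length,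
          (j : ℕ) < (i : ℕ) ∧ (P ++ [G]).get j = Q := by
    rintro P G hP hG ⟨i, hi⟩
    by_cases hlt : i < P.length
    · have e : (P ++ [G]).get ⟨i, hi⟩ = P.get ⟨i, hlt⟩ := by simp [hlt]
      rw [e]
      refine (hP ⟨i, hlt⟩).imp_right ?_
      rintro ⟨prems, h1, h2⟩
      refine ⟨prems, h1, fun Q hQ => ?_⟩
      obtain ⟨⟨j, hj⟩, h3, h4⟩ := h2 Q hQ
      refine ⟨⟨j, by simp; omega⟩, h3, ?_⟩
      rw [← h4]
      simp [hj]
    · have hlast : i = P.length := by simp at hi; omega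
      subst hlast
      have e : (P ++ [G]).get ⟨P.length, hi⟩ = G := by simp
      rw [e]
      refine hG.imp_right ?_
      rintro ⟨prems, h1, h2⟩
      refine ⟨prems, h1, fun Q hQ => ?_⟩
      obtain ⟨j, hj, rfl⟩ := List.mem_iff_getElem.1 (h2 Q hQ)
      exact ⟨⟨j, by simp; omega⟩, hj, by simp [hj]⟩
  induction h with
  | nil => exact fun i => i.elim0
  | @clause P _ C hC ih => exact step P _ ih (Or.inl ⟨C, hC, rfl⟩)
  | @inf P _ prems G hG hp ih => exact step P _ ih (Or.inr ⟨prems, hG, hp⟩)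

theorem IsTwoDnfOn.dnfSize_le {Ω : Finset V} {G : Dnf V} (h : IsTwoDnfOn Ω G) :
    dnfSize G ≤ 3 * (2 * Ω.card + 1) ^ 2 := by
  set Λ : Finset (Lit V) := (Ω ×ˢ (univ : Finset Bool)).image fun p => ⟨p.1, p.2⟩ with hΛ
  have hΛc : Λ.card ≤ 2 * Ω.card := by
    refine Finset.card_image_le.trans ?_
    rw [Finset.card_product, Finset.card_univ, Fintype.card_bool, mul_comm]
  have hsub : G ⊆ (Finset.range 3).biUnion fun i => Λ.powersetCard i := by
    intro q hq
    obtain ⟨h1, h2⟩ := h q hq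
    rw [Finset.mem_biUnion]
    refine ⟨q.card, Finset.mem_range.2 (by omega), Finset.mem_powersetCard.2 ⟨fun l hl => ?_, rfl⟩⟩
    exact Finset.mem_image.2 ⟨(l.var, l.pos), by simp [h2 l hl], rfl⟩
  have hcard : G.card ≤ (2 * Ω.card + 1) ^ 2 := by
    refine (Finset.card_le_card hsub).trans (Finset.card_biUnion_le.trans ?_)
    simp only [Finset.card_powersetCard, Finset.sum_range_succ, Finset.sum_range_zero,
      Nat.choose_zero_right, Nat.choose_one_right, zero_add]
    have h2 : Λ.card.choose 2 ≤ Λ.card ^ 2 := by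
      rw [Nat.choose_two_right, sq]
      exact (Nat.div_le_self _ _).trans (Nat.mul_le_mul_left _ (by omega))
    nlinarith
  calc dnfSize G ≤ ∑ q ∈ G, 3 := Finset.sum_le_sum fun q hq => by have := (h q hq).1; omega
    _ = 3 * G.card := by simp [mul_comm]
    _ ≤ _ := Nat.mul_le_mul_left _ hcard

theorem Reachable.exists_refutation {F : Set (Clause V)} {m L : ℕ} {S : Set (Dnf V)}
    (h : Reachable F m L S) (hS : ∅ ∈ S) :
    ∃ P : List (Dnf V), IsResKRefutation 2 F P ∧ proofSize P ≤ L * (3 * (2 * m + 1) ^ 2) := by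
  obtain ⟨P, h1, h2, h3, h4⟩ := h
  refine ⟨P ++ [∅], ⟨by simp, by simp, ?_, ?_⟩, ?_⟩
  · intro G hG
    rcases List.mem_append.1 hG with hG | hG
    · obtain ⟨Ω, -, hΩ⟩ := h4 G hG
      exact fun q hq => (hΩ q hq).1
    · rw [List.mem_singleton.1 hG]
      exact fun q hq => absurd hq (Finset.notMem_empty q)
  · refine Deriv.getElem (h1.inf (prems := [∅]) ?_ (by simpa using h3 ∅ hS))
    exact ResKInf.weaken ∅ ∅
  · have : ∀ G ∈ P, dnfSize G ≤ 3 * (2 * m + 1) ^ 2 := by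
      intro G hG
      obtain ⟨Ω, hc, hΩ⟩ := h4 G hG
      exact hΩ.dnfSize_le.trans (by gcongr)
    have hsum := List.sum_le_card_nsmul (P.map dnfSize) (3 * (2 * m + 1) ^ 2) (by simpa using this)
    rw [List.length_map, smul_eq_mul] at hsum
    simp only [proofSize, List.map_append, List.sum_append, List.map_cons, List.map_nil,
      List.sum_singleton]
    have he : dnfSize (∅ : Dnf V) = 0 := by simp [dnfSize]
    rw [he, add_zero]
    exact hsum.trans (Nat.mul_le_mul_right _ h2)

namespace RefTree

section Refutation

variable {N g K : ℕ} (x : RefVar N g K → V) (y : Fin N → V)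

/-- The term stating that `y i` has value `v` and differs from the assignment at a line. -/
def conflict (q : LineId N g) (i : Fin N) (v : Bool) : PTerm V :=
  {⟨y i, v⟩, ⟨valVar x q i, !v⟩}

/-- The DNF stating that `y` differs from the assignment at a line on one of the first `t`
variables. -/
def conflicts (t : ℕ) (q : LineId N g) : Dnf V :=
  (univ.filter fun p : Fin N × Bool => p.1.val < t).image fun p => conflict x y q p.1 p.2

/-- The DNF stating that `y` does not reach a line, or the line is inactive. -/
def conflictLine (t : Fin (N + 1)) (j : Addr g) : Dnf V :=
  conflicts x y t (t, j) ∪ clauseToDnf (negActive x (t, j))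

/-- The variables of a pair of lines, together with the root pointer and the variables `y`. -/
def scope (q q' : LineId N g) : Finset V :=
  univ.image y ∪ univ.image (rootVar x) ∪ (univ.image fun z => x (.inr (q, z))) ∪
    univ.image fun z => x (.inr (q', z))

theorem card_scope_le (q q' : LineId N g) :
    (scope x y q q').card ≤ N + g + 2 * (K + (N + 2 * g)) := by
  have h1 : (univ.image y).card ≤ N := Finset.card_image_le.trans (by simp)
  have h2 : (univ.image (rootVar x)).card ≤ g := Finset.card_image_le.trans (by simp)
  have h3 : ∀ q : LineId N g, (univ.image fun z => x (.inr (q, z))).card ≤ K + (N + 2 * g) :=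
    fun q => Finset.card_image_le.trans (by simp [LineData])
  refine (Finset.card_union_le _ _).trans ?_
  have h4 := Finset.card_union_le (univ.image y ∪ univ.image (rootVar x))
    (univ.image fun z => x (.inr (q, z)))
  have h5 := Finset.card_union_le (univ.image y) (univ.image (rootVar x))
  have h6 := h3 q
  have h7 := h3 q'
  omega

theorem input_mem_scope (q q' : LineId N g) (i : Fin N) : y i ∈ scope x y q q' := by
  simp [scope]

theorem root_mem_scope (q q' : LineId N g) (b : Fin g) : rootVar x b ∈ scope x y q q' := by
  simp [scope]

theorem left_mem_scope (q q' : LineId N g) (z) : x (.inr (q, z)) ∈ scope x y q q' := by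
  simp only [scope, Finset.mem_union, Finset.mem_image, Finset.mem_univ, true_and]
  exact Or.inl (Or.inr ⟨z, rfl⟩)

theorem right_mem_scope (q q' : LineId N g) (z) : x (.inr (q', z)) ∈ scope x y q q' := by
  simp only [scope, Finset.mem_union, Finset.mem_image, Finset.mem_univ, true_and]
  exact Or.inr ⟨z, rfl⟩

variable {x y} {Ω : Finset V} {q : LineId N g}

theorem isTwoDnfOn_conflicts (hy : ∀ i, y i ∈ Ω) (hq : ∀ z, x (.inr (q, z)) ∈ Ω) (t : ℕ) :
    IsTwoDnfOn Ω (conflicts x y t q) := by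
  intro p hp
  obtain ⟨⟨i, v⟩, -, rfl⟩ := Finset.mem_image.1 hp
  refine ⟨Finset.card_le_two, fun l hl => ?_⟩
  simp only [conflict, Finset.mem_insert, Finset.mem_singleton] at hl
  rcases hl with rfl | rfl
  · exact hy i
  · exact hq _

theorem var_mem_of_mem_negActive (hq : ∀ z, x (.inr (q, z)) ∈ Ω) :
    ∀ l ∈ negActive x q, l.var ∈ Ω := by
  intro l hl
  obtain ⟨c, -, rfl⟩ := Finset.mem_image.1 hl
  exact hq _

theorem var_mem_of_mem_negPtr (hq : ∀ z, x (.inr (q, z)) ∈ Ω) (s : Bool) (j : Addr g) :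
    ∀ l ∈ negPtr x q s j, l.var ∈ Ω := by
  intro l hl
  obtain ⟨c, -, rfl⟩ := Finset.mem_image.1 hl
  exact hq _

theorem isTwoDnfOn_conflictLine {t : Fin (N + 1)} {j : Addr g} (hy : ∀ i, y i ∈ Ω)
    (hq : ∀ z, x (.inr ((t, j), z)) ∈ Ω) : IsTwoDnfOn Ω (conflictLine x y t j) :=
  (isTwoDnfOn_conflicts hy hq _).union (isTwoDnfOn_clauseToDnf (var_mem_of_mem_negActive hq))

theorem conflict_mem_conflicts {t : ℕ} {i : Fin N} (hi : i.val < t) (v : Bool) :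
    conflict x y q i v ∈ conflicts x y t q :=
  Finset.mem_image.2 ⟨(i, v), by simpa using hi, rfl⟩

theorem clauseToDnf_union (C C' : Clause V) :
    clauseToDnf (C ∪ C') = clauseToDnf C ∪ clauseToDnf C' := Finset.image_union _ _

variable {F : Set (Clause V)} {S : Set (Dnf V)} {Cl : Addr g → Clause (Fin N)}

/-- Activity literals can be resolved away. -/
theorem eliminate_negActive {D : Dnf V} {C : Clause V} {n : ℕ} (hD : IsTwoDnfOn Ω D)
    (hCD : clauseToDnf C ⊆ D) (hC : ∀ l ∈ C, l.var ∈ Ω) (hq : ∀ z, x (.inr (q, z)) ∈ Ω)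
    (hF : ∀ c, C ∪ {⟨copyVar x q c, true⟩} ∈ F)
    (h : TreeDeriv F Ω S n (D ∪ clauseToDnf (negActive x q))) :
    TreeDeriv F Ω S (n + 4 * K) D := by
  have h1 := TreeDeriv.eliminate (F := F) (S := S) (Ω := Ω) (m := 4) (D := D)
    (univ : Finset (Fin K)) (fun c => {⟨copyVar x q c, false⟩}) (by
      intro c _ D' hDD' hD' n h
      refine TreeDeriv.resolve ⟨copyVar x q c, false⟩ h (TreeDeriv.clause (hF c) ?_) hD'
        subset_rfl ?_
      · intro l hl
        rcases Finset.mem_union.1 hl with hl | hl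
        · exact hC l hl
        · rw [Finset.mem_singleton.1 hl]
          exact hq _
      · rw [clauseToDnf_union]
        refine Finset.union_subset_union (hCD.trans hDD') ?_
        simp [clauseToDnf, Lit.neg])
    D subset_rfl hD n (by simpa [clauseToDnf, negActive, Finset.image_image, Function.comp_def]
      using h)
  simpa [mul_comm] using h1

/-- The lines of the last layer. -/
theorem treeDeriv_leaf (hF : ∀ C, IsRefClause x Cl C → C ∈ F)
    (hA : ∀ e, (Cl e).image (Lit.map y) ∈ F) (hw : ∀ e, (Cl e).card ≤ N) (j : Addr g)
    (hy : ∀ i, y i ∈ Ω) (hq : ∀ z, x (.inr ((Fin.last N, j), z)) ∈ Ω) :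
    TreeDeriv F Ω S (2 ^ g * (4 * N + 5)) (conflictLine x y (Fin.last N) j) := by
  have hL := isTwoDnfOn_conflictLine hy hq
  refine (TreeDeriv.eliminate_address (n := 4 * N + 2) (ptrVar x (Fin.last N, j) false) hL
    fun e => ?_).mono le_rfl
  have hD : IsTwoDnfOn Ω (conflictLine x y (Fin.last N) j ∪
      clauseToDnf (negPtr x (Fin.last N, j) false e)) :=
    hL.union (isTwoDnfOn_clauseToDnf (var_mem_of_mem_negPtr hq _ _))
  have h0 : TreeDeriv F Ω S 1 (clauseToDnf ((Cl e).image (Lit.map y))) := .clause (hA e) (by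
    intro l hl
    obtain ⟨l', -, rfl⟩ := Finset.mem_image.1 hl
    exact hy _)
  have h1 := TreeDeriv.eliminate (F := F) (S := S) (Ω := Ω) (m := 4) (Cl e)
    (fun l => {Lit.map y l}) (by
      rintro ⟨i, v⟩ hl D' hDD' hD' n h
      have hc : conflict x y (Fin.last N, j) i v ∈ D' := hDD' (Finset.mem_union_left _
        (Finset.mem_union_left _ (conflict_mem_conflicts (by simp) v)))
      refine TreeDeriv.and_to (l := ⟨y i, v⟩) (l' := ⟨valVar x (Fin.last N, j) i, !v⟩) h
        (TreeDeriv.clause (hF _ (.leaf j e i v hl)) ?_) hD' subset_rfl ?_ hc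
      · intro l hl
        simp only [Finset.mem_union, Finset.mem_singleton] at hl
        rcases hl with (hl | hl) | rfl
        · exact var_mem_of_mem_negActive hq l hl
        · exact var_mem_of_mem_negPtr hq _ _ l hl
        · exact hq _
      · rw [clauseToDnf_union, clauseToDnf_union]
        refine Finset.union_subset_union (Finset.Subset.trans ?_ hDD') (by simp [clauseToDnf])
        exact Finset.union_subset_union Finset.subset_union_right subset_rfl)
    _ subset_rfl hD 2 (h0.weaken_to (hD.union ?_) ?_)
  · exact h1.mono (by have := hw e; omega)
  · intro p hp
    obtain ⟨l, -, rfl⟩ := Finset.mem_image.1 hp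
    simpa [Lit.map] using hy _
  · refine Finset.Subset.trans ?_ Finset.subset_union_right
    simp [clauseToDnf, Finset.image_image, Function.comp_def]

/-- Transferring the conflict from a line to one of its predecessors. -/
theorem treeDeriv_transfer (hF : ∀ C, IsRefClause x Cl C → C ∈ F) (t : Fin N) (j : Addr g)
    (s : Bool) (j' : Addr g) (hy : ∀ i, y i ∈ Ω)
    (hq : ∀ z, x (.inr ((t.castSucc, j), z)) ∈ Ω) (hq' : ∀ z, x (.inr ((t.succ, j'), z)) ∈ Ω)
    (hS : conflictLine x y t.succ j' ∈ S) :
    TreeDeriv F Ω S (16 * N + 4 * K + 1) (conflictLine x y t.castSucc j ∪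
      clauseToDnf (negPtr x (t.castSucc, j) s j') ∪ {{⟨y t, !s⟩}}) := by
  set C := negActive x (t.castSucc, j) ∪ negPtr x (t.castSucc, j) s j' with hCdef
  set D := conflictLine x y t.castSucc j ∪
      clauseToDnf (negPtr x (t.castSucc, j) s j') ∪ {{⟨y t, !s⟩}} with hDdef
  have hD : IsTwoDnfOn Ω D := ((isTwoDnfOn_conflictLine hy hq).union
    (isTwoDnfOn_clauseToDnf (var_mem_of_mem_negPtr hq _ _))).union (isTwoDnfOn_singleton (hy t))
  have hC : ∀ l ∈ C, l.var ∈ Ω := by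
    intro l hl
    rcases Finset.mem_union.1 hl with hl | hl
    · exact var_mem_of_mem_negActive hq l hl
    · exact var_mem_of_mem_negPtr hq _ _ l hl
  have hCD : clauseToDnf C ⊆ D := by
    rw [hCdef, clauseToDnf_union]
    exact (Finset.union_subset_union Finset.subset_union_right subset_rfl).trans
      Finset.subset_union_left
  have hc' := isTwoDnfOn_conflicts hy hq' (t.val + 1)
  have h0 : TreeDeriv F Ω S 1 (D ∪ conflicts x y (t.val + 1) (t.succ, j') ∪
      clauseToDnf (negActive x (t.succ, j'))) := by
    refine (TreeDeriv.hyp hS (isTwoDnfOn_conflictLine hy hq')).weaken_to ((hD.union hc').union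
      (isTwoDnfOn_clauseToDnf (var_mem_of_mem_negActive hq'))) ?_
    exact Finset.union_subset_union Finset.subset_union_right subset_rfl
  have h1 := eliminate_negActive (hD.union hc') (hCD.trans Finset.subset_union_left) hC hq'
    (fun c => hF _ (.active t j s j' c)) h0
  have h2 := TreeDeriv.eliminate (F := F) (S := S) (Ω := Ω) (m := 8) (D := D)
    (univ.filter fun p : Fin N × Bool => p.1.val < t.val + 1)
    (fun p => conflict x y (t.succ, j') p.1 p.2) (by
      rintro ⟨i, v⟩ hi D' hDD' hD' n h
      have hi' : i.val < t.val + 1 := (Finset.mem_filter.1 hi).2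
      have hneg : (conflict x y (t.succ, j') i v).image (fun l => ({l.neg} : PTerm V)) =
          {{⟨y i, !v⟩}, {⟨valVar x (t.succ, j') i, v⟩}} := by
        simp [conflict, Finset.image_insert, Lit.neg]
      rcases Nat.lt_succ_iff_lt_or_eq.1 hi' with hlt | heq
      · have hk : TreeDeriv F Ω S (1 + 1 + 3) (D' ∪
            (conflict x y (t.succ, j') i v).image fun l => ({l.neg} : PTerm V)) := by
          have hc : conflict x y (t.castSucc, j) i v ∈ D' := hDD' (Finset.mem_union_left _
            (Finset.mem_union_left _ (Finset.mem_union_left _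
              (conflict_mem_conflicts (by simpa using hlt) v))))
          rw [hneg]
          refine TreeDeriv.and_to (l := ⟨y i, v⟩) (l' := ⟨valVar x (t.castSucc, j) i, !v⟩)
            (TreeDeriv.ax (y i) (hy i)) (TreeDeriv.clause (hF _ (.keep t j s j' i v hlt)) ?_)
            (hD'.union ?_) ?_ ?_ (Finset.mem_union_left _ hc)
          · intro l hl
            rcases Finset.mem_union.1 hl with hl | hl
            · exact hC l hl
            · simp only [Finset.mem_insert, Finset.mem_singleton] at hl
              rcases hl with rfl | rfl
              · exact hq _
              · exact hq' _
          · rw [Finset.insert_eq]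
            exact (isTwoDnfOn_singleton (hy i)).union (isTwoDnfOn_singleton (hq' _))
          · intro p hp
            cases v <;> simp at hp ⊢ <;> tauto
          · rw [clauseToDnf_union]
            refine Finset.union_subset ((hCD.trans hDD').trans (Finset.subset_union_left.trans
              Finset.subset_union_left)) ?_
            intro p hp
            simp [clauseToDnf] at hp ⊢
            tauto
        exact (TreeDeriv.cut_to h hk hD' subset_rfl subset_rfl).mono (by omega)
      · obtain rfl : i = t := Fin.ext heq
        by_cases hv : v = s
        · subst hv
          refine (TreeDeriv.cut_to h (TreeDeriv.clause (hF _ (.branch i j v j')) ?_) hD'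
            subset_rfl ?_).mono (by omega : n + 1 + 3 ≤ n + 8)
          · intro l hl
            rcases Finset.mem_union.1 hl with hl | hl
            · exact hC l hl
            · rw [Finset.mem_singleton.1 hl]
              exact hq' _
          · rw [hneg, clauseToDnf_union]
            exact Finset.union_subset_union (hCD.trans hDD') (by simp [clauseToDnf])
        · obtain rfl : v = !s := by cases v <;> cases s <;> simp_all
          refine (TreeDeriv.cut_to h (TreeDeriv.ax (y i) (hy i)) hD'
            subset_rfl ?_).mono (by omega : n + 1 + 3 ≤ n + 8)
          rw [hneg]
          have hm : ({⟨y i, !s⟩} : PTerm V) ∈ D' := hDD' (Finset.mem_union_right _ (by simp))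
          intro p hp
          cases s <;> simp at hp hm ⊢ <;> rcases hp with rfl | rfl <;> simp [hm])
    D subset_rfl hD _ h1
  refine h2.mono ?_
  have : (univ.filter fun p : Fin N × Bool => p.1.val < t.val + 1).card ≤ N * 2 :=
    (Finset.card_filter_le _ _).trans (by simp)
  omega

/-- The lines of an inner layer. -/
theorem treeDeriv_inner (t : Fin N) (j : Addr g) (hy : ∀ i, y i ∈ Ω)
    (hq : ∀ z, x (.inr ((t.castSucc, j), z)) ∈ Ω)
    (hS : ∀ s j', conflictLine x y t.castSucc j ∪
      clauseToDnf (negPtr x (t.castSucc, j) s j') ∪ {{⟨y t, !s⟩}} ∈ S) :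
    TreeDeriv F Ω S (2 ^ g * 6 + 3) (conflictLine x y t.castSucc j) := by
  have hL := isTwoDnfOn_conflictLine hy hq
  have h1 : ∀ s, TreeDeriv F Ω S (2 ^ g * (0 + 3))
      (conflictLine x y t.castSucc j ∪ {{⟨y t, !s⟩}}) := by
    intro s
    have hL' := hL.union (isTwoDnfOn_singleton (l := ⟨y t, !s⟩) (hy t))
    refine TreeDeriv.eliminate_address (ptrVar x (t.castSucc, j) s) hL' fun e => ?_
    rw [Finset.union_right_comm]
    refine TreeDeriv.hyp (hS s e) ?_
    rw [Finset.union_right_comm]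
    exact hL'.union (isTwoDnfOn_clauseToDnf (var_mem_of_mem_negPtr hq s e))
  exact (TreeDeriv.resolve ⟨y t, false⟩ (h1 true) (h1 false) hL subset_rfl subset_rfl).mono
    (by omega)

variable (x y) in
/-- If `Cl` is refuted by a decision tree encoded by `x` then its copy over `y` has short Res(2)
refutations. -/
theorem exists_resTwo_refutation (hF : ∀ C, IsRefClause x Cl C → C ∈ F)
    (hA : ∀ e, (Cl e).image (Lit.map y) ∈ F) (hw : ∀ e, (Cl e).card ≤ N) :
    ∃ P : List (Dnf V), IsResKRefutation 2 F P ∧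
      proofSize P ≤ (N + 2) * (2 ^ g * 2 ^ g * (32 * N + 8 * K + 11)) *
        (3 * (2 * (N + g + 2 * (K + (N + 2 * g))) + 1) ^ 2) := by
  set m := N + g + 2 * (K + (N + 2 * g)) with hm
  set M := 2 ^ g * 2 ^ g * (32 * N + 8 * K + 11) with hM
  have hG : 1 ≤ 2 ^ g := Nat.one_le_two_pow
  have hcardA : (univ : Finset (Addr g)).card = 2 ^ g := by simp [Addr]
  have hlayer : ∀ t : Fin (N + 1), Reachable F m ((N + 1 - t.val) * M)
      (Set.range (conflictLine x y t)) := by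
    refine Fin.reverseInduction ?_ fun t ih => ?_
    · have h1 := (Reachable.empty (F := F) (m := m)).add (2 ^ g * (4 * N + 5)) univ
        (conflictLine x y (Fin.last N)) fun j _ => ⟨scope x y (Fin.last N, j) (Fin.last N, j),
          card_scope_le x y _ _, treeDeriv_leaf hF hA hw j (input_mem_scope x y _ _)
            (left_mem_scope x y _ _)⟩
      refine h1.mono ?_ (by simp)
      rw [hcardA, zero_add, Fin.val_last, Nat.add_sub_cancel_left, one_mul, hM, ← mul_assoc]
      exact Nat.mul_le_mul_left _ (by omega)
    · have h1 := ih.add (16 * N + 4 * K + 1) univ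
        (fun p : (Addr g) × Bool × Addr g => conflictLine x y t.castSucc p.1 ∪
          clauseToDnf (negPtr x (t.castSucc, p.1) p.2.1 p.2.2) ∪ {{⟨y t, !p.2.1⟩}})
        fun p _ => ⟨scope x y (t.castSucc, p.1) (t.succ, p.2.2), card_scope_le x y _ _,
          treeDeriv_transfer hF t p.1 p.2.1 p.2.2 (input_mem_scope x y _ _)
            (left_mem_scope x y _ _) (right_mem_scope x y _ _) (Set.mem_range_self _)⟩
      have h2 := h1.add (2 ^ g * 6 + 3) univ (conflictLine x y t.castSucc) fun j _ =>
        ⟨scope x y (t.castSucc, j) (t.castSucc, j), card_scope_le x y _ _,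
          treeDeriv_inner t j (input_mem_scope x y _ _) (left_mem_scope x y _ _)
            fun s j' => Or.inr ⟨(j, s, j'), by simp, rfl⟩⟩
      refine h2.mono ?_ (by simp)
      have hc : (univ : Finset ((Addr g) × Bool × Addr g)).card = 2 ^ g * (2 * 2 ^ g) := by
        simp [Addr]
      rw [hc, hcardA, Fin.val_succ, Fin.val_castSucc,
        show N + 1 - t.val = N + 1 - (t.val + 1) + 1 by omega, Nat.add_mul, one_mul, add_assoc]
      refine Nat.add_le_add_left ?_ _
      rw [hM]
      nlinarith [Nat.mul_le_mul hG hG]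
  have h1 := (hlayer 0).add (4 * K + 1) univ (fun j : Addr g => clauseToDnf (negRoot x j))
    fun j _ => ⟨scope x y (0, j) (0, j), card_scope_le x y _ _, by
      have hr : ∀ l ∈ negRoot x j, l.var ∈ scope x y (0, j) (0, j) := by
        intro l hl
        obtain ⟨b, -, rfl⟩ := Finset.mem_image.1 hl
        exact root_mem_scope x y _ _ b
      have h0 : conflictLine x y 0 j = clauseToDnf (negActive x (0, j)) := by
        simp [conflictLine, conflicts]
      have hl := isTwoDnfOn_conflictLine (input_mem_scope x y (0, j) (0, j))
        (left_mem_scope x y (0, j) (0, j))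
      refine (eliminate_negActive (n := 1) (isTwoDnfOn_clauseToDnf hr) subset_rfl hr
        (left_mem_scope x y (0, j) (0, j)) (fun c => hF _ (.root j c)) ?_).mono (by omega)
      refine (TreeDeriv.hyp (G := conflictLine x y 0 j) (Set.mem_range_self j) hl).weaken_to
        ((isTwoDnfOn_clauseToDnf hr).union (h0 ▸ hl)) ?_
      rw [h0]
      exact Finset.subset_union_right⟩
  have h2 := h1.add (2 ^ g * (0 + 3)) {()} (fun _ => (∅ : Dnf V)) fun _ _ =>
    ⟨scope x y (0, fun _ => true) (0, fun _ => true), card_scope_le x y _ _, by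
      refine TreeDeriv.eliminate_address (rootVar x) (by simp [IsTwoDnfOn]) fun j => ?_
      rw [Finset.empty_union]
      refine TreeDeriv.hyp (Or.inr ⟨j, by simp, rfl⟩) (isTwoDnfOn_clauseToDnf fun l hl => ?_)
      obtain ⟨b, -, rfl⟩ := Finset.mem_image.1 hl
      exact root_mem_scope x y _ _ b⟩
  obtain ⟨P, hP, hs⟩ := h2.exists_refutation (Or.inr ⟨(), by simp, rfl⟩)
  refine ⟨P, hP, hs.trans (Nat.mul_le_mul_right _ ?_)⟩
  rw [hcardA, Fin.val_zero, Nat.sub_zero, Finset.card_singleton, one_mul,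
    show N + 2 = N + 1 + 1 by omega, Nat.add_mul (N + 1) 1, one_mul, add_assoc]
  refine Nat.add_le_add_left ?_ _
  rw [hM]
  nlinarith [Nat.mul_le_mul hG hG]

end Refutation

end RefTree

namespace BitPigeonhole

/-- The clause forbidding pigeons `i` and `i'` to share the hole `h`. -/
def pigeonClause (r : ℕ) (i i' : Fin (2 ^ r + 1)) (h : Fin r → Bool) :
    Clause (Fin ((2 ^ r + 1) * r)) :=
  (univ.image fun b => ⟨finProdFinEquiv (i, b), !(h b)⟩) ∪
    univ.image fun b => ⟨finProdFinEquiv (i', b), !(h b)⟩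

/-- The pigeonhole principle with `2 ^ r + 1` pigeons and `2 ^ r` holes, in binary encoding. -/
def formula (r : ℕ) : Cnf (Fin ((2 ^ r + 1) * r)) :=
  (univ.filter fun p : Fin (2 ^ r + 1) × Fin (2 ^ r + 1) × (Fin r → Bool) => p.1 ≠ p.2.1).image
    fun p => pigeonClause r p.1 p.2.1 p.2.2

theorem mem_formula {r : ℕ} {C : Clause (Fin ((2 ^ r + 1) * r))} :
    C ∈ formula r ↔ ∃ i i' h, i ≠ i' ∧ pigeonClause r i i' h = C := by
  simp [formula]

theorem card_formula_le (r : ℕ) : (formula r).card ≤ 2 ^ (3 * r + 2) := by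
  refine Finset.card_image_le.trans ((Finset.card_filter_le _ _).trans ?_)
  have h : 1 ≤ 2 ^ r := Nat.one_le_two_pow
  have h2 : 2 ^ (3 * r + 2) = (2 * 2 ^ r) * ((2 * 2 ^ r) * 2 ^ r) := by ring
  simp only [Finset.card_univ, Fintype.card_prod, Fintype.card_fin, Fintype.card_pi,
    Fintype.card_bool, Finset.prod_const]
  rw [h2]
  gcongr <;> omega

theorem card_le_of_mem_formula {r : ℕ} {C : Clause (Fin ((2 ^ r + 1) * r))} (hC : C ∈ formula r) :
    C.card ≤ 2 * r := by
  obtain ⟨i, i', h, -, rfl⟩ := mem_formula.1 hC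
  refine (Finset.card_union_le _ _).trans ?_
  have h1 := fun i => Finset.card_image_le (s := univ)
    (f := fun b : Fin r => (⟨finProdFinEquiv (i, b), !(h b)⟩ : Lit (Fin ((2 ^ r + 1) * r))))
  have h2 := h1 i
  have h3 := h1 i'
  simp only [Finset.card_univ, Fintype.card_fin] at h2 h3
  omega

/-- By the pigeonhole principle, every assignment falsifies some clause. -/
theorem exists_falsified (r : ℕ) (D : Fin ((2 ^ r + 1) * r) → Bool) :
    ∃ C ∈ formula r, ∀ l ∈ C, D l.var ≠ l.pos := by
  obtain ⟨i, i', hne, he⟩ := Fintype.exists_ne_map_eq_of_card_lt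
    (fun (i : Fin (2 ^ r + 1)) (b : Fin r) => D (finProdFinEquiv (i, b))) (by simp)
  refine ⟨_, mem_formula.2 ⟨i, i', fun b => D (finProdFinEquiv (i, b)), hne, rfl⟩, ?_⟩
  intro l hl
  rcases Finset.mem_union.1 hl with hl | hl
  · obtain ⟨b, -, rfl⟩ := Finset.mem_image.1 hl
    simp
  · obtain ⟨b, -, rfl⟩ := Finset.mem_image.1 hl
    have hb : D (finProdFinEquiv (i, b)) = D (finProdFinEquiv (i', b)) := congrFun he b
    simp [hb]

/-- The formula over the natural numbers, renamed along `y`. -/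
def formulaMap (r : ℕ) (y : Fin ((2 ^ r + 1) * r) → V) : Cnf V :=
  (formula r).image fun C => C.image (Lit.map y)

theorem formulaMap_lower_bound {v k r : ℕ} (hr : 14 * v + 66 ≤ r)
    {y : Fin ((2 ^ r + 1) * r) → V} (hy : Function.Injective y) {R : List (Dnf V)}
    (hR : IsResKRefutation k (↑(formulaMap r y) : Set (Clause V)) R) :
    2 ^ 2 ^ v ≤ proofSize R + 1 := by
  refine bitPigeonhole_lower_bound (P := Fin (2 ^ r + 1)) hr (by simp)
    (hy.comp finProdFinEquiv.injective) (fun C hC => ?_) hR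
  obtain ⟨C', hC', rfl⟩ := Finset.mem_image.1 (Finset.mem_coe.1 hC)
  obtain ⟨i, i', h, hne, rfl⟩ := mem_formula.1 hC'
  refine ⟨i, i', h, hne, fun b => ⟨?_, ?_⟩⟩
  · exact Finset.mem_image.2 ⟨⟨finProdFinEquiv (i, b), !(h b)⟩, by simp [pigeonClause], rfl⟩
  · exact Finset.mem_image.2 ⟨⟨finProdFinEquiv (i', b), !(h b)⟩, by simp [pigeonClause], rfl⟩

theorem cnfSize_formulaMap_le (r : ℕ) (y : Fin ((2 ^ r + 1) * r) → V) :
    cnfSize (formulaMap r y) ≤ 2 ^ (3 * r + 2) * (2 * r + 1) := by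
  calc cnfSize (formulaMap r y) ≤ ∑ C ∈ formulaMap r y, (2 * r + 1) := by
        refine Finset.sum_le_sum fun C hC => ?_
        obtain ⟨C', hC', rfl⟩ := Finset.mem_image.1 hC
        have := card_le_of_mem_formula hC'
        have := Finset.card_image_le (s := C') (f := Lit.map y)
        omega
    _ = (formulaMap r y).card * (2 * r + 1) := by simp
    _ ≤ _ := Nat.mul_le_mul_right _ (Finset.card_image_le.trans (card_formula_le r))

theorem mem_cnfVars_formulaMap {r : ℕ} {y : Fin ((2 ^ r + 1) * r) → V} {z : V}
    (hz : z ∈ cnfVars (formulaMap r y)) : z ∈ Set.range y := by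
  simp only [cnfVars, formulaMap, Finset.mem_sup, Finset.mem_image] at hz
  obtain ⟨_, ⟨C, -, rfl⟩, l, hl, rfl⟩ := hz
  obtain ⟨l', -, rfl⟩ := Finset.mem_image.1 hl
  exact ⟨_, rfl⟩

end BitPigeonhole

namespace RefTree

variable {N g K : ℕ} (x : RefVar N g K → V) (Cl : Addr g → Clause (Fin N))

/-- Indices of the clauses of the formula. -/
abbrev ClauseIndex (N g K : ℕ) :=
  (Fin N × Addr g × Bool × Addr g) × (Fin N × Bool ⊕ Option (Fin K)) ⊕
    (Addr g × Addr g) × (Fin N × Bool) ⊕ Addr g × Fin K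

/-- The clause with a given index. -/
def clauseOfIndex : ClauseIndex N g K → Clause V
  | .inl ((t, j, s, j'), .inl (i, v)) =>
    negActive x (t.castSucc, j) ∪ negPtr x (t.castSucc, j) s j' ∪
      {⟨valVar x (t.castSucc, j) i, !v⟩, ⟨valVar x (t.succ, j') i, v⟩}
  | .inl ((t, j, s, j'), .inr none) =>
    negActive x (t.castSucc, j) ∪ negPtr x (t.castSucc, j) s j' ∪ {⟨valVar x (t.succ, j') t, s⟩}
  | .inl ((t, j, s, j'), .inr (some c)) =>
    negActive x (t.castSucc, j) ∪ negPtr x (t.castSucc, j) s j' ∪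
      {⟨copyVar x (t.succ, j') c, true⟩}
  | .inr (.inl ((j, e), (i, v))) =>
    negActive x (Fin.last N, j) ∪ negPtr x (Fin.last N, j) false e ∪
      {⟨valVar x (Fin.last N, j) i, !v⟩}
  | .inr (.inr (j, c)) => negRoot x j ∪ {⟨copyVar x (0, j) c, true⟩}

/-- The clauses stating that the variables describe a layered decision tree for `Cl`. -/
noncomputable def formula : Cnf V :=
  (univ.image (clauseOfIndex x)).filter (IsRefClause x Cl)

variable {x Cl}

theorem mem_formula {C : Clause V} : C ∈ formula x Cl ↔ IsRefClause x Cl C := by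
  refine ⟨fun h => (Finset.mem_filter.1 h).2, fun h => Finset.mem_filter.2 ⟨?_, h⟩⟩
  rw [Finset.mem_image]
  cases h with
  | keep t j s j' i v _ => exact ⟨.inl ((t, j, s, j'), .inl (i, v)), Finset.mem_univ _, rfl⟩
  | branch t j s j' => exact ⟨.inl ((t, j, s, j'), .inr none), Finset.mem_univ _, rfl⟩
  | active t j s j' c => exact ⟨.inl ((t, j, s, j'), .inr (some c)), Finset.mem_univ _, rfl⟩
  | leaf j e i v _ => exact ⟨.inr (.inl ((j, e), (i, v))), Finset.mem_univ _, rfl⟩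
  | root j c => exact ⟨.inr (.inr (j, c)), Finset.mem_univ _, rfl⟩

theorem card_le_of_isRefClause {C : Clause V} (hC : IsRefClause x Cl C) : C.card ≤ K + g + 2 := by
  have h1 : ∀ q, (negActive x q).card ≤ K := fun q => Finset.card_image_le.trans (by simp)
  have h2 : ∀ q s j, (negPtr x q s j).card ≤ g := fun q s j => Finset.card_image_le.trans (by simp)
  have h3 : ∀ j, (negRoot x j).card ≤ g := fun j => Finset.card_image_le.trans (by simp)
  have h4 : ∀ (q s j) (E : Clause V), E.card ≤ 2 →
      (negActive x q ∪ negPtr x q s j ∪ E).card ≤ K + g + 2 := by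
    intro q s j E hE
    have := Finset.card_union_le (negActive x q ∪ negPtr x q s j) E
    have := Finset.card_union_le (negActive x q) (negPtr x q s j)
    have := h1 q
    have := h2 q s j
    omega
  cases hC with
  | keep t j s j' i v _ => exact h4 _ _ _ _ Finset.card_le_two
  | branch t j s j' => exact h4 _ _ _ _ (by simp)
  | active t j s j' c => exact h4 _ _ _ _ (by simp)
  | leaf j e i v _ => exact h4 _ _ _ _ (by simp)
  | root j c =>
    have hu := Finset.card_union_le (negRoot x j) {⟨copyVar x (0, j) c, true⟩}
    rw [Finset.card_singleton] at hu
    have := h3 j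
    omega

theorem cnfSize_formula_le : cnfSize (formula x Cl) ≤
    2 ^ g * 2 ^ g * (2 * N * (2 * N + (K + 1)) + 2 * N + K) * (K + g + 3) := by
  calc cnfSize (formula x Cl) ≤ ∑ C ∈ formula x Cl, (K + g + 3) :=
        Finset.sum_le_sum fun C hC => Nat.succ_le_succ
          (card_le_of_isRefClause (mem_formula.1 hC))
    _ = (formula x Cl).card * (K + g + 3) := by simp
    _ ≤ _ := Nat.mul_le_mul_right _ ?_
  refine (Finset.card_filter_le _ _).trans (Finset.card_image_le.trans ?_)
  have hG : 1 ≤ 2 ^ g := Nat.one_le_two_pow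
  simp only [Finset.card_univ, ClauseIndex, Addr, Fintype.card_sum, Fintype.card_prod,
    Fintype.card_option, Fintype.card_fin, Fintype.card_pi, Fintype.card_bool, Finset.prod_const]
  have : 2 ^ g * K ≤ 2 ^ g * 2 ^ g * K := Nat.mul_le_mul_right _ (Nat.le_mul_of_pos_left _ hG)
  calc _ = 2 ^ g * 2 ^ g * (2 * N * (2 * N + (K + 1)) + 2 * N) + 2 ^ g * K := by ring
    _ ≤ 2 ^ g * 2 ^ g * (2 * N * (2 * N + (K + 1)) + 2 * N) + 2 ^ g * 2 ^ g * K := by omega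
    _ = _ := by ring

theorem mem_cnfVars_formula {z : V} (hz : z ∈ cnfVars (formula x Cl)) : z ∈ Set.range x := by
  simp only [cnfVars, Finset.mem_sup, Finset.mem_image] at hz
  obtain ⟨C, hC, l, hl, rfl⟩ := hz
  have h1 : ∀ q, ∀ l ∈ negActive x q, l.var ∈ Set.range x := by
    intro q l hl
    obtain ⟨c, -, rfl⟩ := Finset.mem_image.1 hl
    exact ⟨_, rfl⟩
  have h2 : ∀ q s j, ∀ l ∈ negPtr x q s j, l.var ∈ Set.range x := by
    intro q s j l hl
    obtain ⟨c, -, rfl⟩ := Finset.mem_image.1 hl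
    exact ⟨_, rfl⟩
  cases mem_formula.1 hC <;> simp only [Finset.mem_union, Finset.mem_insert,
    Finset.mem_singleton] at hl
  case keep =>
    rcases hl with (hl | hl) | rfl | rfl
    exacts [h1 _ l hl, h2 _ _ _ l hl, ⟨_, rfl⟩, ⟨_, rfl⟩]
  case root =>
    rcases hl with hl | rfl
    · obtain ⟨c, -, rfl⟩ := Finset.mem_image.1 hl
      exact ⟨_, rfl⟩
    · exact ⟨_, rfl⟩
  all_goals
    rcases hl with (hl | hl) | rfl
    exacts [h1 _ l hl, h2 _ _ _ l hl, ⟨_, rfl⟩]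

end RefTree

theorem Switching.depth_le {k X : ℕ} (hX : 1 ≤ X) (j : ℕ) :
    ∀ T, Switching.depth k X j T ≤ j * k * T * X ^ j := by
  induction j with
  | zero => simp [Switching.depth]
  | succ j ih =>
    intro T
    have h1 : k * T ≤ k * T * (X * X ^ j) :=
      Nat.le_mul_of_pos_right _ (Nat.mul_pos hX (Nat.pow_pos hX))
    calc k * T + Switching.depth k X j (T * X) ≤ k * T * (X * X ^ j) + j * k * (T * X) * X ^ j :=
          Nat.add_le_add h1 (ih _)
      _ = _ := by ring

theorem one_sub_inv_two_pow_nonneg (p : ℕ) : (0 : ℝ) ≤ 1 - 1 / 2 ^ p := by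
  rw [sub_nonneg, div_le_one (by positivity)]
  exact one_le_pow₀ (by norm_num)

theorem one_sub_inv_two_pow_pow_le (p a : ℕ) :
    (1 - 1 / 2 ^ p : ℝ) ^ (2 ^ p * a) ≤ 1 / 2 ^ a := by
  have h1 := Real.one_sub_div_pow_le_exp_neg (n := 2 ^ p) (t := 1)
    (by exact_mod_cast Nat.one_le_two_pow)
  push_cast at h1
  have h2 := Real.exp_neg_one_lt_d9
  have h3 : (1 - 1 / 2 ^ p : ℝ) ^ 2 ^ p ≤ 1 / 2 := by linarith
  rw [pow_mul, ← one_div_pow (2 : ℝ) a]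
  exact pow_le_pow_left₀ (pow_nonneg (one_sub_inv_two_pow_nonneg p) _) h3 a

namespace RefTree

/-- The lower bound for suitable parameters. -/
theorem two_pow_le_proofSize_add_one {N g k M : ℕ} {Cl : Addr g → Clause (Fin N)}
    {x : RefVar N g (k + 1) → V} (hx : Function.Injective x)
    (hCl : ∀ D : Fin N → Bool, ∃ e, ∀ l ∈ Cl e, D l.var ≠ l.pos) (hN : N + 1 ≤ 2 ^ g)
    {W T X : ℕ} (hW : W = k + 1 + N + 2 * g) (hT : T = 2 ^ (2 * k) * (M + W + 2))
    (hX : X = 2 ^ (2 * k) * (k * W) + 1)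
    (hg : (9 * (k * k * T * X ^ k) + 14) * (2 ^ (k + 1) * (2 * g + 1)) ≤ 2 ^ g)
    {P : List (Dnf V)} (hP : IsResKRefutation k (↑(formula x Cl) : Set (Clause V)) P) :
    2 ^ M ≤ proofSize P + 1 := by
  set A := 9 * (k * k * T * X ^ k) + 14 with hA
  refine refutation_lower_bound (X := X) (T := T) (A := A) (Y := 2 ^ (k + 1) * (2 * g + 1))
    (K := k + 1) (by omega) hx hCl ?_ ?_ hg ?_ (fun C hC => mem_formula.1 hC) hP
  · have h0 := one_sub_inv_two_pow_nonneg (2 * k)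
    have h1 := one_sub_inv_two_pow_pow_le (2 * k) (k * W)
    rw [← hW, hX, pow_succ, ← mul_assoc]
    refine mul_le_of_le_one_left h0 ?_
    calc (2 : ℝ) ^ (k * W) * (1 - 1 / 2 ^ (2 * k)) ^ (2 ^ (2 * k) * (k * W))
        ≤ 2 ^ (k * W) * (1 / 2 ^ (k * W)) := by gcongr
      _ = 1 := by rw [mul_one_div_cancel (by positivity)]
  · have := Switching.depth_le (k := k) (X := X) (by omega) k T
    omega
  · have h1 := one_sub_inv_two_pow_pow_le (2 * k) (M + W + 2)
    have h2 := one_sub_inv_two_pow_pow_le (k + 1) (2 * g + 1)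
    rw [← hT] at h1
    rw [← hW]
    have hA' : (A : ℝ) ≤ 2 ^ g := by
      exact_mod_cast le_trans (Nat.le_mul_of_pos_right _ (by positivity)) hg
    have hN' : (N : ℝ) + 1 ≤ 2 ^ g := by exact_mod_cast hN
    have h3 : (2 : ℝ) ^ M * (2 ^ W * (1 - 1 / 2 ^ (2 * k)) ^ T) ≤ 1 / 4 := by
      calc (2 : ℝ) ^ M * (2 ^ W * (1 - 1 / 2 ^ (2 * k)) ^ T)
          ≤ 2 ^ M * (2 ^ W * (1 / 2 ^ (M + W + 2))) := by gcongr
        _ = 1 / 4 := by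
          rw [pow_add, pow_add]
          field_simp
          norm_num
    have h4 : ((N : ℝ) + 1) * A * (1 - 1 / 2 ^ (k + 1)) ^ (2 ^ (k + 1) * (2 * g + 1)) ≤ 1 / 2 := by
      calc ((N : ℝ) + 1) * A * (1 - 1 / 2 ^ (k + 1)) ^ (2 ^ (k + 1) * (2 * g + 1))
          ≤ 2 ^ g * 2 ^ g * (1 / 2 ^ (2 * g + 1)) := by
            have := one_sub_inv_two_pow_nonneg (k + 1)
            gcongr
        _ = 1 / 2 := by
          rw [pow_add, two_mul, pow_add]
          field_simp
    linarith

end RefTree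

section Parameters

/-- The number `2 ^ m` is large in terms of `k`. -/
def IsLarge (k m : ℕ) : Prop := 1000 * 64 ^ k * (k + 1) ^ 3 * (m + 1) ≤ 2 ^ (m / 2)

theorem exists_isLarge (k : ℕ) : ∃ m₀, ∀ m, m₀ ≤ m → IsLarge k m := by
  have h := (tendsto_pow_const_div_const_pow_of_one_lt 1 (r := (2 : ℝ)) (by norm_num))
  set c : ℕ := 1000 * 64 ^ k * (k + 1) ^ 3 with hc
  have hc0 : 0 < c := by positivity
  have hc' : (0 : ℝ) < 1 / (4 * c) := by positivity
  obtain ⟨h₀, hh⟩ := Filter.eventually_atTop.1 (h.eventually (gt_mem_nhds hc'))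
  refine ⟨2 * h₀ + 2, fun m hm => ?_⟩
  have h1 := hh (m / 2) (by omega)
  rw [div_lt_div_iff₀ (by positivity) (by positivity), one_mul, pow_one] at h1
  have h2 : m / 2 * (4 * c) < 2 ^ (m / 2) := by exact_mod_cast h1
  have h3 : m + 1 ≤ m / 2 * 4 := by omega
  calc c * (m + 1) ≤ c * (m / 2 * 4) := Nat.mul_le_mul_left _ h3
    _ = m / 2 * (4 * c) := by ring
    _ ≤ _ := h2.le

variable {k m r N g : ℕ}

theorem card_pigeonVars_le (r : ℕ) : (2 ^ r + 1) * r ≤ 2 ^ (2 * r) := by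
  have h : r + 1 ≤ 2 ^ r := Nat.lt_two_pow_self
  have h2 : 2 ^ (2 * r) = 2 ^ r * 2 ^ r := by ring
  rw [h2]
  nlinarith

theorem IsLarge.mul_add_le (h : IsLarge k m) (hr : r = m / 8) (hN : N = (2 ^ r + 1) * r) :
    1000 * 64 ^ k * (k + 1) ^ 3 * (m + 1 + N) ≤ 2 * 2 ^ m := by
  have h1 : 1000 * 64 ^ k * (k + 1) ^ 3 ≤ 2 ^ (m / 2) :=
    (Nat.le_mul_of_pos_right _ (Nat.succ_pos m)).trans h
  have h2 : N ≤ 2 ^ (2 * r) := hN ▸ card_pigeonVars_le r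
  have h3 : 2 ^ (m / 2) ≤ 2 ^ m := Nat.pow_le_pow_right (by norm_num) (by omega)
  have h4 : 2 ^ (m / 2) * 2 ^ (2 * r) ≤ 2 ^ m := by
    rw [← pow_add]
    exact Nat.pow_le_pow_right (by norm_num) (by omega)
  calc 1000 * 64 ^ k * (k + 1) ^ 3 * (m + 1 + N)
      = 1000 * 64 ^ k * (k + 1) ^ 3 * (m + 1) + 1000 * 64 ^ k * (k + 1) ^ 3 * N := by ring
    _ ≤ 2 ^ (m / 2) + 2 ^ (m / 2) * 2 ^ (2 * r) := Nat.add_le_add h (Nat.mul_le_mul h1 h2)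
    _ ≤ _ := by omega

theorem IsLarge.parameters (h : IsLarge k m) (hk : 1 ≤ k) (hr : r = m / 8)
    (hN : N = (2 ^ r + 1) * r) (hg : g = (2 * k + 1) * m) {W T X : ℕ}
    (hW : W = k + 1 + N + 2 * g) (hT : T = 2 ^ (2 * k) * (2 ^ m + W + 2))
    (hX : X = 2 ^ (2 * k) * (k * W) + 1) :
    (9 * (k * k * T * X ^ k) + 14) * (2 ^ (k + 1) * (2 * g + 1)) ≤ 2 ^ g := by
  have hmain := h.mul_add_le hr hN
  set M := 2 ^ m with hM
  have hgM : 2 ^ g = M ^ (2 * k + 1) := by rw [hg, hM, ← pow_mul, mul_comm]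
  have h4 : 2 ^ (2 * k) = 4 ^ k := by rw [pow_mul]; norm_num
  have h464 : 4 ^ k ≤ 64 ^ k := Nat.pow_le_pow_left (by norm_num) k
  have hWle : W ≤ 4 * (k + 1) * (m + 1 + N) := by
    rw [hW, hg]
    nlinarith
  have hXM : X + 1 ≤ M := by
    have h5 : 4 ^ k * (k * W) ≤ 4 * 64 ^ k * (k + 1) ^ 3 * (m + 1 + N) := by
      calc 4 ^ k * (k * W) ≤ 64 ^ k * ((k + 1) * (4 * (k + 1) * (m + 1 + N))) := by
            gcongr
            omega
        _ = 4 * 64 ^ k * ((k + 1) ^ 2 * 1) * (m + 1 + N) := by ring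
        _ ≤ 4 * 64 ^ k * ((k + 1) ^ 2 * (k + 1)) * (m + 1 + N) := by gcongr; omega
        _ = _ := by ring
    have h6 : 1 ≤ 64 ^ k * (k + 1) ^ 3 * (m + 1 + N) := Nat.succ_le_of_lt (by positivity)
    rw [hX, h4]
    nlinarith
  have hWM : W + 2 ≤ M := by
    have h5 : W ≤ 2 ^ (2 * k) * (k * W) := by
      rw [← mul_assoc]
      exact Nat.le_mul_of_pos_left _ (by positivity)
    omega
  have hM1 : 1 ≤ M := by omega
  have hTM : T ≤ 4 ^ k * (2 * M) := by
    rw [hT, h4]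
    exact Nat.mul_le_mul_left _ (by omega)
  have hXk : X ^ k ≤ M ^ k := Nat.pow_le_pow_left (by omega) k
  have hMk : 1 ≤ M ^ (k + 1) := Nat.one_le_pow _ _ hM1
  have hA : 9 * (k * k * T * X ^ k) + 14 ≤ 32 * ((k + 1) ^ 2 * 4 ^ k * M ^ (k + 1)) := by
    have h5 : k * k * T * X ^ k ≤ 2 * ((k + 1) ^ 2 * 4 ^ k * M ^ (k + 1)) := by
      calc k * k * T * X ^ k ≤ (k + 1) * (k + 1) * (4 ^ k * (2 * M)) * M ^ k := by
            gcongr <;> omega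
        _ = _ := by ring
    have h6 : 1 ≤ (k + 1) ^ 2 * 4 ^ k * M ^ (k + 1) := Nat.succ_le_of_lt (by positivity)
    omega
  have hY : 2 ^ (k + 1) * (2 * g + 1) ≤ 8 * (2 ^ k * (k + 1) * (m + 1)) := by
    have : 2 * g + 1 ≤ 4 * ((k + 1) * (m + 1)) := by
      rw [hg]
      nlinarith
    calc 2 ^ (k + 1) * (2 * g + 1) ≤ 2 ^ (k + 1) * (4 * ((k + 1) * (m + 1))) := by gcongr
      _ = _ := by ring
  have h8 : 4 ^ k * 2 ^ k ≤ 64 ^ k := by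
    rw [← mul_pow]
    exact Nat.pow_le_pow_left (by norm_num) k
  calc (9 * (k * k * T * X ^ k) + 14) * (2 ^ (k + 1) * (2 * g + 1))
      ≤ 32 * ((k + 1) ^ 2 * 4 ^ k * M ^ (k + 1)) * (8 * (2 ^ k * (k + 1) * (m + 1))) :=
        Nat.mul_le_mul hA hY
    _ = 256 * (4 ^ k * 2 ^ k) * (k + 1) ^ 3 * (m + 1) * M ^ (k + 1) := by ring
    _ ≤ 1000 * 64 ^ k * (k + 1) ^ 3 * (m + 1) * M ^ (k + 1) := by gcongr; norm_num
    _ ≤ 2 ^ (m / 2) * M ^ (k + 1) := Nat.mul_le_mul_right _ h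
    _ ≤ M * M ^ (k + 1) := by
        gcongr
        exact Nat.pow_le_pow_right (by norm_num) (by omega)
    _ = M ^ (k + 2) := by ring
    _ ≤ M ^ (2 * k + 1) := Nat.pow_le_pow_right hM1 (by omega)
    _ = 2 ^ g := hgM.symm

/-- All lengths appearing in the formulas are at most `2 ^ m`. -/
theorem IsLarge.width_le (h : IsLarge k m) (hr : r = m / 8)
    (hN : N = (2 ^ r + 1) * r) (hg : g = (2 * k + 1) * m) :
    40 * (N + g + k + 1) ≤ 2 ^ m := by
  have hmain := h.mul_add_le hr hN
  have h1 : N + g + k + 1 ≤ 2 * (k + 1) * (m + 1 + N) := by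
    rw [hg]
    nlinarith
  have h2 : 2 * (k + 1) * (m + 1 + N) ≤ 2 * (64 ^ k * (k + 1) ^ 3 * (m + 1 + N)) := by
    have h64 : 1 ≤ 64 ^ k := Nat.one_le_pow _ _ (by norm_num)
    have h3 : (k + 1) ≤ 64 ^ k * (k + 1) ^ 3 :=
      (Nat.le_self_pow (by norm_num) _).trans (Nat.le_mul_of_pos_left _ h64)
    calc 2 * (k + 1) * (m + 1 + N) ≤ 2 * (64 ^ k * (k + 1) ^ 3) * (m + 1 + N) := by gcongr
      _ = _ := by ring
  nlinarith

end Parameters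

/-- Even natural numbers, used as the variables of the first family. -/
def evenVar {N : ℕ} (i : Fin N) : ℕ := 2 * i.val

theorem evenVar_injective {N : ℕ} : Function.Injective (evenVar (N := N)) := by
  intro i j h
  simp only [evenVar] at h
  exact Fin.ext (by omega)

/-- Odd natural numbers, used as the variables of the second family. -/
noncomputable def oddVar {X : Type} [Fintype X] (z : X) : ℕ := 2 * (Fintype.equivFin X z).val + 1

theorem oddVar_injective {X : Type} [Fintype X] : Function.Injective (oddVar (X := X)) := by
  intro i j h
  simp only [oddVar] at h
  exact (Fintype.equivFin X).injective (Fin.ext (by omega))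

/-- The pigeonhole formulas in terms of the size parameter. -/
def pigeonFamily (n : ℕ) : Cnf ℕ := BitPigeonhole.formulaMap (Nat.clog 2 n / 8) evenVar

theorem exists_refutation_of_empty_mem {F : Set (Clause V)} (h : ∅ ∈ F) :
    ∃ P : List (Dnf V), IsResKRefutation 2 F P ∧ proofSize P = 0 := by
  have he : clauseToDnf (∅ : Clause V) = ∅ := by simp [clauseToDnf]
  refine ⟨[∅], ⟨by simp, by simp, by simp [IsKDnf], fun i => Or.inl ⟨∅, h, ?_⟩⟩, ?_⟩
  · rw [he]
    simp
  · simp [proofSize, dnfSize]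

/-- A finite set can be enumerated by addresses. -/
theorem exists_enumeration {α : Type} {g : ℕ} {s : Finset α} (hs : s.Nonempty)
    (hc : s.card ≤ 2 ^ g) :
    ∃ f : (Fin g → Bool) → α, (∀ e, f e ∈ s) ∧ ∀ a ∈ s, ∃ e, f e = a := by
  have hne : Nonempty s := hs.to_subtype
  obtain ⟨ι⟩ := Function.Embedding.nonempty_of_card_le (α := s) (β := Fin g → Bool)
    (by simpa using hc)
  exact ⟨fun e => (Function.invFun ι e).1, fun e => (Function.invFun ι e).2,
    fun a ha => ⟨ι ⟨a, ha⟩,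
      congrArg Subtype.val (Function.leftInverse_invFun ι.injective ⟨a, ha⟩)⟩⟩

theorem two_pow_clog_le {n : ℕ} (hn : 1 ≤ n) : 2 ^ Nat.clog 2 n ≤ 2 * n := by
  rcases Nat.lt_or_ge 1 n with h | h
  · have h1 := Nat.pow_pred_clog_lt_self (b := 2) (by norm_num) h
    have h2 : Nat.clog 2 n = (Nat.clog 2 n).pred + 1 :=
      (Nat.succ_pred_eq_of_pos (Nat.clog_pos (by norm_num) h)).symm
    rw [h2, pow_succ]
    omega
  · obtain rfl : n = 1 := by omega
    simp

/-- Formulas encoding decision trees for the pigeonhole formulas. -/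
theorem exists_tree_formula (n k : ℕ) (hk : 1 ≤ k) : ∃ B : Cnf ℕ,
    (2 ≤ n → cnfSize B ≤ n ^ (18 * k)) ∧ (∀ z ∈ cnfVars B, z % 2 = 1) ∧
    (IsLarge k (Nat.clog 2 n) → ∀ P : List (Dnf ℕ),
      IsResKRefutation k (↑B : Set (Clause ℕ)) P → 2 ^ n ≤ proofSize P + 1) ∧
    (1 ≤ n → ∃ P : List (Dnf ℕ),
      IsResKRefutation 2 (↑(pigeonFamily n ∪ B) : Set (Clause ℕ)) P ∧
        proofSize P ≤ 6 * k ^ 2 * n ^ (7 * k + 7)) := by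
  by_cases hl : IsLarge k (Nat.clog 2 n)
  swap
  · refine ⟨{∅}, fun hn => ?_, by simp [cnfVars], fun h => absurd h hl, fun _ => ?_⟩
    · simp only [cnfSize, Finset.sum_singleton, Finset.card_empty, zero_add]
      exact Nat.one_le_pow _ _ (by omega)
    · obtain ⟨P, hP, hs⟩ := exists_refutation_of_empty_mem
        (F := (↑(pigeonFamily n ∪ {∅}) : Set (Clause ℕ))) (by simp)
      exact ⟨P, hP, by omega⟩
  have hfam : pigeonFamily n = BitPigeonhole.formulaMap (Nat.clog 2 n / 8) evenVar := rfl
  have hnM : n ≤ 2 ^ Nat.clog 2 n := Nat.le_pow_clog (by norm_num) n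
  have hMn : 1 ≤ n → 2 ^ Nat.clog 2 n ≤ 2 * n := two_pow_clog_le
  generalize Nat.clog 2 n = m at *
  set r := m / 8 with hr
  set N := (2 ^ r + 1) * r with hN
  set g := (2 * k + 1) * m with hg
  have hw := hl.width_le hr hN hg
  have hpar := hl.parameters hk hr hN hg rfl rfl rfl
  have hm : 32 ≤ m := by
    by_contra hlt
    have h1 : 2 ^ (m / 2) ≤ 2 ^ 15 := Nat.pow_le_pow_right (by norm_num) (by omega)
    have h2 : 64 ^ 1 ≤ 64 ^ k := Nat.pow_le_pow_right (by norm_num) hk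
    have h3 : 2 ^ 3 ≤ (k + 1) ^ 3 := Nat.pow_le_pow_left (by omega) 3
    have h4 : 1000 * 64 ^ 1 * 2 ^ 3 * 1 ≤ 2 ^ (m / 2) :=
      le_trans (by gcongr; omega) hl
    norm_num at h1 h4
    omega
  have hgm : m ≤ g := Nat.le_mul_of_pos_left _ (by omega)
  have hMg : 2 ^ m ≤ 2 ^ g := Nat.pow_le_pow_right (by norm_num) hgm
  have hgpow : 2 ^ g * 2 ^ g = (2 ^ m) ^ (4 * k + 2) := by
    rw [hg, ← pow_add, ← pow_mul]
    congr 1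
    ring
  obtain ⟨Cl, hCl1, hCl2⟩ := exists_enumeration (g := g) (s := BitPigeonhole.formula r)
    (by
      obtain ⟨C, hC, -⟩ := BitPigeonhole.exists_falsified r fun _ => true
      exact ⟨C, hC⟩)
    ((BitPigeonhole.card_formula_le r).trans (Nat.pow_le_pow_right (by norm_num) (by omega)))
  set x : RefTree.RefVar N g (k + 1) → ℕ := oddVar with hx
  refine ⟨RefTree.formula x Cl, fun hn => ?_, fun z hz => ?_, fun _ P hP => ?_, fun hn => ?_⟩
  · refine RefTree.cnfSize_formula_le.trans ?_
    rw [hgpow]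
    have h1 : 2 * N * (2 * N + (k + 1 + 1)) + 2 * N + (k + 1) ≤ 2 ^ m * 2 ^ m := by
      nlinarith
    calc (2 ^ m) ^ (4 * k + 2) * (2 * N * (2 * N + (k + 1 + 1)) + 2 * N + (k + 1)) *
          (k + 1 + g + 3) ≤ (2 ^ m) ^ (4 * k + 2) * (2 ^ m * 2 ^ m) * 2 ^ m := by
          gcongr
          omega
      _ = (2 ^ m) ^ (4 * k + 5) := by ring
      _ ≤ (n ^ 2) ^ (4 * k + 5) := Nat.pow_le_pow_left ((hMn (by omega)).trans (by nlinarith)) _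
      _ = n ^ (2 * (4 * k + 5)) := by rw [pow_mul]
      _ ≤ _ := Nat.pow_le_pow_right (by omega) (by omega)
  · obtain ⟨w, rfl⟩ := RefTree.mem_cnfVars_formula hz
    simp only [hx, oddVar]
    omega
  · refine le_trans (Nat.pow_le_pow_right (by norm_num) hnM)
      (RefTree.two_pow_le_proofSize_add_one oddVar_injective (fun D => ?_) ?_ rfl rfl rfl hpar hP)
    · obtain ⟨C, hC, hf⟩ := BitPigeonhole.exists_falsified r D
      obtain ⟨e, he⟩ := hCl2 C hC
      exact ⟨e, he ▸ hf⟩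
    · omega
  · obtain ⟨P, hP, hs⟩ := RefTree.exists_resTwo_refutation x (evenVar (N := N)) (Cl := Cl)
      (F := (↑(pigeonFamily n ∪ RefTree.formula x Cl) : Set (Clause ℕ)))
      (fun C hC => Finset.mem_coe.2 (Finset.mem_union_right _ (RefTree.mem_formula.2 hC)))
      (fun e => Finset.mem_coe.2 (Finset.mem_union_left _
        (hfam ▸ Finset.mem_image_of_mem _ (hCl1 e))))
      (fun e => (BitPigeonhole.card_le_of_mem_formula (hCl1 e)).trans
        (Nat.mul_le_mul_right _ (by have := Nat.one_le_two_pow (n := r); omega)))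
    refine ⟨P, hP, hs.trans ?_⟩
    rw [hgpow]
    have h2 : 2 ^ (4 * k + 6) ≤ 2 ^ m := by
      have h3 : 2 ^ (4 * k + 6) ≤ 2 ^ (m / 2) := by
        refine le_trans ?_ hl
        have h4 : 2 ^ (4 * k + 6) = 64 * 16 ^ k := by
          rw [pow_add, pow_mul]
          norm_num
          ring
        have h5 : 16 ^ k ≤ 64 ^ k := Nat.pow_le_pow_left (by norm_num) k
        calc 2 ^ (4 * k + 6) ≤ 1000 * 64 ^ k * 1 * 1 := by omega
          _ ≤ _ := by
            gcongr
            · exact Nat.one_le_pow _ _ (by omega)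
            · omega
      exact h3.trans (Nat.pow_le_pow_right (by norm_num) (by omega))
    calc (N + 2) * ((2 ^ m) ^ (4 * k + 2) * (32 * N + 8 * (k + 1) + 11)) *
          (3 * (2 * (N + g + 2 * (k + 1 + (N + 2 * g))) + 1) ^ 2)
        ≤ 2 ^ m * ((2 ^ m) ^ (4 * k + 2) * 2 ^ m) * (3 * (2 ^ m) ^ 2) := by
          gcongr <;> omega
      _ = 3 * (2 ^ m) ^ (4 * k + 6) := by ring
      _ ≤ 3 * (2 * n) ^ (4 * k + 6) := by gcongr; exact hMn hn
      _ = 3 * (2 ^ (4 * k + 6) * n ^ (4 * k + 6)) := by rw [mul_pow]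
      _ ≤ 3 * (2 * n * n ^ (4 * k + 6)) := by gcongr; exact h2.trans (hMn hn)
      _ = 6 * 1 * n ^ (4 * k + 7) := by ring
      _ ≤ 6 * k ^ 2 * n ^ (7 * k + 7) := by
          gcongr
          · exact Nat.one_le_pow _ _ hk
          · omega

theorem cnfSize_pigeonFamily_le {n : ℕ} (hn : 1 ≤ n) : cnfSize (pigeonFamily n) ≤ n ^ 4 := by
  rcases Nat.lt_or_ge 1 n with h | h
  · have hm : 1 ≤ Nat.clog 2 n := Nat.clog_pos (by norm_num) h
    have hM := two_pow_clog_le hn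
    refine (BitPigeonhole.cnfSize_formulaMap_le _ _).trans ?_
    generalize Nat.clog 2 n = m at *
    have h1 : 2 * (m / 8) + 1 ≤ 2 ^ (m / 8 + 1) := by
      have : m / 8 + 1 ≤ 2 ^ (m / 8) := Nat.lt_two_pow_self
      rw [pow_succ]
      omega
    calc 2 ^ (3 * (m / 8) + 2) * (2 * (m / 8) + 1)
        ≤ 2 ^ (3 * (m / 8) + 2) * 2 ^ (m / 8 + 1) := Nat.mul_le_mul_left _ h1
      _ = 2 ^ (3 * (m / 8) + 2 + (m / 8 + 1)) := by rw [← pow_add]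
      _ ≤ 2 ^ (m + 2) := Nat.pow_le_pow_right (by norm_num) (by omega)
      _ = 2 ^ m * 2 ^ 2 := by rw [pow_add]
      _ ≤ 2 * n * 2 ^ 2 := Nat.mul_le_mul_right _ hM
      _ = 2 ^ 3 * n := by ring
      _ ≤ n ^ 3 * n := Nat.mul_le_mul_right _ (Nat.pow_le_pow_left h 3)
      _ = n ^ 4 := by ring
  · obtain rfl : n = 1 := by omega
    have hsub : pigeonFamily 1 ⊆ {∅} := by
      intro C hC
      obtain ⟨C', hC', rfl⟩ := Finset.mem_image.1 hC
      have hc := BitPigeonhole.card_le_of_mem_formula hC'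
      have h0 : C' = ∅ := by
        rw [← Finset.card_eq_zero]
        simpa using hc
      simp [h0]
    calc cnfSize (pigeonFamily 1) ≤ ∑ C ∈ {(∅ : Clause ℕ)}, (C.card + 1) :=
          Finset.sum_le_sum_of_subset hsub
      _ = 1 ^ 4 := by simp

theorem exists_clog_ge (a : ℕ) : ∃ n₀, ∀ n, n₀ ≤ n → a ≤ Nat.clog 2 n := by
  refine ⟨2 ^ a, fun n hn => ?_⟩
  have := Nat.clog_mono_right 2 hn
  rwa [Nat.clog_pow 2 a (by norm_num)] at this

theorem two_rpow_lt_of_two_pow_le {s : ℝ} {L a : ℕ} (hs : 0 < s) (h : s + 1 ≤ a)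
    (hL : 2 ^ a ≤ L + 1) : (2 : ℝ) ^ s < L := by
  have h1 : (2 : ℝ) ^ (s + 1) ≤ L + 1 := by
    calc (2 : ℝ) ^ (s + 1) ≤ 2 ^ (a : ℝ) := Real.rpow_le_rpow_of_exponent_le (by norm_num) h
      _ = 2 ^ a := Real.rpow_natCast 2 a
      _ ≤ _ := by exact_mod_cast hL
  have h2 : (1 : ℝ) < 2 ^ s := Real.one_lt_rpow (by norm_num) hs
  rw [Real.rpow_add (by norm_num), Real.rpow_one] at h1
  linarith

/-- There are families `A n` and `B n k` of CNFs of polynomial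
(resp. `n^{O(k)}`) size, sharing no variables, such that: (i) `A n` requires Res(k)
refutations of size greater than `2^{n^α}` for all `k`; (ii) `B n k` requires Res(k)
refutations of size greater than `2^{β n}`; (iii) `A n ∧ B n k` has Res(2) refutations
of size `O(k² n^{7k+7})`. -/
theorem disjunction_hard_families :
    ∃ (A : ℕ → Cnf ℕ) (B : ℕ → ℕ → Cnf ℕ) (d₁ d₂ : ℕ), 0 < d₁ ∧ 0 < d₂ ∧
      (∀ n : ℕ, 1 ≤ n → cnfSize (A n) ≤ n ^ d₁) ∧
      (∀ n k : ℕ, 2 ≤ n → 1 ≤ k → cnfSize (B n k) ≤ n ^ (d₂ * k)) ∧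
      (∀ n k : ℕ, 1 ≤ n → 1 ≤ k → Disjoint (cnfVars (A n)) (cnfVars (B n k))) ∧
      -- (i) the A_n are exponentially hard for Res(k), for every k
      (∃ α : ℝ, 0 < α ∧ ∃ n₁ : ℕ,
        ∀ k n : ℕ, 1 ≤ k → n₁ ≤ n →
          ∀ P : List (Dnf ℕ), IsResKRefutation k (↑(A n) : Set (Clause ℕ)) P →
            (2 : ℝ) ^ ((n : ℝ) ^ α) < (proofSize P : ℝ)) ∧
      -- (ii) the B_{n,k} are exponentially hard for Res(k)
      (∀ k : ℕ, 1 ≤ k → ∃ β : ℝ, 0 < β ∧ ∃ n₂ : ℕ,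
        ∀ n : ℕ, n₂ ≤ n →
          ∀ P : List (Dnf ℕ), IsResKRefutation k (↑(B n k) : Set (Clause ℕ)) P →
            (2 : ℝ) ^ (β * (n : ℝ)) < (proofSize P : ℝ)) ∧
      -- (iii) `A n ∧ B n k` has short Res(2) refutations
      (∃ c : ℕ, 0 < c ∧ ∀ n k : ℕ, 1 ≤ n → 1 ≤ k →
        ∃ P : List (Dnf ℕ), IsResKRefutation 2 (↑(A n ∪ B n k) : Set (Clause ℕ)) P ∧
          proofSize P ≤ c * k ^ 2 * n ^ (7 * k + 7)) := by
  choose B hB using fun n k => exists_tree_formula n (k + 1) (Nat.succ_pos k)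
  refine ⟨pigeonFamily, fun n k => B n (k - 1), 4, 18, by norm_num, by norm_num,
    fun n => cnfSize_pigeonFamily_le, fun n k hn hk => ?_, fun n k _ hk => ?_,
    ⟨1 / 224, by norm_num, ?_⟩, fun k hk => ⟨1 / 2, by norm_num, ?_⟩, 6, by norm_num,
    fun n k hn hk => ?_⟩
  · have := (hB n (k - 1)).1 hn
    rwa [Nat.sub_add_cancel hk] at this
  · rw [Finset.disjoint_left]
    intro z hz hz'
    have h1 := (hB n (k - 1)).2.1 z hz'
    obtain ⟨i, rfl⟩ := BitPigeonhole.mem_cnfVars_formulaMap hz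
    simp only [evenVar] at h1
    omega
  · obtain ⟨n₁, hn₁⟩ := exists_clog_ge 2000
    refine ⟨n₁, fun k n _ hn P hP => ?_⟩
    have hm := hn₁ n hn
    have hn0 : 0 < n := Nat.pos_of_ne_zero fun h => by simp [h] at hm
    have hnM : n ≤ 2 ^ Nat.clog 2 n := Nat.le_pow_clog (by norm_num) n
    have hlow := BitPigeonhole.formulaMap_lower_bound (v := (Nat.clog 2 n / 8 - 66) / 14)
      (by omega) evenVar_injective hP
    generalize Nat.clog 2 n = m at *
    obtain ⟨v, hv⟩ : ∃ v, (m / 8 - 66) / 14 = v + 1 := ⟨(m / 8 - 66) / 14 - 1, by omega⟩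
    have hmv : m ≤ 224 * v := by omega
    rw [hv] at hlow
    refine two_rpow_lt_of_two_pow_le (by positivity) ?_ hlow
    have h1 : (n : ℝ) ^ (1 / 224 : ℝ) ≤ 2 ^ v := by
      calc (n : ℝ) ^ (1 / 224 : ℝ) ≤ (2 ^ (224 * v) : ℝ) ^ (1 / 224 : ℝ) := by
            refine Real.rpow_le_rpow (by positivity) ?_ (by norm_num)
            exact_mod_cast hnM.trans (Nat.pow_le_pow_right (by norm_num) hmv)
        _ = 2 ^ v := by
            rw [mul_comm, pow_mul, ← Real.rpow_natCast _ 224, ← Real.rpow_mul (by positivity)]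
            norm_num
    have h2 : (1 : ℝ) ≤ 2 ^ v := one_le_pow₀ (by norm_num)
    push_cast
    rw [pow_succ]
    linarith
  · obtain ⟨m₀, hm₀⟩ := exists_isLarge k
    obtain ⟨n₂, hn₂⟩ := exists_clog_ge m₀
    refine ⟨max n₂ 2, fun n hn P hP => ?_⟩
    have hn2 : (2 : ℝ) ≤ n := by exact_mod_cast (le_max_right _ _).trans hn
    have h1 := (hB n (k - 1)).2.2.1
    rw [Nat.sub_add_cancel hk] at h1
    refine two_rpow_lt_of_two_pow_le (by linarith) (by linarith)
      (h1 (hm₀ _ (hn₂ n ((le_max_left _ _).trans hn))) P hP)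
  · have := (hB n (k - 1)).2.2.2 hn
    rwa [Nat.sub_add_cancel hk] at this
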